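/- arXiv:2401.17936 — 3 statements merged into one kernel-verified Lean document; each statement's English description precedes it below -/
import Mathlib

section
/- Assume hypotheses (D), (M), (I), and fix ε∈[0,1/5]. Then for all (t₁,t₀)∈ℝ² with t₁≥t₀ and all u₀∈C_γ, the attainability set Φ^ε(t₁,t₀,u₀) is a compact subset of C_γ. Moreover, Φ^ε is upper semicontinuous in the initial datum: for every u₀∈C_γ, every t₁≥t₀, and every open neighborhood V of Φ^ε(t₁,t₀,u₀) in C_γ, there exists δ>0 such that Φ^ε(t₁,t₀,u) ⊂ V for all u∈C_γ with ‖u−u₀‖_γ < δ. -/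
open MeasureTheory Set Filter Topology Pointwise

noncomputable section

/-- Index set for the synaptic variables `z i j`, `i ≠ j`. -/
abbrev IdxZ (n : ℕ) := {p : Fin n × Fin n // p.1 ≠ p.2}

/-- The state space `ℝ^{n²} = ℝ^n × ℝ^{n(n-1)}`, with the norm
`‖(x,z)‖ = max (‖x‖_∞) (‖z‖_∞)` (product of supremum norms). -/
abbrev NState (n : ℕ) := (Fin n → ℝ) × (IdxZ n → ℝ)

/-- The `C_γ` norm: `‖u‖_γ = sup_{t ≤ 0} e^{γ t} ‖u t‖`. -/
def gNorm (γ : ℝ) {E : Type*} [NormedAddCommGroup E] (u : ℝ → E) : ℝ :=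
  ⨆ t : Iic (0 : ℝ), Real.exp (γ * t.1) * ‖u t.1‖

/-- Membership in `C_γ`: continuity on `(-∞,0]`, existence of a finite limit of
`e^{γ t} u t` as `t → -∞`, and boundedness of `e^{γ t} ‖u t‖` on `(-∞,0]`. -/
def InC (γ : ℝ) {E : Type*} [NormedAddCommGroup E] [NormedSpace ℝ E] (u : ℝ → E) : Prop :=
  ContinuousOn u (Iic 0) ∧
    (∃ L : E, Tendsto (fun t => Real.exp (γ * t) • u t) atBot (𝓝 L)) ∧
    BddAbove (range fun t : Iic (0 : ℝ) => Real.exp (γ * t.1) * ‖u t.1‖)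

/-- The history `u_t(s) = u (t+s)`. -/
def hist {E : Type*} (u : ℝ → E) (t : ℝ) : ℝ → E := fun s => u (t + s)

/-- The sigmoidal function `σ_ε (s) = 1/(1+e^{-s/ε})`. -/
def sigm (ε s : ℝ) : ℝ := 1 / (1 + Real.exp (-s / ε))

/-- Hypothesis (D): `A i`, `B p` locally Lipschitz and bounded below by `α > 0`. -/
def HypD {n : ℕ} (α : ℝ) (A : Fin n → ℝ → ℝ) (B : IdxZ n → ℝ → ℝ) : Prop :=
  0 < α ∧ (∀ i, LocallyLipschitz (A i) ∧ ∀ s, α ≤ A i s) ∧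
    ∀ p, LocallyLipschitz (B p) ∧ ∀ s, α ≤ B p s

/-- Hypothesis (M): `∫_{-∞}^0 e^{-γ t} dμ_p (t) < ∞`. -/
def HypM {n : ℕ} (γ : ℝ) (μ : IdxZ n → Measure ℝ) : Prop :=
  ∀ p, ∫⁻ t in Iic (0 : ℝ), ENNReal.ofReal (Real.exp (-γ * t)) ∂(μ p) < ⊤

/-- Hypothesis (I): continuity of the external stimuli. -/
def HypI {n : ℕ} (Istim : Fin n → ℝ → ℝ) : Prop := ∀ i, Continuous (Istim i)

/-- Decay term `D`. -/
def decayT {n : ℕ} (A : Fin n → ℝ → ℝ) (B : IdxZ n → ℝ → ℝ) (u : ℝ → NState n) : NState n :=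
  (fun i => -(A i ((u 0).1 i)) * (u 0).1 i, fun p => -(B p ((u 0).2 p)) * (u 0).2 p)

/-- Sigmoidal excitation and inhibition term `Σ^ε`. -/
def sigTerm {n : ℕ} (ε : ℝ) (μ : IdxZ n → Measure ℝ) (c d : IdxZ n → ℝ)
    (Γ : Fin n → ℝ) (u : ℝ → NState n) : NState n :=
  (fun i => ∑ k : Fin n,
      if h : k ≠ i then
        ((u 0).2 ⟨(k, i), h⟩ - c ⟨(k, i), h⟩) *
          ∫ τ in Iic (0 : ℝ), sigm ε ((u τ).1 k - Γ k) ∂(μ ⟨(k, i), h⟩)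
      else 0,
    fun p =>
      d p * (∫ τ in Iic (0 : ℝ), sigm ε ((u τ).1 p.1.1 - Γ p.1.1) ∂(μ p)) *
        max ((u 0).1 p.1.2) 0)

/-- Stimulus term `I(t) = ((I_i(t))_i, 0)`. -/
def stimT {n : ℕ} (Istim : Fin n → ℝ → ℝ) (t : ℝ) : NState n :=
  (fun i => Istim i t, 0)

/-- Right-hand side `f_ε(t,u) = D(u) + Σ^ε(u) + I(t)` of the sigmoidal system. -/
def fEps {n : ℕ} (ε : ℝ) (A : Fin n → ℝ → ℝ) (B : IdxZ n → ℝ → ℝ)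
    (μ : IdxZ n → Measure ℝ) (c d : IdxZ n → ℝ) (Γ : Fin n → ℝ)
    (Istim : Fin n → ℝ → ℝ) (t : ℝ) (u : ℝ → NState n) : NState n :=
  decayT A B u + sigTerm ε μ c d Γ u + stimT Istim t

/-- Solution of the sigmoidal system on `[t₀, t₁)` with initial datum `u₀` at `t₀`. -/
def IsSigSolOn {n : ℕ} (ε : ℝ) (A : Fin n → ℝ → ℝ) (B : IdxZ n → ℝ → ℝ)
    (μ : IdxZ n → Measure ℝ) (c d : IdxZ n → ℝ) (Γ : Fin n → ℝ)
    (Istim : Fin n → ℝ → ℝ) (t₀ t₁ : ℝ) (u₀ u : ℝ → NState n) : Prop :=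
  (∀ s ≤ (0 : ℝ), u (t₀ + s) = u₀ s) ∧ ContinuousOn u (Iio t₁) ∧
    ∀ t ∈ Ico t₀ t₁, HasDerivAt u (fEps ε A B μ c d Γ Istim t (hist u t)) t

/-- Solution of the sigmoidal system on the closed interval `[t₀, t₁]`. -/
def IsSigSolOnC {n : ℕ} (ε : ℝ) (A : Fin n → ℝ → ℝ) (B : IdxZ n → ℝ → ℝ)
    (μ : IdxZ n → Measure ℝ) (c d : IdxZ n → ℝ) (Γ : Fin n → ℝ)
    (Istim : Fin n → ℝ → ℝ) (t₀ t₁ : ℝ) (u₀ u : ℝ → NState n) : Prop :=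
  (∀ s ≤ (0 : ℝ), u (t₀ + s) = u₀ s) ∧ ContinuousOn u (Iic t₁) ∧
    ∀ t ∈ Ico t₀ t₁, HasDerivAt u (fEps ε A B μ c d Γ Istim t (hist u t)) t

/-- `b(ε) = ε log((1-ε)/ε)` for `ε ≠ 0`, `b(0) = 0`. -/
def bfun (ε : ℝ) : ℝ := if ε = 0 then 0 else ε * Real.log ((1 - ε) / ε)

/-- The set-valued function `χ_ε`. -/
def chiSet (ε s : ℝ) : Set ℝ :=
  if s < -bfun ε then Icc 0 ε else if s ≤ bfun ε then Icc 0 1 else Icc (1 - ε) 1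

/-- Aumann integral over `(-∞,0]` of a set-valued map `F` with respect to `μ`:
the set of integrals of integrable measurable selectors of `F`. -/
def aumann (F : ℝ → Set ℝ) (μ : Measure ℝ) : Set ℝ :=
  {y | ∃ s : ℝ → ℝ, Measurable s ∧ IntegrableOn s (Iic 0) μ ∧
      (∀ t ≤ (0 : ℝ), s t ∈ F t) ∧ y = ∫ t in Iic (0 : ℝ), s t ∂μ}

/-- Directed Hausdorff pseudometric `haus(A,B) = sup_{a∈A} inf_{b∈B} |a-b|`. -/
def hausd (S T : Set ℝ) : ℝ :=
  sSup ((fun a => sInf ((fun b => |a - b|) '' T)) '' S)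

/-- The `i`-th factor of `X^ε(u)`: the Minkowski sum over `k ≠ i` of
`(z_{ki}(0) - c_{ki}) • ∫ χ_ε(x_k(τ)-Γ_k) dμ_{ki}(τ)`. -/
def XsetX {n : ℕ} (ε : ℝ) (μ : IdxZ n → Measure ℝ) (c : IdxZ n → ℝ)
    (Γ : Fin n → ℝ) (u : ℝ → NState n) (i : Fin n) : Set ℝ :=
  {y | ∃ g : Fin n → ℝ, g i = 0 ∧
      (∀ k, ∀ h : k ≠ i,
        g k ∈ ((u 0).2 ⟨(k, i), h⟩ - c ⟨(k, i), h⟩) •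
          aumann (fun τ => chiSet ε ((u τ).1 k - Γ k)) (μ ⟨(k, i), h⟩)) ∧
      y = ∑ k, g k}

/-- The set-valued map `X^ε : C_γ → 𝒫(ℝ^{n²})`. -/
def Xset {n : ℕ} (ε : ℝ) (μ : IdxZ n → Measure ℝ) (c d : IdxZ n → ℝ)
    (Γ : Fin n → ℝ) (u : ℝ → NState n) : Set (NState n) :=
  {v | (∀ i, v.1 i ∈ XsetX ε μ c Γ u i) ∧
      ∀ p : IdxZ n, v.2 p ∈ (d p * max ((u 0).1 p.1.2) 0) •
        aumann (fun τ => chiSet ε ((u τ).1 p.1.1 - Γ p.1.1)) (μ p)}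

/-- Solution of the `ε`-inflated differential inclusion on `[t₀,t₁]` with initial
datum `u₀` at `t₀`: absolutely continuous on `[t₀,t₁]` (expressed in integral form)
with `u'(t) = D(u_t) + Σ(t) + I(t)` a.e. for some integrable selector `Σ(t) ∈ X^ε(u_t)`. -/
def IsIncSolOn {n : ℕ} (ε : ℝ) (A : Fin n → ℝ → ℝ) (B : IdxZ n → ℝ → ℝ)
    (μ : IdxZ n → Measure ℝ) (c d : IdxZ n → ℝ) (Γ : Fin n → ℝ)
    (Istim : Fin n → ℝ → ℝ) (t₀ t₁ : ℝ) (u₀ u : ℝ → NState n) : Prop :=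
  (∀ s ≤ (0 : ℝ), u (t₀ + s) = u₀ s) ∧ ContinuousOn u (Icc t₀ t₁) ∧
    ∃ S : ℝ → NState n,
      (∀ t ∈ Icc t₀ t₁, S t ∈ Xset ε μ c d Γ (hist u t)) ∧
      IntegrableOn (fun s => decayT A B (hist u s) + S s + stimT Istim s) (Icc t₀ t₁) ∧
      ∀ t ∈ Icc t₀ t₁,
        u t = u₀ 0 + ∫ s in t₀..t, (decayT A B (hist u s) + S s + stimT Istim s)

/-- Clamped history: the canonical representative in `C_γ` of the history `u_t`. -/
def clampHist {n : ℕ} (u : ℝ → NState n) (t : ℝ) : ℝ → NState n :=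
  fun s => u (t + min s 0)

/-- Attainability set `Φ^ε(t, t₀, u₀)` of the `ε`-inflated inclusion. -/
def attain {n : ℕ} (ε : ℝ) (A : Fin n → ℝ → ℝ) (B : IdxZ n → ℝ → ℝ)
    (μ : IdxZ n → Measure ℝ) (c d : IdxZ n → ℝ) (Γ : Fin n → ℝ)
    (Istim : Fin n → ℝ → ℝ) (t t₀ : ℝ) (u₀ : ℝ → NState n) : Set (ℝ → NState n) :=
  {v | ∃ u, IsIncSolOn ε A B μ c d Γ Istim t₀ t u₀ u ∧ v = clampHist u t}

/-- Total mass `|μ_p|` of the measure `μ_p` on `(-∞,0]`. -/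
def mTot {n : ℕ} (μ : IdxZ n → Measure ℝ) (p : IdxZ n) : ℝ := (μ p (Iic 0)).toReal

/-- Hypothesis (A). -/
def HypA {n : ℕ} (α : ℝ) (μ : IdxZ n → Measure ℝ) (d : IdxZ n → ℝ) : Prop :=
  ∃ lx lz nx nz eta eps : IdxZ n → ℝ,
    (∀ p, lx p ∈ ({1, mTot μ p ^ 2, d p ^ 2, mTot μ p ^ 2 * d p ^ 2} : Set ℝ) ∧
        lz p ∈ ({1, mTot μ p ^ 2, d p ^ 2, mTot μ p ^ 2 * d p ^ 2} : Set ℝ) ∧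
        lx p * lz p = mTot μ p ^ 2 * d p ^ 2 ∧
        nx p ∈ ({1, mTot μ p ^ 2} : Set ℝ) ∧ nz p ∈ ({1, mTot μ p ^ 2} : Set ℝ) ∧
        nx p * nz p = mTot μ p ^ 2 ∧ 0 < eta p ∧ 0 < eps p ∧
        nz p / eta p + lz p / eps p < 2 * α) ∧
    ∀ i : Fin n,
      (∑ k : Fin n, if h : k ≠ i then
          nx ⟨(k, i), h⟩ * eta ⟨(k, i), h⟩ + lx ⟨(k, i), h⟩ * eps ⟨(k, i), h⟩
        else 0) < 2 * α

/-- Directed Hausdorff "distance" between subsets of `C_γ`, w.r.t. `‖·‖_γ`. -/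
def setDistG (γ : ℝ) {n : ℕ} (S T : Set (ℝ → NState n)) : ℝ :=
  sSup ((fun a => sInf ((fun b => gNorm γ (fun s => a s - b s)) '' T)) '' S)


def chiLo (ε s : ℝ) : ℝ := if s ≤ bfun ε then 0 else 1 - ε
def chiHi (ε s : ℝ) : ℝ := if s < -bfun ε then ε else 1

lemma bfun_nonneg {ε : ℝ} (hε : ε ∈ Icc (0 : ℝ) (1 / 5)) : 0 ≤ bfun ε := by
  unfold bfun
  split_ifs with h
  · exact le_rfl
  · have h0 : 0 < ε := lt_of_le_of_ne hε.1 (Ne.symm h)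
    apply mul_nonneg hε.1
    apply Real.log_nonneg
    rw [le_div_iff₀ h0]
    linarith [hε.2]

lemma chiSet_eq {ε : ℝ} (hε : ε ∈ Icc (0 : ℝ) (1 / 5)) (s : ℝ) :
    chiSet ε s = Icc (chiLo ε s) (chiHi ε s) := by
  have hb := bfun_nonneg hε
  unfold chiSet chiLo chiHi
  by_cases h1 : s < -bfun ε
  · have h2 : s ≤ bfun ε := by linarith
    simp [h1, h2]
  · by_cases h2 : s ≤ bfun ε <;> simp [h1, h2]

lemma chi_bounds {ε : ℝ} (hε : ε ∈ Icc (0 : ℝ) (1 / 5)) (s : ℝ) :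
    0 ≤ chiLo ε s ∧ chiLo ε s ≤ chiHi ε s ∧ chiHi ε s ≤ 1 := by
  have hb := bfun_nonneg hε
  have h0 := hε.1
  have h1 := hε.2
  unfold chiLo chiHi
  refine ⟨?_, ?_, ?_⟩ <;> split_ifs <;> linarith

lemma measurable_chiLo (ε : ℝ) : Measurable (chiLo ε) :=
  Measurable.ite measurableSet_Iic measurable_const measurable_const

lemma measurable_chiHi (ε : ℝ) : Measurable (chiHi ε) :=
  Measurable.ite measurableSet_Iio measurable_const measurable_const

lemma chiHi_usc {ε : ℝ} (hε : ε ∈ Icc (0 : ℝ) (1 / 5)) {ι : Type*} {l : Filter ι} {x : ι → ℝ}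
    {y : ℝ} (h : Tendsto x l (𝓝 y)) : ∀ᶠ a in l, chiHi ε (x a) ≤ chiHi ε y := by
  by_cases hy : y < -bfun ε
  · filter_upwards [h.eventually (Iio_mem_nhds hy)] with a ha
    have : x a < -bfun ε := ha
    simp [chiHi, hy, this]
  · refine Eventually.of_forall fun a => ?_
    have := (chi_bounds hε (x a)).2.2
    simpa [chiHi, hy] using this

lemma chiLo_lsc {ε : ℝ} (hε : ε ∈ Icc (0 : ℝ) (1 / 5)) {ι : Type*} {l : Filter ι} {x : ι → ℝ}
    {y : ℝ} (h : Tendsto x l (𝓝 y)) : ∀ᶠ a in l, chiLo ε y ≤ chiLo ε (x a) := by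
  by_cases hy : bfun ε < y
  · filter_upwards [h.eventually (Ioi_mem_nhds hy)] with a ha
    have : bfun ε < x a := ha
    simp [chiLo, not_le.2 hy, not_le.2 this]
  · refine Eventually.of_forall fun a => ?_
    have := (chi_bounds hε (x a)).1
    push Not at hy
    simpa [chiLo, hy] using this

/-- lower integral -/
def iLo (ε : ℝ) (ν : Measure ℝ) (y : ℝ → ℝ) : ℝ := ∫ τ in Iic (0 : ℝ), chiLo ε (y τ) ∂ν
/-- upper integral -/
def iHi (ε : ℝ) (ν : Measure ℝ) (y : ℝ → ℝ) : ℝ := ∫ τ in Iic (0 : ℝ), chiHi ε (y τ) ∂ν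

lemma integrable_bdd {ν : Measure ℝ} (hν : ν (Iic 0) < ⊤) {g : ℝ → ℝ} (hg : Measurable g)
    (h0 : ∀ s, 0 ≤ g s ∧ g s ≤ 1) {y : ℝ → ℝ} (hy : ContinuousOn y (Iic 0)) :
    IntegrableOn (fun τ => g (y τ)) (Iic 0) ν := by
  have : IsFiniteMeasure (ν.restrict (Iic 0)) := ⟨by simpa using hν⟩
  refine Integrable.of_bound (C := 1)
    ((hg.comp_aemeasurable (hy.aemeasurable measurableSet_Iic)).aestronglyMeasurable) ?_
  refine Eventually.of_forall fun τ => ?_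
  rw [Real.norm_eq_abs, abs_of_nonneg (h0 _).1]
  exact (h0 _).2

lemma lo01 {ε : ℝ} (hε : ε ∈ Icc (0 : ℝ) (1 / 5)) (s : ℝ) : 0 ≤ chiLo ε s ∧ chiLo ε s ≤ 1 :=
  ⟨(chi_bounds hε s).1, (chi_bounds hε s).2.1.trans (chi_bounds hε s).2.2⟩

lemma hi01 {ε : ℝ} (hε : ε ∈ Icc (0 : ℝ) (1 / 5)) (s : ℝ) : 0 ≤ chiHi ε s ∧ chiHi ε s ≤ 1 :=
  ⟨(chi_bounds hε s).1.trans (chi_bounds hε s).2.1, (chi_bounds hε s).2.2⟩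

lemma i_bounds {ε : ℝ} (hε : ε ∈ Icc (0 : ℝ) (1 / 5)) {ν : Measure ℝ} (hν : ν (Iic 0) < ⊤)
    {y : ℝ → ℝ} (hy : ContinuousOn y (Iic 0)) :
    0 ≤ iLo ε ν y ∧ iLo ε ν y ≤ iHi ε ν y ∧ iHi ε ν y ≤ (ν (Iic 0)).toReal := by
  refine ⟨integral_nonneg fun τ => (chi_bounds hε _).1, ?_, ?_⟩
  · exact integral_mono (integrable_bdd hν (measurable_chiLo ε) (lo01 hε) hy)
      (integrable_bdd hν (measurable_chiHi ε) (hi01 hε) hy) fun τ => (chi_bounds hε _).2.1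
  · have : iHi ε ν y ≤ ∫ τ in Iic (0 : ℝ), (1 : ℝ) ∂ν := by
      refine integral_mono (integrable_bdd hν (measurable_chiHi ε) (hi01 hε) hy) ?_
        fun τ => (chi_bounds hε _).2.2
      have : IsFiniteMeasure (ν.restrict (Iic 0)) := ⟨by simpa using hν⟩
      exact integrable_const _
    simpa [Measure.real] using this

lemma exists_conv {L H y : ℝ} (hy : y ∈ Icc L H) : ∃ t ∈ Icc (0 : ℝ) 1, y = L + t * (H - L) := by
  rcases eq_or_lt_of_le (hy.1.trans hy.2) with h | h
  · exact ⟨0, by simp, by have := hy.1; have := hy.2; linarith⟩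
  · have : 0 < H - L := by linarith
    refine ⟨(y - L) / (H - L), ⟨div_nonneg (by linarith [hy.1]) this.le, ?_⟩, by field_simp; ring⟩
    rw [div_le_one this]; linarith [hy.2]

lemma aumann_eq {ε : ℝ} (hε : ε ∈ Icc (0 : ℝ) (1 / 5)) {ν : Measure ℝ} (hν : ν (Iic 0) < ⊤)
    {y : ℝ → ℝ} (hy : ContinuousOn y (Iic 0)) :
    aumann (fun τ => chiSet ε (y τ)) ν = Icc (iLo ε ν y) (iHi ε ν y) := by
  have iL := integrable_bdd hν (measurable_chiLo ε) (lo01 hε) hy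
  have iH := integrable_bdd hν (measurable_chiHi ε) (hi01 hε) hy
  ext w
  constructor
  · rintro ⟨s, hs, hsi, hsel, rfl⟩
    constructor
    · refine setIntegral_mono_on iL hsi measurableSet_Iic fun τ hτ => ?_
      have := hsel τ hτ
      rw [show (fun τ => chiSet ε (y τ)) τ = chiSet ε (y τ) from rfl, chiSet_eq hε] at this
      exact this.1
    · refine setIntegral_mono_on hsi iH measurableSet_Iic fun τ hτ => ?_
      have := hsel τ hτ
      rw [show (fun τ => chiSet ε (y τ)) τ = chiSet ε (y τ) from rfl, chiSet_eq hε] at this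
      exact this.2
  · intro hw
    obtain ⟨t, ht, rfl⟩ := exists_conv hw
    have hc : Continuous fun τ => y (min τ 0) := by
      have : Continuous (fun τ : ℝ => min τ 0) := by fun_prop
      exact hy.comp_continuous this fun τ => Set.mem_Iic.2 (min_le_right _ _)
    have heq : EqOn (fun τ => chiLo ε (y τ) + t * (chiHi ε (y τ) - chiLo ε (y τ)))
      (fun τ => chiLo ε (y (min τ 0)) + t * (chiHi ε (y (min τ 0)) - chiLo ε (y (min τ 0))))
      (Iic 0) := by
      intro τ hτ
      have : min τ 0 = τ := min_eq_left hτ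
      simp only [this]
    refine ⟨fun τ => chiLo ε (y (min τ 0)) + t * (chiHi ε (y (min τ 0)) - chiLo ε (y (min τ 0))),
      ?_, ?_, ?_, ?_⟩
    · have h1 := (measurable_chiLo ε).comp hc.measurable
      have h2 := (measurable_chiHi ε).comp hc.measurable
      exact h1.add ((h2.sub h1).const_mul t)
    · refine IntegrableOn.congr_fun ?_ heq measurableSet_Iic
      exact Integrable.add iL ((Integrable.sub iH iL).const_mul t)
    · intro τ hτ
      have h := heq hτ
      beta_reduce at h
      beta_reduce
      rw [← h, chiSet_eq hε]
      have := (chi_bounds hε (y τ)).2.1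
      constructor <;> nlinarith [ht.1, ht.2]
    · rw [← setIntegral_congr_fun measurableSet_Iic heq, integral_add iL, integral_const_mul,
        integral_sub iH iL]
      · rfl
      · exact (Integrable.sub iH iL).const_mul t

def TLe {ι : Type*} (l : Filter ι) (f : ι → ℝ) (c : ℝ) : Prop :=
  ∃ e : ι → ℝ, Tendsto e l (𝓝 c) ∧ ∀ᶠ a in l, f a ≤ e a

def TGe {ι : Type*} (l : Filter ι) (f : ι → ℝ) (c : ℝ) : Prop :=
  ∃ e : ι → ℝ, Tendsto e l (𝓝 c) ∧ ∀ᶠ a in l, e a ≤ f a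

lemma int_usc_aux {ν : Measure ℝ} (hν : ν (Iic 0) < ⊤) {g : ℝ → ℝ} (hg : Measurable g)
    (h0 : ∀ s, 0 ≤ g s ∧ g s ≤ 1) {ι : Type*} {l : Filter ι} [l.IsCountablyGenerated]
    {x : ι → ℝ → ℝ} {y : ℝ → ℝ} (hx : ∀ᶠ a in l, ContinuousOn (x a) (Iic 0))
    (hy : ContinuousOn y (Iic 0)) (sg : ℝ)
    (hu : ∀ τ ≤ (0 : ℝ), ∀ᶠ a in l, sg * g (x a τ) ≤ sg * g (y τ)) :
    TLe l (fun a => sg * ∫ τ in Iic (0 : ℝ), g (x a τ) ∂ν)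
      (sg * ∫ τ in Iic (0 : ℝ), g (y τ) ∂ν) := by
  have : IsFiniteMeasure (ν.restrict (Iic 0)) := ⟨by simpa using hν⟩
  have iy := integrable_bdd hν hg h0 hy
  have key : Tendsto (fun a => ∫ τ in Iic (0 : ℝ), max (sg * g (x a τ) - sg * g (y τ)) 0 ∂ν) l
      (𝓝 (∫ τ in Iic (0 : ℝ), (0 : ℝ) ∂ν)) := by
    refine tendsto_integral_filter_of_dominated_convergence (fun _ => 2 * |sg|) ?_ ?_
      (integrable_const _) ?_
    · filter_upwards [hx] with a ha
      have ix := integrable_bdd hν hg h0 ha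
      exact (((ix.const_mul sg).sub (iy.const_mul sg)).aestronglyMeasurable.sup
        aestronglyMeasurable_const)
    · refine Eventually.of_forall fun a => Eventually.of_forall fun τ => ?_
      rw [Real.norm_eq_abs, abs_of_nonneg (le_max_right _ _)]
      have b : ∀ s, |sg * g s| ≤ |sg| := fun s => by
        rw [abs_mul, abs_of_nonneg (h0 s).1]
        exact mul_le_of_le_one_right (abs_nonneg _) (h0 s).2
      have b1 := abs_le.1 (b (x a τ))
      have b2 := abs_le.1 (b (y τ))
      exact max_le (by linarith) (by linarith)
    · refine (ae_restrict_iff' measurableSet_Iic).2 (Eventually.of_forall fun τ hτ => ?_)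
      refine tendsto_const_nhds.congr' ?_
      filter_upwards [hu τ hτ] with a ha
      rw [max_eq_right]; linarith
  refine ⟨fun a => sg * (∫ τ in Iic (0 : ℝ), g (y τ) ∂ν) +
    ∫ τ in Iic (0 : ℝ), max (sg * g (x a τ) - sg * g (y τ)) 0 ∂ν, ?_, ?_⟩
  · simpa using tendsto_const_nhds.add key
  · filter_upwards [hx] with a ha
    have ix := integrable_bdd hν hg h0 ha
    have im : IntegrableOn (fun τ => max (sg * g (x a τ) - sg * g (y τ)) 0) (Iic 0) ν :=
      ((ix.const_mul sg).sub (iy.const_mul sg)).sup (integrable_const (0 : ℝ))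
    rw [← integral_const_mul, ← integral_const_mul, ← integral_add (iy.const_mul sg) im]
    refine integral_mono (ix.const_mul sg) ((iy.const_mul sg).add im) fun τ => ?_
    have := le_max_left (sg * g (x a τ) - sg * g (y τ)) 0
    simp only
    linarith

lemma iHi_usc {ε : ℝ} (hε : ε ∈ Icc (0 : ℝ) (1 / 5)) {ν : Measure ℝ} (hν : ν (Iic 0) < ⊤)
    {ι : Type*} {l : Filter ι} [l.IsCountablyGenerated]
    {x : ι → ℝ → ℝ} {y : ℝ → ℝ} (hx : ∀ᶠ a in l, ContinuousOn (x a) (Iic 0))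
    (hy : ContinuousOn y (Iic 0)) (h : ∀ τ ≤ (0 : ℝ), Tendsto (fun a => x a τ) l (𝓝 (y τ))) :
    TLe l (fun a => iHi ε ν (x a)) (iHi ε ν y) := by
  have := int_usc_aux hν (measurable_chiHi ε) (hi01 hε) hx hy 1
    (fun τ hτ => by simpa using chiHi_usc hε (h τ hτ))
  simpa [iHi] using this

lemma iLo_lsc {ε : ℝ} (hε : ε ∈ Icc (0 : ℝ) (1 / 5)) {ν : Measure ℝ} (hν : ν (Iic 0) < ⊤)
    {ι : Type*} {l : Filter ι} [l.IsCountablyGenerated]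
    {x : ι → ℝ → ℝ} {y : ℝ → ℝ} (hx : ∀ᶠ a in l, ContinuousOn (x a) (Iic 0))
    (hy : ContinuousOn y (Iic 0)) (h : ∀ τ ≤ (0 : ℝ), Tendsto (fun a => x a τ) l (𝓝 (y τ))) :
    TGe l (fun a => iLo ε ν (x a)) (iLo ε ν y) := by
  obtain ⟨e, he, hle⟩ := int_usc_aux hν (measurable_chiLo ε) (lo01 hε) hx hy (-1)
    (fun τ hτ => by simpa using chiLo_lsc hε (h τ hτ))
  refine ⟨fun a => - e a, by simpa [iLo] using he.neg, ?_⟩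
  filter_upwards [hle] with a ha
  simp only [iLo]; linarith

def sLo (q L H : ℝ) : ℝ := max q 0 * L - max (-q) 0 * H
def sHi (q L H : ℝ) : ℝ := max q 0 * H - max (-q) 0 * L

lemma smul_Icc_iff {q L H y : ℝ} (hLH : L ≤ H) :
    y ∈ q • Icc L H ↔ y ∈ Icc (sLo q L H) (sHi q L H) := by
  unfold sLo sHi
  rw [Set.mem_smul_set]
  rcases le_total 0 q with hq | hq
  · rw [max_eq_left hq, max_eq_right (by linarith)]
    constructor
    · rintro ⟨w, hw, rfl⟩
      simp only [smul_eq_mul]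
      constructor <;> nlinarith [hw.1, hw.2]
    · intro hy
      have hy' : y ∈ Icc (q * L) (q * H) := by simpa using hy
      obtain ⟨t, ht, rfl⟩ := exists_conv hy'
      refine ⟨L + t * (H - L), ⟨?_, ?_⟩, by simp only [smul_eq_mul]; ring⟩ <;>
        nlinarith [ht.1, ht.2]
  · rw [max_eq_right hq, max_eq_left (by linarith)]
    constructor
    · rintro ⟨w, hw, rfl⟩
      simp only [smul_eq_mul]
      constructor <;> nlinarith [hw.1, hw.2]
    · intro hy
      have hy' : y ∈ Icc (q * H) (q * L) := by simpa using hy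
      obtain ⟨t, ht, rfl⟩ := exists_conv hy'
      refine ⟨H + t * (L - H), ⟨?_, ?_⟩, by simp only [smul_eq_mul]; ring⟩ <;>
        nlinarith [ht.1, ht.2]

lemma s_bounds {q L H M : ℝ} (hL : 0 ≤ L) (hLH : L ≤ H) (hH : H ≤ M) :
    -(|q| * M) ≤ sLo q L H ∧ sLo q L H ≤ sHi q L H ∧ sHi q L H ≤ |q| * M := by
  unfold sLo sHi
  rcases le_total 0 q with hq | hq
  · rw [max_eq_left hq, max_eq_right (by linarith), abs_of_nonneg hq]
    refine ⟨?_, ?_, ?_⟩ <;> nlinarith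
  · rw [max_eq_right hq, max_eq_left (by linarith), abs_of_nonpos hq]
    refine ⟨?_, ?_, ?_⟩ <;> nlinarith

lemma sHi_usc {ι : Type*} {l : Filter ι} {q L H : ι → ℝ} {q' L' H' : ℝ}
    (hq : Tendsto q l (𝓝 q')) (hL : TGe l L L') (hH : TLe l H H') :
    TLe l (fun a => sHi (q a) (L a) (H a)) (sHi q' L' H') := by
  obtain ⟨e, he, h1⟩ := hL
  obtain ⟨f, hf, h2⟩ := hH
  refine ⟨fun a => sHi (q a) (e a) (f a), ?_, ?_⟩
  · exact ((hq.max tendsto_const_nhds).mul hf).sub ((hq.neg.max tendsto_const_nhds).mul he)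
  · filter_upwards [h1, h2] with a h1 h2
    have := mul_le_mul_of_nonneg_left h1 (le_max_right (-q a) 0)
    have := mul_le_mul_of_nonneg_left h2 (le_max_right (q a) 0)
    unfold sHi; linarith

lemma sLo_lsc {ι : Type*} {l : Filter ι} {q L H : ι → ℝ} {q' L' H' : ℝ}
    (hq : Tendsto q l (𝓝 q')) (hL : TGe l L L') (hH : TLe l H H') :
    TGe l (fun a => sLo (q a) (L a) (H a)) (sLo q' L' H') := by
  obtain ⟨e, he, h1⟩ := hL
  obtain ⟨f, hf, h2⟩ := hH
  refine ⟨fun a => sLo (q a) (e a) (f a), ?_, ?_⟩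
  · exact ((hq.max tendsto_const_nhds).mul he).sub ((hq.neg.max tendsto_const_nhds).mul hf)
  · filter_upwards [h1, h2] with a h1 h2
    have := mul_le_mul_of_nonneg_left h2 (le_max_right (-q a) 0)
    have := mul_le_mul_of_nonneg_left h1 (le_max_right (q a) 0)
    unfold sLo; linarith

lemma TLe.sum {ι κ : Type*} [Fintype κ] {l : Filter ι} {f : κ → ι → ℝ} {c : κ → ℝ}
    (h : ∀ k, TLe l (f k) (c k)) : TLe l (fun a => ∑ k, f k a) (∑ k, c k) := by
  choose e he hle using h
  refine ⟨fun a => ∑ k, e k a, tendsto_finsetSum _ fun k _ => he k, ?_⟩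
  filter_upwards [eventually_all.2 hle] with a ha
  exact Finset.sum_le_sum fun k _ => ha k

lemma TGe.sum {ι κ : Type*} [Fintype κ] {l : Filter ι} {f : κ → ι → ℝ} {c : κ → ℝ}
    (h : ∀ k, TGe l (f k) (c k)) : TGe l (fun a => ∑ k, f k a) (∑ k, c k) := by
  choose e he hle using h
  refine ⟨fun a => ∑ k, e k a, tendsto_finsetSum _ fun k _ => he k, ?_⟩
  filter_upwards [eventually_all.2 hle] with a ha
  exact Finset.sum_le_sum fun k _ => ha k

/-- All coordinates. -/
abbrev CIdx (n : ℕ) := Fin n ⊕ IdxZ n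

/-- Coordinate functionals. -/
def co {n : ℕ} : CIdx n → NState n →L[ℝ] ℝ
  | Sum.inl i => (ContinuousLinearMap.proj (R := ℝ) (φ := fun _ : Fin n => ℝ) i).comp
      (ContinuousLinearMap.fst ℝ (Fin n → ℝ) (IdxZ n → ℝ))
  | Sum.inr p => (ContinuousLinearMap.proj (R := ℝ) (φ := fun _ : IdxZ n => ℝ) p).comp
      (ContinuousLinearMap.snd ℝ (Fin n → ℝ) (IdxZ n → ℝ))

lemma co_inl {n : ℕ} (i : Fin n) (v : NState n) : co (Sum.inl i) v = v.1 i := rfl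
lemma co_inr {n : ℕ} (p : IdxZ n) (v : NState n) : co (Sum.inr p) v = v.2 p := rfl

lemma co_ext {n : ℕ} {v w : NState n} (h : ∀ j, co j v = co j w) : v = w :=
  Prod.ext (funext fun i => h (Sum.inl i)) (funext fun p => h (Sum.inr p))

lemma abs_co_le {n : ℕ} (j : CIdx n) (v : NState n) : |co j v| ≤ ‖v‖ := by
  cases j with
  | inl i => exact (norm_le_pi_norm v.1 i).trans (norm_fst_le v)
  | inr p => exact (norm_le_pi_norm v.2 p).trans (norm_snd_le v)

lemma norm_le_of_co {n : ℕ} {v : NState n} {r : ℝ} (hr : 0 ≤ r) (h : ∀ j, |co j v| ≤ r) :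
    ‖v‖ ≤ r := by
  refine max_le ?_ ?_
  · exact (pi_norm_le_iff_of_nonneg hr).2 fun i => h (Sum.inl i)
  · exact (pi_norm_le_iff_of_nonneg hr).2 fun p => h (Sum.inr p)

/-- Reassemble a state from coordinates. -/
def mkS {n : ℕ} (f : CIdx n → ℝ) : NState n := (fun i => f (Sum.inl i), fun p => f (Sum.inr p))

lemma co_mkS {n : ℕ} (f : CIdx n → ℝ) (j : CIdx n) : co j (mkS f) = f j := by
  cases j <;> rfl

def loJ {n : ℕ} (ε : ℝ) (μ : IdxZ n → Measure ℝ) (c d : IdxZ n → ℝ) (Γ : Fin n → ℝ) :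
    CIdx n → (ℝ → NState n) → ℝ
  | Sum.inl i, u => ∑ k : Fin n, if h : k ≠ i then
      sLo ((u 0).2 ⟨(k, i), h⟩ - c ⟨(k, i), h⟩)
        (iLo ε (μ ⟨(k, i), h⟩) (fun τ => (u τ).1 k - Γ k))
        (iHi ε (μ ⟨(k, i), h⟩) (fun τ => (u τ).1 k - Γ k)) else 0
  | Sum.inr p, u => sLo (d p * max ((u 0).1 p.1.2) 0)
        (iLo ε (μ p) (fun τ => (u τ).1 p.1.1 - Γ p.1.1))
        (iHi ε (μ p) (fun τ => (u τ).1 p.1.1 - Γ p.1.1))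

def upJ {n : ℕ} (ε : ℝ) (μ : IdxZ n → Measure ℝ) (c d : IdxZ n → ℝ) (Γ : Fin n → ℝ) :
    CIdx n → (ℝ → NState n) → ℝ
  | Sum.inl i, u => ∑ k : Fin n, if h : k ≠ i then
      sHi ((u 0).2 ⟨(k, i), h⟩ - c ⟨(k, i), h⟩)
        (iLo ε (μ ⟨(k, i), h⟩) (fun τ => (u τ).1 k - Γ k))
        (iHi ε (μ ⟨(k, i), h⟩) (fun τ => (u τ).1 k - Γ k)) else 0
  | Sum.inr p, u => sHi (d p * max ((u 0).1 p.1.2) 0)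
        (iLo ε (μ p) (fun τ => (u τ).1 p.1.1 - Γ p.1.1))
        (iHi ε (μ p) (fun τ => (u τ).1 p.1.1 - Γ p.1.1))

lemma mass_lt_top {n : ℕ} {γ : ℝ} (hγ : 0 < γ) {μ : IdxZ n → Measure ℝ} (hM : HypM γ μ)
    (p : IdxZ n) : μ p (Iic 0) < ⊤ := by
  refine lt_of_le_of_lt ?_ (hM p)
  calc μ p (Iic 0) = ∫⁻ _ in Iic (0 : ℝ), 1 ∂(μ p) := by simp
    _ ≤ _ := by
      refine setLIntegral_mono' measurableSet_Iic fun t ht => ?_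
      have ht' : t ≤ 0 := ht
      rw [← ENNReal.ofReal_one]
      apply ENNReal.ofReal_le_ofReal
      apply Real.one_le_exp
      nlinarith

lemma cont_x {n : ℕ} {u : ℝ → NState n} (hu : ContinuousOn u (Iic 0)) (k : Fin n) (a : ℝ) :
    ContinuousOn (fun τ => (u τ).1 k - a) (Iic 0) := by
  have : ContinuousOn (fun τ => co (Sum.inl k) (u τ)) (Iic 0) :=
    (co (Sum.inl k)).continuous.comp_continuousOn hu
  exact this.sub continuousOn_const

lemma Xset_iff {n : ℕ} {ε : ℝ} (hε : ε ∈ Icc (0 : ℝ) (1 / 5)) {μ : IdxZ n → Measure ℝ}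
    (hμ : ∀ p, μ p (Iic 0) < ⊤) (c d : IdxZ n → ℝ) (Γ : Fin n → ℝ)
    {u : ℝ → NState n} (hu : ContinuousOn u (Iic 0)) (v : NState n) :
    v ∈ Xset ε μ c d Γ u ↔
      ∀ j, co j v ∈ Icc (loJ ε μ c d Γ j u) (upJ ε μ c d Γ j u) := by
  have hA : ∀ (p : IdxZ n) (k : Fin n),
      aumann (fun τ => chiSet ε ((u τ).1 k - Γ k)) (μ p) =
        Icc (iLo ε (μ p) (fun τ => (u τ).1 k - Γ k)) (iHi ε (μ p) (fun τ => (u τ).1 k - Γ k)) :=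
    fun p k => aumann_eq hε (hμ p) (cont_x hu k (Γ k))
  have hB : ∀ (p : IdxZ n) (k : Fin n), iLo ε (μ p) (fun τ => (u τ).1 k - Γ k) ≤
      iHi ε (μ p) (fun τ => (u τ).1 k - Γ k) :=
    fun p k => (i_bounds hε (hμ p) (cont_x hu k (Γ k))).2.1
  have hX : ∀ i y, y ∈ XsetX ε μ c Γ u i ↔
      y ∈ Icc (loJ ε μ c d Γ (Sum.inl i) u) (upJ ε μ c d Γ (Sum.inl i) u) := by
    intro i y
    constructor
    · rintro ⟨g, hgi, hg, rfl⟩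
      have hg' : ∀ k, ∀ h : k ≠ i, _ := fun k h =>
        (smul_Icc_iff (hB ⟨(k, i), h⟩ k)).1 (hA ⟨(k, i), h⟩ k ▸ hg k h)
      constructor
      · refine Finset.sum_le_sum fun k _ => ?_
        by_cases h : k ≠ i
        · rw [dif_pos h]; exact (hg' k h).1
        · rw [dif_neg h]; push Not at h; rw [h, hgi]
      · refine Finset.sum_le_sum fun k _ => ?_
        by_cases h : k ≠ i
        · rw [dif_pos h]; exact (hg' k h).2
        · rw [dif_neg h]; push Not at h; rw [h, hgi]
    · intro hy
      obtain ⟨t, ht, hyt⟩ := exists_conv hy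
      simp only [loJ, upJ] at hyt
      rw [← Finset.sum_sub_distrib, Finset.mul_sum, ← Finset.sum_add_distrib] at hyt
      refine ⟨_, ?_, ?_, hyt⟩
      · simp
      · intro k h
        rw [hA ⟨(k, i), h⟩ k, smul_Icc_iff (hB ⟨(k, i), h⟩ k)]
        simp only [dif_pos h]
        have := (s_bounds (q := (u 0).2 ⟨(k, i), h⟩ - c ⟨(k, i), h⟩)
          (i_bounds hε (hμ ⟨(k, i), h⟩) (cont_x hu k (Γ k))).1 (hB ⟨(k, i), h⟩ k) le_rfl).2.1
        constructor <;> nlinarith [ht.1, ht.2]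
  have hZ : ∀ p : IdxZ n, v.2 p ∈ (d p * max ((u 0).1 p.1.2) 0) •
        aumann (fun τ => chiSet ε ((u τ).1 p.1.1 - Γ p.1.1)) (μ p) ↔
      v.2 p ∈ Icc (loJ ε μ c d Γ (Sum.inr p) u) (upJ ε μ c d Γ (Sum.inr p) u) := by
    intro p
    rw [hA p p.1.1, smul_Icc_iff (hB p p.1.1)]
    rfl
  constructor
  · rintro ⟨h1, h2⟩ (i | p)
    · exact (hX i _).1 (h1 i)
    · exact (hZ p).1 (h2 p)
  · intro h
    exact ⟨fun i => (hX i _).2 (h (Sum.inl i)), fun p => (hZ p).2 (h (Sum.inr p))⟩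

lemma growth_j {n : ℕ} {ε : ℝ} (hε : ε ∈ Icc (0 : ℝ) (1 / 5)) {μ : IdxZ n → Measure ℝ}
    (hμ : ∀ p, μ p (Iic 0) < ⊤) (c d : IdxZ n → ℝ) (Γ : Fin n → ℝ) (j : CIdx n) :
    ∃ K, 0 ≤ K ∧ ∀ u : ℝ → NState n, ContinuousOn u (Iic 0) →
      -(K * (1 + ‖u 0‖)) ≤ loJ ε μ c d Γ j u ∧ loJ ε μ c d Γ j u ≤ upJ ε μ c d Γ j u ∧
        upJ ε μ c d Γ j u ≤ K * (1 + ‖u 0‖) := by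
  cases j with
  | inl i =>
    have hK0 : ∀ k : Fin n, 0 ≤ (if h : k ≠ i then
      (1 + |c ⟨(k, i), h⟩|) * (μ ⟨(k, i), h⟩ (Iic 0)).toReal else 0) := by
      intro k
      split_ifs
      · positivity
      · exact le_rfl
    refine ⟨∑ k : Fin n, if h : k ≠ i then
      (1 + |c ⟨(k, i), h⟩|) * (μ ⟨(k, i), h⟩ (Iic 0)).toReal else 0,
      Finset.sum_nonneg fun k _ => hK0 k, fun u hu => ?_⟩
    have key : ∀ k (h : k ≠ i), _ := fun k h =>
      s_bounds (q := (u 0).2 ⟨(k, i), h⟩ - c ⟨(k, i), h⟩)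
          (i_bounds hε (hμ ⟨(k, i), h⟩) (cont_x hu k (Γ k))).1
          (i_bounds hε (hμ ⟨(k, i), h⟩) (cont_x hu k (Γ k))).2.1
          (i_bounds hε (hμ ⟨(k, i), h⟩) (cont_x hu k (Γ k))).2.2
    have key2 : ∀ k (h : k ≠ i), |(u 0).2 ⟨(k, i), h⟩ - c ⟨(k, i), h⟩| *
        (μ ⟨(k, i), h⟩ (Iic 0)).toReal ≤
        (1 + |c ⟨(k, i), h⟩|) * (μ ⟨(k, i), h⟩ (Iic 0)).toReal * (1 + ‖u 0‖) := by
      intro k h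
      have h1 : |(u 0).2 ⟨(k, i), h⟩ - c ⟨(k, i), h⟩| ≤ (1 + |c ⟨(k, i), h⟩|) * (1 + ‖u 0‖) := by
        have a1 := abs_sub ((u 0).2 ⟨(k, i), h⟩) (c ⟨(k, i), h⟩)
        have a2 : |(u 0).2 ⟨(k, i), h⟩| ≤ ‖u 0‖ := abs_co_le (Sum.inr ⟨(k, i), h⟩) (u 0)
        nlinarith [abs_nonneg (c ⟨(k, i), h⟩), norm_nonneg (u 0)]
      calc _ ≤ (1 + |c ⟨(k, i), h⟩|) * (1 + ‖u 0‖) * (μ ⟨(k, i), h⟩ (Iic 0)).toReal :=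
            mul_le_mul_of_nonneg_right h1 ENNReal.toReal_nonneg
        _ = _ := by ring
    simp only [loJ, upJ]
    rw [Finset.sum_mul, ← Finset.sum_neg_distrib]
    refine ⟨Finset.sum_le_sum fun k _ => ?_, Finset.sum_le_sum fun k _ => ?_,
      Finset.sum_le_sum fun k _ => ?_⟩
    all_goals
      by_cases h : k ≠ i
      · simp only [dif_pos h]
        have a1 := key k h
        have a2 := key2 k h
        linarith [a1.1, a1.2.1, a1.2.2]
      · simp only [dif_neg h]; simp
  | inr p =>
    refine ⟨|d p| * (μ p (Iic 0)).toReal, by positivity, fun u hu => ?_⟩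
    have key := s_bounds (q := d p * max ((u 0).1 p.1.2) 0)
          (i_bounds hε (hμ p) (cont_x hu p.1.1 (Γ p.1.1))).1
          (i_bounds hε (hμ p) (cont_x hu p.1.1 (Γ p.1.1))).2.1
          (i_bounds hε (hμ p) (cont_x hu p.1.1 (Γ p.1.1))).2.2
    have key2 : |d p * max ((u 0).1 p.1.2) 0| * (μ p (Iic 0)).toReal ≤
        |d p| * (μ p (Iic 0)).toReal * (1 + ‖u 0‖) := by
      have a2 : |(u 0).1 p.1.2| ≤ ‖u 0‖ := abs_co_le (Sum.inl p.1.2) (u 0)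
      have a3 : |max ((u 0).1 p.1.2) 0| ≤ 1 + ‖u 0‖ := by
        rw [abs_of_nonneg (le_max_right _ _)]
        exact max_le (by linarith [le_abs_self ((u 0).1 p.1.2)]) (by positivity)
      rw [abs_mul]
      calc _ ≤ |d p| * (1 + ‖u 0‖) * (μ p (Iic 0)).toReal := by gcongr
        _ = _ := by ring
    simp only [loJ, upJ]
    refine ⟨?_, ?_, ?_⟩ <;> linarith [key.1, key.2.1, key.2.2]

lemma growth {n : ℕ} {ε : ℝ} (hε : ε ∈ Icc (0 : ℝ) (1 / 5)) {μ : IdxZ n → Measure ℝ}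
    (hμ : ∀ p, μ p (Iic 0) < ⊤) (c d : IdxZ n → ℝ) (Γ : Fin n → ℝ) :
    ∃ K, 0 ≤ K ∧ ∀ u : ℝ → NState n, ContinuousOn u (Iic 0) → ∀ j,
      -(K * (1 + ‖u 0‖)) ≤ loJ ε μ c d Γ j u ∧ loJ ε μ c d Γ j u ≤ upJ ε μ c d Γ j u ∧
        upJ ε μ c d Γ j u ≤ K * (1 + ‖u 0‖) := by
  choose K hK0 hK using growth_j hε hμ c d Γ
  refine ⟨∑ j, K j, Finset.sum_nonneg fun j _ => hK0 j, fun u hu j => ?_⟩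
  have h1 : K j ≤ ∑ j, K j := Finset.single_le_sum (fun j _ => hK0 j) (Finset.mem_univ j)
  have h2 : K j * (1 + ‖u 0‖) ≤ (∑ j, K j) * (1 + ‖u 0‖) :=
    mul_le_mul_of_nonneg_right h1 (by positivity)
  have := hK j u hu
  exact ⟨by linarith [this.1], this.2.1, by linarith [this.2.2]⟩

lemma J_usc {n : ℕ} {ε : ℝ} (hε : ε ∈ Icc (0 : ℝ) (1 / 5)) {μ : IdxZ n → Measure ℝ}
    (hμ : ∀ p, μ p (Iic 0) < ⊤) (c d : IdxZ n → ℝ) (Γ : Fin n → ℝ)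
    {ι : Type*} {l : Filter ι} [l.IsCountablyGenerated]
    {x : ι → ℝ → NState n} {y : ℝ → NState n} (hx : ∀ᶠ a in l, ContinuousOn (x a) (Iic 0))
    (hy : ContinuousOn y (Iic 0)) (h : ∀ τ ≤ (0 : ℝ), Tendsto (fun a => x a τ) l (𝓝 (y τ)))
    (j : CIdx n) :
    TLe l (fun a => upJ ε μ c d Γ j (x a)) (upJ ε μ c d Γ j y) ∧
    TGe l (fun a => loJ ε μ c d Γ j (x a)) (loJ ε μ c d Γ j y) := by
  have hco : ∀ j, ∀ τ ≤ (0 : ℝ), Tendsto (fun a => co j (x a τ)) l (𝓝 (co j (y τ))) :=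
    fun j τ hτ => ((co j).continuous.tendsto _).comp (h τ hτ)
  have hxk : ∀ k : Fin n, ∀ᶠ a in l, ContinuousOn (fun τ => (x a τ).1 k - Γ k) (Iic 0) := by
    intro k
    filter_upwards [hx] with a ha using cont_x ha k (Γ k)
  have hkk : ∀ k : Fin n, ∀ τ ≤ (0 : ℝ),
      Tendsto (fun a => (x a τ).1 k - Γ k) l (𝓝 ((y τ).1 k - Γ k)) :=
    fun k τ hτ => (hco (Sum.inl k) τ hτ).sub tendsto_const_nhds
  have hU : ∀ (p : IdxZ n) (k : Fin n), _ := fun p k =>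
    iHi_usc hε (hμ p) (hxk k) (cont_x hy k (Γ k)) (hkk k)
  have hL : ∀ (p : IdxZ n) (k : Fin n), _ := fun p k =>
    iLo_lsc hε (hμ p) (hxk k) (cont_x hy k (Γ k)) (hkk k)
  have zero1 : TLe l (fun _ => (0 : ℝ)) 0 :=
    ⟨fun _ => 0, tendsto_const_nhds, Eventually.of_forall fun _ => le_rfl⟩
  have zero2 : TGe l (fun _ => (0 : ℝ)) 0 :=
    ⟨fun _ => 0, tendsto_const_nhds, Eventually.of_forall fun _ => le_rfl⟩
  cases j with
  | inl i =>
    have hq : ∀ k (h : k ≠ i), Tendsto (fun a => (x a 0).2 ⟨(k, i), h⟩ - c ⟨(k, i), h⟩) l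
        (𝓝 ((y 0).2 ⟨(k, i), h⟩ - c ⟨(k, i), h⟩)) :=
      fun k h => (hco (Sum.inr ⟨(k, i), h⟩) 0 le_rfl).sub tendsto_const_nhds
    simp only [loJ, upJ]
    constructor
    · refine TLe.sum fun k => ?_
      by_cases h : k ≠ i
      · simp only [dif_pos h]
        exact sHi_usc (hq k h) (hL _ k) (hU _ k)
      · simp only [dif_neg h]; exact zero1
    · refine TGe.sum fun k => ?_
      by_cases h : k ≠ i
      · simp only [dif_pos h]
        exact sLo_lsc (hq k h) (hL _ k) (hU _ k)
      · simp only [dif_neg h]; exact zero2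
  | inr p =>
    have hq : Tendsto (fun a => d p * max ((x a 0).1 p.1.2) 0) l
        (𝓝 (d p * max ((y 0).1 p.1.2) 0)) :=
      tendsto_const_nhds.mul ((hco (Sum.inl p.1.2) 0 le_rfl).max tendsto_const_nhds)
    exact ⟨sHi_usc hq (hL p _) (hU p _), sLo_lsc hq (hL p _) (hU p _)⟩

def AJ {n : ℕ} (A : Fin n → ℝ → ℝ) (B : IdxZ n → ℝ → ℝ) : CIdx n → ℝ → ℝ := Sum.elim A B

lemma co_decay {n : ℕ} (A : Fin n → ℝ → ℝ) (B : IdxZ n → ℝ → ℝ) (u : ℝ → NState n) (j : CIdx n) :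
    co j (decayT A B u) = -(AJ A B j (co j (u 0))) * co j (u 0) := by
  cases j <;> rfl

/-- right-hand side in coordinates -/
def GJ {n : ℕ} (A : Fin n → ℝ → ℝ) (B : IdxZ n → ℝ → ℝ) (Istim : Fin n → ℝ → ℝ)
    (u : ℝ → NState n) (g : CIdx n → ℝ → ℝ) (j : CIdx n) (s : ℝ) : ℝ :=
  -(AJ A B j (co j (u s))) * co j (u s) + g j s + co j (stimT Istim s)

/-- coordinate form of solutions -/
def CSol {n : ℕ} (ε : ℝ) (A : Fin n → ℝ → ℝ) (B : IdxZ n → ℝ → ℝ)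
    (μ : IdxZ n → Measure ℝ) (c d : IdxZ n → ℝ) (Γ : Fin n → ℝ)
    (Istim : Fin n → ℝ → ℝ) (t₀ t₁ : ℝ) (u : ℝ → NState n) (g : CIdx n → ℝ → ℝ) : Prop :=
  ContinuousOn u (Iic t₁) ∧
    (∀ t ∈ Icc t₀ t₁, ∀ j, g j t ∈
      Icc (loJ ε μ c d Γ j (hist u t)) (upJ ε μ c d Γ j (hist u t))) ∧
    (∀ j, IntegrableOn (GJ A B Istim u g j) (Icc t₀ t₁)) ∧
    ∀ j, ∀ t ∈ Icc t₀ t₁, co j (u t) = co j (u t₀) + ∫ s in t₀..t, GJ A B Istim u g j s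

lemma integrableOn_of_co {n : ℕ} {f : ℝ → NState n} {s : Set ℝ}
    (h : ∀ j, IntegrableOn (fun t => co j (f t)) s) : IntegrableOn f s := by
  have h1 : Integrable (fun t => (f t).1) (volume.restrict s) :=
    Integrable.of_eval fun i => h (Sum.inl i)
  have h2 : Integrable (fun t => (f t).2) (volume.restrict s) :=
    Integrable.of_eval fun p => h (Sum.inr p)
  exact h1.prodMk h2

lemma cont_glue {n : ℕ} {t₀ t₁ : ℝ} (ht : t₀ ≤ t₁) {u₀ u : ℝ → NState n}
    (hu₀ : ContinuousOn u₀ (Iic 0)) (h : ∀ s ≤ (0 : ℝ), u (t₀ + s) = u₀ s)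
    (hc : ContinuousOn u (Icc t₀ t₁)) : ContinuousOn u (Iic t₁) := by
  have h1 : ContinuousOn u (Iic t₀) := by
    have : ContinuousOn (fun s => u₀ (s - t₀)) (Iic t₀) := by
      refine hu₀.comp (by fun_prop) fun s hs => ?_
      have : s ≤ t₀ := hs
      exact Set.mem_Iic.2 (by linarith)
    refine this.congr fun s hs => ?_
    have hs' : s ≤ t₀ := hs
    show u s = u₀ (s - t₀)
    rw [← h (s - t₀) (by linarith)]
    congr 1; ring
  have := h1.union_of_isClosed hc isClosed_Iic isClosed_Icc
  rwa [Iic_union_Icc_eq_Iic ht] at this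

lemma cont_hist {n : ℕ} {t t₁ : ℝ} (ht : t ≤ t₁) {u : ℝ → NState n}
    (hu : ContinuousOn u (Iic t₁)) : ContinuousOn (hist u t) (Iic 0) := by
  refine hu.comp (by fun_prop) fun s hs => ?_
  have : s ≤ 0 := hs
  exact Set.mem_Iic.2 (by linarith)

lemma sol_to_csol {n : ℕ} {ε : ℝ} (hε : ε ∈ Icc (0 : ℝ) (1 / 5)) {A : Fin n → ℝ → ℝ}
    {B : IdxZ n → ℝ → ℝ} {μ : IdxZ n → Measure ℝ}
    (hμ : ∀ p, μ p (Iic 0) < ⊤) {c d : IdxZ n → ℝ} {Γ : Fin n → ℝ}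
    {Istim : Fin n → ℝ → ℝ} {t₀ t₁ : ℝ} (ht : t₀ ≤ t₁) {u₀ u : ℝ → NState n}
    (hu₀ : ContinuousOn u₀ (Iic 0))
    (h : IsIncSolOn ε A B μ c d Γ Istim t₀ t₁ u₀ u) :
    ∃ g, CSol ε A B μ c d Γ Istim t₀ t₁ u g := by
  obtain ⟨h1, h2, S, hS, hGint, hu⟩ := h
  have hc := cont_glue ht hu₀ h1 h2
  have e0 : u₀ 0 = u t₀ := by rw [← h1 0 le_rfl, add_zero]
  have hG : ∀ j s, co j (decayT A B (hist u s) + S s + stimT Istim s) =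
      GJ A B Istim u (fun j t => co j (S t)) j s := by
    intro j s
    simp only [map_add, co_decay, GJ, hist, add_zero]
  refine ⟨fun j t => co j (S t), hc, fun t htt j => ?_, fun j => ?_, fun j t htt => ?_⟩
  · exact (Xset_iff hε hμ c d Γ (cont_hist htt.2 hc) _).1 (hS t htt) j
  · have := (co j).integrable_comp hGint
    simp only [hG] at this
    exact this
  · have hi : IntervalIntegrable (fun s => decayT A B (hist u s) + S s + stimT Istim s)
        volume t₀ t := by
      rw [intervalIntegrable_iff_integrableOn_Icc_of_le htt.1]
      exact hGint.mono_set (Icc_subset_Icc_right htt.2)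
    rw [hu t htt, map_add, e0, ← (co j).intervalIntegral_comp_comm hi]
    simp only [hG]

lemma csol_to_sol {n : ℕ} {ε : ℝ} (hε : ε ∈ Icc (0 : ℝ) (1 / 5)) {A : Fin n → ℝ → ℝ}
    {B : IdxZ n → ℝ → ℝ} {μ : IdxZ n → Measure ℝ}
    (hμ : ∀ p, μ p (Iic 0) < ⊤) {c d : IdxZ n → ℝ} {Γ : Fin n → ℝ}
    {Istim : Fin n → ℝ → ℝ} {t₀ t₁ : ℝ} {u₀ u : ℝ → NState n}
    (h0 : ∀ s ≤ (0 : ℝ), u (t₀ + s) = u₀ s) {g : CIdx n → ℝ → ℝ}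
    (h : CSol ε A B μ c d Γ Istim t₀ t₁ u g) : IsIncSolOn ε A B μ c d Γ Istim t₀ t₁ u₀ u := by
  obtain ⟨hc, hg, hGint, hu⟩ := h
  have e0 : u₀ 0 = u t₀ := by rw [← h0 0 le_rfl, add_zero]
  have hG : ∀ j s, co j (decayT A B (hist u s) + mkS (fun j => g j s) + stimT Istim s) =
      GJ A B Istim u g j s := by
    intro j s
    simp only [map_add, co_decay, GJ, hist, add_zero, co_mkS]
  have hGint' : IntegrableOn (fun s => decayT A B (hist u s) + mkS (fun j => g j s) +
      stimT Istim s) (Icc t₀ t₁) := by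
    refine integrableOn_of_co fun j => ?_
    simp only [hG]
    exact hGint j
  refine ⟨h0, hc.mono Icc_subset_Iic_self, fun s => mkS (fun j => g j s), fun t htt => ?_, hGint',
    fun t htt => co_ext fun j => ?_⟩
  · rw [Xset_iff hε hμ c d Γ (cont_hist htt.2 hc)]
    intro j
    rw [co_mkS]
    exact hg t htt j
  · have hi : IntervalIntegrable (fun s => decayT A B (hist u s) + mkS (fun j => g j s) +
        stimT Istim s) volume t₀ t := by
      rw [intervalIntegrable_iff_integrableOn_Icc_of_le htt.1]
      exact hGint'.mono_set (Icc_subset_Icc_right htt.2)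
    rw [hu j t htt, map_add, e0, ← (co j).intervalIntegral_comp_comm hi]
    simp only [hG]

lemma ii_of {f : ℝ → ℝ} {t₀ t₁ a b : ℝ} (h : IntegrableOn f (Icc t₀ t₁)) (ha : a ∈ Icc t₀ t₁)
    (hb : b ∈ Icc t₀ t₁) : IntervalIntegrable f volume a b :=
  (h.mono_set (uIcc_subset_Icc ha hb)).intervalIntegrable

lemma csol_diff {f G : ℝ → ℝ} {t₀ t₁ a b : ℝ} (h : IntegrableOn G (Icc t₀ t₁))
    (hf : ∀ t ∈ Icc t₀ t₁, f t = f t₀ + ∫ s in t₀..t, G s) (ha : a ∈ Icc t₀ t₁)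
    (hb : b ∈ Icc t₀ t₁) : f b - f a = ∫ s in a..b, G s := by
  have ht : t₀ ∈ Icc t₀ t₁ := ⟨le_rfl, ha.1.trans ha.2⟩
  rw [hf b hb, hf a ha, ← intervalIntegral.integral_add_adjacent_intervals (ii_of h ht ha)
    (ii_of h ha hb)]
  ring

lemma one_sided {t₀ t₁ : ℝ} {y a r h : ℝ → ℝ} (hy : ContinuousOn y (Icc t₀ t₁))
    (ha : ∀ s, 0 ≤ a s) (hr : ∀ s ∈ Icc t₀ t₁, |r s| ≤ h s) (hh : IntegrableOn h (Icc t₀ t₁))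
    (hG : IntegrableOn (fun s => -(a s) * y s + r s) (Icc t₀ t₁))
    (he : ∀ t ∈ Icc t₀ t₁, y t = y t₀ + ∫ s in t₀..t, (-(a s) * y s + r s)) :
    ∀ t ∈ Icc t₀ t₁, y t ≤ |y t₀| + ∫ s in t₀..t, h s := by
  intro t ht
  have hh0 : ∀ s ∈ Icc t₀ t₁, 0 ≤ h s := fun s hs => (abs_nonneg _).trans (hr s hs)
  have h00 : t₀ ∈ Icc t₀ t₁ := ⟨le_rfl, ht.1.trans ht.2⟩
  have hex : ∃ s ∈ Icc t₀ t, y s ≤ |y t₀| ∧ ∀ x ∈ Ioc s t, 0 ≤ y x := by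
    by_cases hZ : ∃ s ∈ Icc t₀ t, y s ≤ 0
    · have hcl : IsCompact (Icc t₀ t ∩ y ⁻¹' (Iic 0)) :=
        isCompact_Icc.of_isClosed_subset
          ((hy.mono (Icc_subset_Icc_right ht.2)).preimage_isClosed_of_isClosed isClosed_Icc
            isClosed_Iic) inter_subset_left
      obtain ⟨z, hz1, hz2⟩ := hZ
      obtain ⟨s, hs, hmax⟩ := hcl.exists_isGreatest ⟨z, hz1, hz2⟩
      refine ⟨s, hs.1, (show y s ≤ 0 from hs.2).trans (abs_nonneg _), fun x hx => ?_⟩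
      by_contra hneg
      push Not at hneg
      have := hmax (a := x) ⟨⟨hs.1.1.trans hx.1.le, hx.2⟩, hneg.le⟩
      exact absurd hx.1 (not_lt.2 this)
    · push Not at hZ
      exact ⟨t₀, ⟨le_rfl, ht.1⟩, le_abs_self _, fun x hx => (hZ x ⟨hx.1.le, hx.2⟩).le⟩
  obtain ⟨s, hs, hys, hpos⟩ := hex
  have hs' : s ∈ Icc t₀ t₁ := ⟨hs.1, hs.2.trans ht.2⟩
  have hd := csol_diff hG he hs' ht
  have h1 : ∫ x in s..t, (-(a x) * y x + r x) ≤ ∫ x in s..t, h x := by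
    refine intervalIntegral.integral_mono_on_of_le_Ioo hs.2 (ii_of hG hs' ht) (ii_of hh hs' ht) ?_
    intro x hx
    have hx' : x ∈ Icc t₀ t₁ := ⟨hs.1.trans hx.1.le, hx.2.le.trans ht.2⟩
    have := hpos x ⟨hx.1, hx.2.le⟩
    have := mul_nonneg (ha x) this
    have := (abs_le.1 (hr x hx')).2
    linarith
  have h2 : 0 ≤ ∫ x in t₀..s, h x :=
    intervalIntegral.integral_nonneg hs.1 fun x hx => hh0 x ⟨hx.1, hx.2.trans hs'.2⟩
  have h3 := intervalIntegral.integral_add_adjacent_intervals (ii_of hh h00 hs') (ii_of hh hs' ht)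
  linarith

lemma two_sided {t₀ t₁ : ℝ} {y a r h : ℝ → ℝ} (hy : ContinuousOn y (Icc t₀ t₁))
    (ha : ∀ s, 0 ≤ a s) (hr : ∀ s ∈ Icc t₀ t₁, |r s| ≤ h s) (hh : IntegrableOn h (Icc t₀ t₁))
    (hG : IntegrableOn (fun s => -(a s) * y s + r s) (Icc t₀ t₁))
    (he : ∀ t ∈ Icc t₀ t₁, y t = y t₀ + ∫ s in t₀..t, (-(a s) * y s + r s)) :
    ∀ t ∈ Icc t₀ t₁, |y t| ≤ |y t₀| + ∫ s in t₀..t, h s := by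
  intro t ht
  refine abs_le.2 ⟨?_, one_sided hy ha hr hh hG he t ht⟩
  have e : (fun s => -(a s) * (-y s) + (-r s)) = fun s => -(-(a s) * y s + r s) := by
    funext s; ring
  have := one_sided (y := fun s => - y s) (r := fun s => - r s) hy.neg ha
    (fun s hs => by rw [abs_neg]; exact hr s hs) hh (by rw [e]; exact hG.neg)
    (fun t ht => by rw [e, intervalIntegral.integral_neg, he t ht]; ring) t ht
  rw [abs_neg] at this
  linarith

lemma gron {t₀ t₁ R K : ℝ} (hR : 0 ≤ R) (hK : 0 ≤ K) {f : ℝ → ℝ}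
    (hf : ContinuousOn f (Icc t₀ t₁)) (h0 : ∀ t ∈ Icc t₀ t₁, 0 ≤ f t)
    (hle : ∀ t ∈ Icc t₀ t₁, f t ≤ R + ∫ s in t₀..t, K * (1 + f s)) :
    ∀ t ∈ Icc t₀ t₁, f t ≤ gronwallBound R K K (t₁ - t₀) := by
  intro t ht
  have ht01 : t₀ ≤ t₁ := ht.1.trans ht.2
  set F : ℝ → ℝ := IccExtend ht01 ((Icc t₀ t₁).domRestrict f) with hF
  have hFc : Continuous F := (continuousOn_iff_continuous_domRestrict.1 hf).Icc_extend'
  have hFe : ∀ s ∈ Icc t₀ t₁, F s = f s := fun s hs => IccExtend_of_mem ht01 _ hs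
  have hi : ∀ s ∈ Icc t₀ t₁, ∫ x in t₀..s, K * (1 + f x) = ∫ x in t₀..s, K * (1 + F x) := by
    intro s hs
    refine intervalIntegral.integral_congr fun x hx => ?_
    rw [uIcc_of_le hs.1] at hx
    rw [hFe x ⟨hx.1, hx.2.trans hs.2⟩]
  have hc : Continuous fun x => K * (1 + F x) := by fun_prop
  have hd : ∀ x, HasDerivAt (fun s => R + ∫ x in t₀..s, K * (1 + F x)) (K * (1 + F x)) x :=
    fun x => (hc.integral_hasStrictDerivAt t₀ x).hasDerivAt.const_add R
  have := norm_le_gronwallBound_of_norm_deriv_right_le (δ := R) (K := K) (ε := K) (a := t₀)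
    (b := t₁) (f := fun s => R + ∫ x in t₀..s, K * (1 + F x)) (f' := fun x => K * (1 + F x))
    (fun x _ => (hd x).continuousAt.continuousWithinAt) (fun x _ => (hd x).hasDerivWithinAt)
    (by simp [abs_of_nonneg hR]) (by
      intro x hx
      have hx' : x ∈ Icc t₀ t₁ := ⟨hx.1, hx.2.le⟩
      have a0 := h0 x hx'
      have a1 := hle x hx'
      rw [hi x hx'] at a1
      rw [hFe x hx', Real.norm_eq_abs, Real.norm_eq_abs, abs_of_nonneg (by positivity)]
      have := a1.trans (le_abs_self _)
      nlinarith) t ht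
  have a1 := hle t ht
  rw [hi t ht] at a1
  refine (a1.trans (le_abs_self _)).trans (this.trans ?_)
  exact gronwallBound_mono hR hK hK (by linarith [ht.2])

lemma apriori {n : ℕ} {ε : ℝ} (hε : ε ∈ Icc (0 : ℝ) (1 / 5)) {A : Fin n → ℝ → ℝ}
    {B : IdxZ n → ℝ → ℝ} {α : ℝ} (hD : HypD α A B) {μ : IdxZ n → Measure ℝ}
    (hμ : ∀ p, μ p (Iic 0) < ⊤) (c d : IdxZ n → ℝ) (Γ : Fin n → ℝ)
    {Istim : Fin n → ℝ → ℝ} (hI : HypI Istim) (t₀ t₁ : ℝ) (R₀ : ℝ) (hR₀ : 0 ≤ R₀) :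
    ∃ R L : ℝ, 0 ≤ L ∧ ∀ u g, CSol ε A B μ c d Γ Istim t₀ t₁ u g → ‖u t₀‖ ≤ R₀ →
      (∀ t ∈ Icc t₀ t₁, ‖u t‖ ≤ R) ∧ ∀ s ∈ Icc t₀ t₁, ∀ t ∈ Icc t₀ t₁,
        ‖u t - u s‖ ≤ L * |t - s| := by
  obtain ⟨K, hK0, hK⟩ := growth hε hμ c d Γ
  have hst : Continuous (stimT Istim) := by
    refine Continuous.prodMk (continuous_pi fun i => hI i) continuous_const
  obtain ⟨Im, hIm⟩ := (isCompact_Icc (a := t₀) (b := t₁)).exists_bound_of_continuousOn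
    hst.continuousOn
  have hAp : ∀ j x, 0 ≤ AJ A B j x := by
    rintro (i | p) x
    · exact hD.1.le.trans ((hD.2.1 i).2 x)
    · exact hD.1.le.trans ((hD.2.2 p).2 x)
  have hAc : ∀ j, Continuous (AJ A B j) := by
    rintro (i | p)
    · exact (hD.2.1 i).1.continuous
    · exact (hD.2.2 p).1.continuous
  set K' := K + |Im| with hK'
  have hK'0 : 0 ≤ K' := by positivity
  set R := gronwallBound R₀ K' K' (t₁ - t₀) with hR
  have hdc : Continuous fun v : NState n => mkS fun j => -(AJ A B j (co j v)) * co j v := by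
    have : ∀ j, Continuous fun v : NState n => -(AJ A B j (co j v)) * co j v := fun j =>
      ((hAc j).comp (co j).continuous).neg.mul (co j).continuous
    exact Continuous.prodMk (continuous_pi fun i => this (Sum.inl i))
      (continuous_pi fun p => this (Sum.inr p))
  obtain ⟨C, hC⟩ := (isCompact_closedBall (0 : NState n) R).exists_bound_of_continuousOn
    hdc.continuousOn
  refine ⟨R, |C| + K' * (1 + |R|), by positivity, fun u g hs hu0 => ?_⟩
  obtain ⟨hc, hg, hGint, hu⟩ := hs
  have hcI : ContinuousOn u (Icc t₀ t₁) := hc.mono Icc_subset_Iic_self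
  have hr : ∀ j, ∀ s ∈ Icc t₀ t₁, |g j s + co j (stimT Istim s)| ≤ K' * (1 + ‖u s‖) := by
    intro j s hs
    have h1 := hK (hist u s) (cont_hist hs.2 hc) j
    have h2 := hg s hs j
    have h3 : hist u s 0 = u s := by simp [hist]
    rw [h3] at h1
    have h4 : |g j s| ≤ K * (1 + ‖u s‖) := abs_le.2 ⟨h1.1.trans h2.1, h2.2.trans h1.2.2⟩
    have h5 : |co j (stimT Istim s)| ≤ |Im| :=
      (abs_co_le j _).trans ((hIm s hs).trans (le_abs_self _))
    refine (abs_add_le _ _).trans ?_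
    have : 0 ≤ |Im| * ‖u s‖ := by positivity
    rw [hK']; nlinarith
  have hhc : ContinuousOn (fun s => K' * (1 + ‖u s‖)) (Icc t₀ t₁) := by fun_prop
  have hbound : ∀ t ∈ Icc t₀ t₁, ‖u t‖ ≤ R := by
    refine gron hR₀ hK'0 hcI.norm (fun t _ => norm_nonneg _) fun t ht => ?_
    have hnn : 0 ≤ ∫ s in t₀..t, K' * (1 + ‖u s‖) :=
      intervalIntegral.integral_nonneg ht.1 fun s _ => by positivity
    refine norm_le_of_co (by positivity) fun j => ?_
    have := two_sided (y := fun s => co j (u s)) (a := fun s => AJ A B j (co j (u s)))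
      (r := fun s => g j s + co j (stimT Istim s)) (h := fun s => K' * (1 + ‖u s‖))
      ((co j).continuous.comp_continuousOn hcI) (fun s => hAp j _) (hr j)
      (hhc.integrableOn_Icc) (by simpa only [GJ, add_assoc] using (show IntegrableOn (fun s => GJ A B Istim u g j s) _ from hGint j))
      (by simpa only [GJ, add_assoc] using hu j) t ht
    refine this.trans ?_
    have := (abs_co_le j (u t₀)).trans hu0
    gcongr
  refine ⟨hbound, fun s hs t ht => ?_⟩
  refine norm_le_of_co (by positivity) fun j => ?_
  rw [map_sub, csol_diff (hGint j) (hu j) hs ht]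
  have := intervalIntegral.norm_integral_le_of_norm_le_const (a := s) (b := t)
    (f := GJ A B Istim u g j) (C := |C| + K' * (1 + |R|)) (by
      intro x hx
      have hx' : x ∈ Icc t₀ t₁ := uIcc_subset_Icc hs ht (uIoc_subset_uIcc hx)
      have h1 := hC (u x) (by simpa using hbound x hx')
      have h2 := (abs_co_le j _).trans h1
      rw [co_mkS] at h2
      have h3 := hr j x hx'
      have h4 := (hbound x hx').trans (le_abs_self _)
      rw [Real.norm_eq_abs, GJ, add_assoc]
      refine (abs_add_le _ _).trans ?_
      have h5 : K' * (1 + ‖u x‖) ≤ K' * (1 + |R|) := by gcongr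
      linarith [le_abs_self C])
  exact this

lemma deriv_le_aux {t₀ t₁ t : ℝ} (ht : t ∈ Ioo t₀ t₁) {y G : ℕ → ℝ → ℝ} {y' : ℝ → ℝ} {D C : ℝ}
    (hd : HasDerivAt y' D t) (hGint : ∀ m, IntegrableOn (G m) (Icc t₀ t₁))
    (hy : ∀ m, ∀ a ∈ Icc t₀ t₁, ∀ b ∈ Icc t₀ t₁, y m b - y m a = ∫ s in a..b, G m s)
    (hlim : ∀ s ∈ Icc t₀ t₁, Tendsto (fun m => y m s) atTop (𝓝 (y' s)))
    (hC : TLe (atTop ×ˢ 𝓝[Icc t₀ t₁] t) (fun a : ℕ × ℝ => G a.1 a.2) C) : D ≤ C := by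
  refine le_of_forall_pos_le_add fun δ hδ => ?_
  obtain ⟨e, he, hle⟩ := hC
  have hev : ∀ᶠ a : ℕ × ℝ in atTop ×ˢ 𝓝[Icc t₀ t₁] t, G a.1 a.2 ≤ C + δ := by
    filter_upwards [hle, he.eventually (Iio_mem_nhds (show C < C + δ by linarith))] with a h1 h2
    exact h1.trans (le_of_lt h2)
  obtain ⟨pa, hpa, pb, hpb, hab⟩ := eventually_prod_iff.1 hev
  rw [nhdsWithin_eq_nhds.2 (Icc_mem_nhds ht.1 ht.2)] at hpb
  obtain ⟨η, hη, hb⟩ := Metric.eventually_nhds_iff.1 hpb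
  have htI : t ∈ Icc t₀ t₁ := ⟨ht.1.le, ht.2.le⟩
  have hs := (hasDerivWithinAt_iff_tendsto_slope' (s := Ioi t) (by simp)).1 hd.hasDerivWithinAt
  refine le_of_tendsto hs ?_
  have hmem : Ioo t (min (t + η) t₁) ∈ 𝓝[>] t :=
    Ioo_mem_nhdsGT (lt_min (by linarith) ht.2)
  filter_upwards [hmem] with s hs
  have hs1 : s < t + η := hs.2.trans_le (min_le_left _ _)
  have hs2 : s < t₁ := hs.2.trans_le (min_le_right _ _)
  have hsI : s ∈ Icc t₀ t₁ := ⟨ht.1.le.trans hs.1.le, hs2.le⟩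
  have hfin : y' s - y' t ≤ (C + δ) * (s - t) := by
    refine le_of_tendsto ((hlim s hsI).sub (hlim t htI)) ?_
    filter_upwards [hpa] with m hm
    rw [hy m t htI s hsI]
    have : ∫ x in t..s, G m x ≤ ∫ x in t..s, (C + δ) := by
      refine intervalIntegral.integral_mono_on hs.1.le (ii_of (hGint m) htI hsI) (by simp) ?_
      intro x hx
      refine hab hm (hb ?_)
      rw [Real.dist_eq, abs_of_nonneg (by linarith [hx.1])]
      linarith [hx.2]
    (rw [intervalIntegral.integral_const, smul_eq_mul, mul_comm] at this; exact this)
  have hpos : 0 < s - t := by linarith [hs.1]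
  rw [slope_def_field, div_le_iff₀ hpos]
  exact hfin

lemma limit_sol {n : ℕ} {ε : ℝ} (hε : ε ∈ Icc (0 : ℝ) (1 / 5)) {A : Fin n → ℝ → ℝ}
    {B : IdxZ n → ℝ → ℝ} {α : ℝ} (hD : HypD α A B) {μ : IdxZ n → Measure ℝ}
    (hμ : ∀ p, μ p (Iic 0) < ⊤) (c d : IdxZ n → ℝ) (Γ : Fin n → ℝ)
    {Istim : Fin n → ℝ → ℝ} (hI : HypI Istim) {t₀ t₁ : ℝ} (ht : t₀ ≤ t₁) (γ : ℝ)
    {um : ℕ → ℝ → NState n} {gm : ℕ → CIdx n → ℝ → ℝ}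
    (hm : ∀ m, CSol ε A B μ c d Γ Istim t₀ t₁ (um m) (gm m)) {u : ℝ → NState n}
    (hu : ContinuousOn u (Iic t₁)) {e : ℕ → ℝ} (he : Tendsto e atTop (𝓝 0))
    (hue : ∀ m, ∀ s ≤ t₁, ‖um m s - u s‖ ≤ e m * Real.exp (γ * (t₁ - s))) {L : ℝ} (hL : 0 ≤ L)
    (hLip : ∀ s ∈ Icc t₀ t₁, ∀ t ∈ Icc t₀ t₁, ‖u t - u s‖ ≤ L * |t - s|) :
    ∃ g, CSol ε A B μ c d Γ Istim t₀ t₁ u g := by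
  classical
  obtain ⟨K, hK0, hK⟩ := growth hε hμ c d Γ
  have hst : Continuous (stimT Istim) := by
    refine Continuous.prodMk (continuous_pi fun i => hI i) continuous_const
  have hAc : ∀ j, Continuous (AJ A B j) := by
    rintro (i | p)
    · exact (hD.2.1 i).1.continuous
    · exact (hD.2.2 p).1.continuous
  -- convergence of shifted arguments
  have hconv : ∀ t ∈ Icc t₀ t₁, ∀ τ ≤ (0 : ℝ),
      Tendsto (fun a : ℕ × ℝ => um a.1 (a.2 + τ)) (atTop ×ˢ 𝓝[Icc t₀ t₁] t) (𝓝 (u (t + τ))) := by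
    intro t htt τ hτ
    have hsnd : Tendsto (fun a : ℕ × ℝ => a.2) (atTop ×ˢ 𝓝[Icc t₀ t₁] t) (𝓝[Icc t₀ t₁] t) :=
      tendsto_snd
    have hmem : ∀ᶠ a : ℕ × ℝ in atTop ×ˢ 𝓝[Icc t₀ t₁] t, a.2 ∈ Icc t₀ t₁ :=
      hsnd.eventually self_mem_nhdsWithin
    have hshift : Tendsto (fun a : ℕ × ℝ => a.2 + τ) (atTop ×ˢ 𝓝[Icc t₀ t₁] t)
        (𝓝[Iic t₁] (t + τ)) := by
      refine tendsto_nhdsWithin_iff.2 ⟨?_, ?_⟩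
      · exact (tendsto_nhds_of_tendsto_nhdsWithin hsnd).add tendsto_const_nhds
      · filter_upwards [hmem] with a ha
        exact Set.mem_Iic.2 (by linarith [ha.2])
    have h1 : Tendsto (fun a : ℕ × ℝ => u (a.2 + τ)) (atTop ×ˢ 𝓝[Icc t₀ t₁] t)
        (𝓝 (u (t + τ))) :=
      Tendsto.comp (hu (t + τ) (Set.mem_Iic.2 (by linarith [htt.2]))) hshift
    have h2 : Tendsto (fun a : ℕ × ℝ => um a.1 (a.2 + τ) - u (a.2 + τ))
        (atTop ×ˢ 𝓝[Icc t₀ t₁] t) (𝓝 0) := by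
      have hz : Tendsto (fun a : ℕ × ℝ => e a.1 * Real.exp (γ * (t₁ - (a.2 + τ))))
          (atTop ×ˢ 𝓝[Icc t₀ t₁] t) (𝓝 0) := by
        have a1 : Tendsto (fun a : ℕ × ℝ => e a.1) (atTop ×ˢ 𝓝[Icc t₀ t₁] t) (𝓝 0) :=
          he.comp tendsto_fst
        have a2 : Tendsto (fun a : ℕ × ℝ => Real.exp (γ * (t₁ - (a.2 + τ))))
            (atTop ×ˢ 𝓝[Icc t₀ t₁] t) (𝓝 (Real.exp (γ * (t₁ - (t + τ))))) := by
          have : Continuous fun s : ℝ => Real.exp (γ * (t₁ - (s + τ))) := by fun_prop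
          exact (this.tendsto t).comp (tendsto_nhds_of_tendsto_nhdsWithin hsnd)
        simpa using a1.mul a2
      refine squeeze_zero_norm' ?_ hz
      filter_upwards [hmem] with a ha
      exact hue a.1 _ (by linarith [ha.2])
    simpa using h2.add h1
  have hlim0 : ∀ s ∈ Icc t₀ t₁, Tendsto (fun m => um m s) atTop (𝓝 (u s)) := by
    intro s hs
    have := (hconv s hs 0 le_rfl).comp
      ((tendsto_id (x := (atTop : Filter ℕ))).prodMk
        (tendsto_const_pure.mono_right (pure_le_nhdsWithin hs)))
    simpa [Function.comp_def] using this
  -- derivative inclusion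
  have hder : ∀ t ∈ Ioo t₀ t₁, ∀ j, ∀ D, HasDerivAt (fun s => co j (u s)) D t →
      D + AJ A B j (co j (u t)) * co j (u t) - co j (stimT Istim t) ∈
        Icc (loJ ε μ c d Γ j (hist u t)) (upJ ε μ c d Γ j (hist u t)) := by
    intro t htt j D hDer
    have htI : t ∈ Icc t₀ t₁ := ⟨htt.1.le, htt.2.le⟩
    set l : Filter (ℕ × ℝ) := atTop ×ˢ 𝓝[Icc t₀ t₁] t with hl
    have hsnd : Tendsto (fun a : ℕ × ℝ => a.2) l (𝓝[Icc t₀ t₁] t) := tendsto_snd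
    have hmem : ∀ᶠ a : ℕ × ℝ in l, a.2 ∈ Icc t₀ t₁ := hsnd.eventually self_mem_nhdsWithin
    have hJ := J_usc hε hμ c d Γ (l := l) (x := fun a => hist (um a.1) a.2) (y := hist u t)
      (by filter_upwards [hmem] with a ha using cont_hist ha.2 (hm a.1).1)
      (cont_hist htt.2.le hu) (fun τ hτ => hconv t htI τ hτ) j
    have hx : Tendsto (fun a : ℕ × ℝ => co j (um a.1 a.2)) l (𝓝 (co j (u t))) := by
      have := ((co j).continuous.tendsto _).comp (hconv t htI 0 le_rfl)
      simpa [Function.comp_def] using this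
    have hdec : Tendsto (fun a : ℕ × ℝ => -(AJ A B j (co j (um a.1 a.2))) * co j (um a.1 a.2)) l
        (𝓝 (-(AJ A B j (co j (u t))) * co j (u t))) :=
      ((((hAc j).tendsto _).comp hx).neg).mul hx
    have hsti : Tendsto (fun a : ℕ × ℝ => co j (stimT Istim a.2)) l
        (𝓝 (co j (stimT Istim t))) :=
      ((((co j).continuous.comp hst).tendsto t)).comp (tendsto_nhds_of_tendsto_nhdsWithin hsnd)
    have hdiff : ∀ m, ∀ a ∈ Icc t₀ t₁, ∀ b ∈ Icc t₀ t₁, co j (um m b) - co j (um m a) =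
        ∫ s in a..b, GJ A B Istim (um m) (gm m) j s := fun m a ha b hb =>
      csol_diff (f := fun s => co j (um m s)) ((hm m).2.2.1 j) ((hm m).2.2.2 j) ha hb
    have hlimj : ∀ s ∈ Icc t₀ t₁, Tendsto (fun m => co j (um m s)) atTop (𝓝 (co j (u s))) :=
      fun s hs => ((co j).continuous.tendsto _).comp (hlim0 s hs)
    obtain ⟨⟨e1, he1, hle1⟩, ⟨e2, he2, hle2⟩⟩ := hJ
    have hup : D ≤ -(AJ A B j (co j (u t))) * co j (u t) + upJ ε μ c d Γ j (hist u t) +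
        co j (stimT Istim t) := by
      refine deriv_le_aux htt (y := fun m s => co j (um m s)) hDer
        (fun m => (hm m).2.2.1 j) hdiff hlimj ⟨_, (hdec.add he1).add hsti, ?_⟩
      filter_upwards [hmem, hle1] with a ha h1
      have := ((hm a.1).2.1 a.2 ha j).2
      simp only [GJ]
      linarith
    have hlo : -D ≤ -(-(AJ A B j (co j (u t))) * co j (u t) + loJ ε μ c d Γ j (hist u t) +
        co j (stimT Istim t)) := by
      refine deriv_le_aux htt (y := fun m s => - co j (um m s))
        (G := fun m s => - GJ A B Istim (um m) (gm m) j s) hDer.fun_neg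
        (fun m => ((hm m).2.2.1 j).neg) ?_ (fun s hs => (hlimj s hs).neg)
        ⟨_, ((hdec.add he2).add hsti).neg, ?_⟩
      · intro m a ha b hb
        rw [intervalIntegral.integral_neg, ← hdiff m a ha b hb]; ring
      · filter_upwards [hmem, hle2] with a ha h1
        have := ((hm a.1).2.1 a.2 ha j).1
        simp only [GJ]
        linarith
    constructor <;> linarith
  -- absolute continuity
  have hAC : ∀ j, ∀ t ∈ Icc t₀ t₁, AbsolutelyContinuousOnInterval (fun s => co j (u s)) t₀ t := by
    intro j t htt
    refine LipschitzOnWith.absolutelyContinuousOnInterval (K := L.toNNReal) ?_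
    rw [uIcc_of_le htt.1]
    refine LipschitzOnWith.of_dist_le_mul fun x hx y hy => ?_
    rw [Real.dist_eq, Real.dist_eq, ← map_sub, Real.coe_toNNReal _ hL]
    exact (abs_co_le j _).trans (hLip y ⟨hy.1, hy.2.trans htt.2⟩ x ⟨hx.1, hx.2.trans htt.2⟩)
  have ht1 : t₁ ∈ Icc t₀ t₁ := ⟨ht, le_rfl⟩
  set good : ℝ → Prop := fun t => t ∈ Ioo t₀ t₁ ∧
    ∀ j, DifferentiableAt ℝ (fun s => co j (u s)) t with hgood
  have hae : ∀ᵐ t ∂(volume.restrict (Icc t₀ t₁)), good t := by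
    rw [← Measure.restrict_congr_set (Ioo_ae_eq_Icc (μ := volume) (a := t₀) (b := t₁))]
    rw [ae_restrict_iff' measurableSet_Ioo]
    filter_upwards [ae_all_iff.2 fun j => (hAC j t₁ ht1).ae_differentiableAt] with t h1 h2
    refine ⟨h2, fun j => h1 j ?_⟩
    rw [uIcc_of_le ht]
    exact ⟨h2.1.le, h2.2.le⟩
  set g : CIdx n → ℝ → ℝ := fun j t => if good t then
    deriv (fun s => co j (u s)) t + AJ A B j (co j (u t)) * co j (u t) - co j (stimT Istim t)
    else loJ ε μ c d Γ j (hist u t) with hg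
  have hGd : ∀ j, GJ A B Istim u g j =ᵐ[volume.restrict (Icc t₀ t₁)]
      deriv (fun s => co j (u s)) := by
    intro j
    filter_upwards [hae] with t htg
    simp only [GJ, hg, if_pos htg]
    ring
  refine ⟨g, hu, fun t htt j => ?_, fun j => ?_, fun j t htt => ?_⟩
  · by_cases h : good t
    · simp only [hg, if_pos h]
      exact hder t h.1 j _ (h.2 j).hasDerivAt
    · simp only [hg, if_neg h]
      exact ⟨le_rfl, (hK _ (cont_hist htt.2 hu) j).2.1⟩
  · have h1 := (hAC j t₁ ht1).intervalIntegrable_deriv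
    rw [intervalIntegrable_iff_integrableOn_Icc_of_le ht] at h1
    exact Integrable.congr h1 (hGd j).symm
  · have h1 := (hAC j t htt).integral_deriv_eq_sub
    have h2 : ∫ s in t₀..t, GJ A B Istim u g j s = ∫ s in t₀..t, deriv (fun s => co j (u s)) s := by
      rw [intervalIntegral.integral_of_le htt.1, intervalIntegral.integral_of_le htt.1]
      refine integral_congr_ae ?_
      exact ae_restrict_of_ae_restrict_of_subset
        (Ioc_subset_Icc_self.trans (Icc_subset_Icc_right htt.2)) (hGd j)
    rw [h2, h1]; ring

lemma extract {n : ℕ} {t₀ t₁ R L : ℝ} (ht : t₀ ≤ t₁) (hL : 0 ≤ L) {f : ℕ → ℝ → NState n}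
    (hR : ∀ m, ∀ t ∈ Icc t₀ t₁, ‖f m t‖ ≤ R)
    (hLip : ∀ m, ∀ s ∈ Icc t₀ t₁, ∀ t ∈ Icc t₀ t₁, ‖f m t - f m s‖ ≤ L * |t - s|) :
    ∃ φ : ℕ → ℕ, StrictMono φ ∧ ∃ w : ℝ → NState n, ∃ e : ℕ → ℝ, Tendsto e atTop (𝓝 0) ∧
      (∀ k, 0 ≤ e k) ∧ ∀ k, ∀ s ∈ Icc t₀ t₁, ‖f (φ k) s - w s‖ ≤ e k := by
  have hlw : ∀ m, LipschitzWith L.toNNReal ((Icc t₀ t₁).domRestrict (f m)) := by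
    intro m
    refine LipschitzWith.of_dist_le_mul fun x y => ?_
    rw [Real.coe_toNNReal _ hL, dist_eq_norm, Subtype.dist_eq, Real.dist_eq]
    exact hLip m y y.2 x x.2
  set F : ℕ → BoundedContinuousFunction (Icc t₀ t₁) (NState n) := fun m =>
    BoundedContinuousFunction.mkOfCompact ⟨(Icc t₀ t₁).domRestrict (f m), (hlw m).continuous⟩
    with hF
  have hcomp : IsCompact (closure (range F)) := by
    refine BoundedContinuousFunction.arzela_ascoli (Metric.closedBall (0 : NState n) R)
      (isCompact_closedBall _ _) (range F) ?_ ?_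
    · rintro _ x ⟨m, rfl⟩
      simpa [hF] using hR m x x.2
    · refine (LipschitzWith.uniformEquicontinuous _ L.toNNReal ?_).equicontinuous
      rintro ⟨_, m, rfl⟩
      exact hlw m
  obtain ⟨W, -, φ, hφ, hlim⟩ := hcomp.tendsto_subseq (x := F) fun m => subset_closure ⟨m, rfl⟩
  refine ⟨φ, hφ, IccExtend ht W, fun k => dist (F (φ k)) W,
    tendsto_iff_dist_tendsto_zero.1 hlim, fun k => dist_nonneg, fun k s hs => ?_⟩
  rw [IccExtend_of_mem ht _ hs, ← dist_eq_norm]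
  exact BoundedContinuousFunction.dist_coe_le_dist (f := F (φ k)) (g := W) ⟨s, hs⟩

lemma core {n : ℕ} {ε : ℝ} (hε : ε ∈ Icc (0 : ℝ) (1 / 5)) {A : Fin n → ℝ → ℝ}
    {B : IdxZ n → ℝ → ℝ} {α : ℝ} (hD : HypD α A B) {μ : IdxZ n → Measure ℝ}
    (hμ : ∀ p, μ p (Iic 0) < ⊤) (c d : IdxZ n → ℝ) (Γ : Fin n → ℝ)
    {Istim : Fin n → ℝ → ℝ} (hI : HypI Istim) {t₀ t₁ : ℝ} (ht : t₀ ≤ t₁) {γ : ℝ} (hγ : 0 < γ)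
    {U um : ℕ → ℝ → NState n} {u₀ : ℝ → NState n}
    (hU : ∀ m, ContinuousOn (U m) (Iic 0)) (hu₀ : ContinuousOn u₀ (Iic 0))
    {e0 : ℕ → ℝ} (he0 : Tendsto e0 atTop (𝓝 0))
    (hUe : ∀ m, ∀ s ≤ (0 : ℝ), Real.exp (γ * s) * ‖U m s - u₀ s‖ ≤ e0 m)
    (hsol : ∀ m, IsIncSolOn ε A B μ c d Γ Istim t₀ t₁ (U m) (um m)) :
    ∃ φ : ℕ → ℕ, StrictMono φ ∧ ∃ u, IsIncSolOn ε A B μ c d Γ Istim t₀ t₁ u₀ u ∧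
      Tendsto (fun k => gNorm γ (fun s => clampHist (um (φ k)) t₁ s - clampHist u t₁ s))
        atTop (𝓝 0) := by
  choose gm hgm using fun m => sol_to_csol hε hμ ht (hU m) (hsol m)
  have he0nn : ∀ m, 0 ≤ e0 m := fun m => le_trans (by positivity) (hUe m 0 le_rfl)
  have hum0 : ∀ m, um m t₀ = U m 0 := fun m => by
    have := (hsol m).1 0 le_rfl
    rwa [add_zero] at this
  have hdiff : ∀ m, ‖um m t₀ - u₀ 0‖ ≤ e0 m := fun m => by
    have := hUe m 0 le_rfl
    rw [mul_zero, Real.exp_zero, one_mul] at this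
    rw [hum0 m]; exact this
  obtain ⟨E, hE⟩ := he0.bddAbove_range
  have hE' : ∀ m, e0 m ≤ E := fun m => hE ⟨m, rfl⟩
  have hE0 : 0 ≤ E := (he0nn 0).trans (hE' 0)
  obtain ⟨R, L, hL, hap⟩ := apriori hε hD hμ c d Γ hI t₀ t₁ (‖u₀ 0‖ + E) (by positivity)
  have hap' := fun m => hap (um m) (gm m) (hgm m) (by
    have h1 := hdiff m
    have h2 := norm_sub_norm_le (um m t₀) (u₀ 0)
    linarith [hE' m])
  obtain ⟨φ, hφ, w, e1, he1, he1nn, hw⟩ := extract ht hL (fun m => (hap' m).1)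
    (fun m => (hap' m).2)
  have hlimw : ∀ s ∈ Icc t₀ t₁, Tendsto (fun k => um (φ k) s) atTop (𝓝 (w s)) := by
    intro s hs
    rw [tendsto_iff_norm_sub_tendsto_zero]
    exact squeeze_zero (fun k => norm_nonneg _) (fun k => hw k s hs) he1
  have he0φ : Tendsto (fun k => e0 (φ k)) atTop (𝓝 0) := he0.comp hφ.tendsto_atTop
  have hw0 : w t₀ = u₀ 0 := by
    refine tendsto_nhds_unique (hlimw t₀ ⟨le_rfl, ht⟩) ?_
    rw [tendsto_iff_norm_sub_tendsto_zero]
    exact squeeze_zero (fun k => norm_nonneg _) (fun k => hdiff (φ k)) he0φ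
  set u : ℝ → NState n := fun s => if s ≤ t₀ then u₀ (s - t₀) else w s with hu
  have huw : ∀ s ∈ Icc t₀ t₁, u s = w s := by
    intro s hs
    rcases eq_or_lt_of_le hs.1 with h | h
    · subst h
      simp [hu, hw0]
    · simp [hu, not_le.2 h]
  have huhist : ∀ s ≤ (0 : ℝ), u (t₀ + s) = u₀ s := by
    intro s hs
    have : t₀ + s ≤ t₀ := by linarith
    simp [hu, hs]
  have hLip : ∀ s ∈ Icc t₀ t₁, ∀ t ∈ Icc t₀ t₁, ‖u t - u s‖ ≤ L * |t - s| := by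
    intro s hs t ht'
    rw [huw s hs, huw t ht']
    exact le_of_tendsto ((hlimw t ht').sub (hlimw s hs)).norm
      (Eventually.of_forall fun k => (hap' (φ k)).2 s hs t ht')
  have hcI : ContinuousOn u (Icc t₀ t₁) := by
    have : LipschitzOnWith L.toNNReal u (Icc t₀ t₁) := by
      refine LipschitzOnWith.of_dist_le_mul fun x hx y hy => ?_
      rw [Real.coe_toNNReal _ hL, dist_eq_norm, Real.dist_eq]
      exact hLip y hy x hx
    exact this.continuousOn
  have hcu := cont_glue ht hu₀ huhist hcI
  have hue : ∀ k, ∀ s ≤ t₁, ‖um (φ k) s - u s‖ ≤ (e0 (φ k) + e1 k) * Real.exp (γ * (t₁ - s)) := by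
    intro k s hs
    rcases le_total s t₀ with h | h
    · have h1 := hUe (φ k) (s - t₀) (by linarith)
      have h2 := (hsol (φ k)).1 (s - t₀) (by linarith)
      have h3 := huhist (s - t₀) (by linarith)
      rw [add_sub_cancel] at h2 h3
      rw [h2, h3]
      have h4 : ‖U (φ k) (s - t₀) - u₀ (s - t₀)‖ ≤ e0 (φ k) * Real.exp (γ * (t₀ - s)) := by
        have h5 := mul_le_mul_of_nonneg_right h1 (Real.exp_pos (γ * (t₀ - s))).le
        have h6 : Real.exp (γ * (s - t₀)) * Real.exp (γ * (t₀ - s)) = 1 := by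
          rw [← Real.exp_add, ← Real.exp_zero]; congr 1; ring
        calc _ = (Real.exp (γ * (s - t₀)) * Real.exp (γ * (t₀ - s))) *
              ‖U (φ k) (s - t₀) - u₀ (s - t₀)‖ := by rw [h6, one_mul]
          _ ≤ _ := by linarith
      have h7 : Real.exp (γ * (t₀ - s)) ≤ Real.exp (γ * (t₁ - s)) := by
        apply Real.exp_le_exp.2
        exact mul_le_mul_of_nonneg_left (by linarith) hγ.le
      refine h4.trans (mul_le_mul ?_ h7 (Real.exp_pos _).le ?_)
      · linarith [he1nn k]
      · linarith [he1nn k, he0nn (φ k)]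
    · have h1 := hw k s ⟨h, hs⟩
      rw [huw s ⟨h, hs⟩]
      have h7 : 1 ≤ Real.exp (γ * (t₁ - s)) := by
        apply Real.one_le_exp
        exact mul_nonneg hγ.le (by linarith)
      have h8 : 0 ≤ e0 (φ k) + e1 k := by linarith [he1nn k, he0nn (φ k)]
      have := le_mul_of_one_le_right h8 h7
      linarith [he0nn (φ k)]
  have he : Tendsto (fun k => e0 (φ k) + e1 k) atTop (𝓝 0) := by
    simpa using he0φ.add he1
  obtain ⟨g, hg⟩ := limit_sol hε hD hμ c d Γ hI ht γ (fun k => hgm (φ k)) hcu he hue hL hLip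
  refine ⟨φ, hφ, u, csol_to_sol hε hμ huhist hg, ?_⟩
  refine squeeze_zero (fun k => ?_) (fun k => ?_) he
  · exact Real.iSup_nonneg fun t => by positivity
  · haveI : Nonempty (Iic (0 : ℝ)) := ⟨⟨0, Set.mem_Iic.2 le_rfl⟩⟩
    refine ciSup_le fun t => ?_
    have ht0 : t.1 ≤ 0 := t.2
    simp only [clampHist, min_eq_left ht0]
    have h1 := hue k (t₁ + t.1) (by linarith)
    have h5 := mul_le_mul_of_nonneg_left h1 (Real.exp_pos (γ * t.1)).le
    have h6 : Real.exp (γ * t.1) * Real.exp (γ * (t₁ - (t₁ + t.1))) = 1 := by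
      rw [← Real.exp_add, ← Real.exp_zero]; congr 1; ring
    refine h5.trans (le_of_eq ?_)
    rw [mul_left_comm, h6, mul_one]

lemma clamp_inC {n : ℕ} {ε : ℝ} {A : Fin n → ℝ → ℝ}
    {B : IdxZ n → ℝ → ℝ} {μ : IdxZ n → Measure ℝ} {c d : IdxZ n → ℝ} {Γ : Fin n → ℝ}
    {Istim : Fin n → ℝ → ℝ} {t₀ t₁ : ℝ} (ht : t₀ ≤ t₁) {γ : ℝ} (hγ : 0 < γ)
    {u₀ u : ℝ → NState n} (hu₀ : InC γ u₀)
    (h : IsIncSolOn ε A B μ c d Γ Istim t₀ t₁ u₀ u) : InC γ (clampHist u t₁) := by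
  obtain ⟨hc0, ⟨l, hl⟩, ⟨b, hb⟩⟩ := hu₀
  have hcu := cont_glue ht hc0 h.1 h.2.1
  have hpast : ∀ t ≤ t₀ - t₁, Real.exp (γ * t) • clampHist u t₁ t =
      Real.exp (γ * (t₀ - t₁)) • (Real.exp (γ * (t + (t₁ - t₀))) • u₀ (t + (t₁ - t₀))) := by
    intro t h1
    have h2 := h.1 (t + (t₁ - t₀)) (by linarith)
    rw [← h2, smul_smul, ← Real.exp_add, clampHist, min_eq_left (by linarith)]
    congr 2 <;> ring
  refine ⟨?_, ⟨Real.exp (γ * (t₀ - t₁)) • l, ?_⟩, ?_⟩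
  · refine hcu.comp (by fun_prop) fun s hs => ?_
    have := min_le_right s 0
    exact Set.mem_Iic.2 (by linarith)
  · have h1 : Tendsto (fun t : ℝ => t + (t₁ - t₀)) atBot atBot :=
      tendsto_atBot_add_const_right _ _ tendsto_id
    refine ((hl.comp h1).const_smul (Real.exp (γ * (t₀ - t₁)))).congr' ?_
    filter_upwards [eventually_le_atBot (t₀ - t₁)] with t h2
    exact (hpast t h2).symm
  · obtain ⟨C, hC⟩ := (isCompact_Icc (a := t₀) (b := t₁)).exists_bound_of_continuousOn h.2.1
    refine ⟨max C (Real.exp (γ * (t₀ - t₁)) * b), ?_⟩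
    rintro _ ⟨⟨t, ht0⟩, rfl⟩
    have ht0' : t ≤ 0 := ht0
    show Real.exp (γ * t) * ‖clampHist u t₁ t‖ ≤ _
    rcases le_total t (t₀ - t₁) with h1 | h1
    · refine le_trans ?_ (le_max_right _ _)
      have e1 : Real.exp (γ * t) * ‖clampHist u t₁ t‖ = ‖Real.exp (γ * t) • clampHist u t₁ t‖ := by
        rw [norm_smul, Real.norm_eq_abs, abs_of_pos (Real.exp_pos _)]
      rw [e1, hpast t h1, norm_smul, norm_smul, Real.norm_eq_abs, Real.norm_eq_abs,
        abs_of_pos (Real.exp_pos _), abs_of_pos (Real.exp_pos _)]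
      refine mul_le_mul_of_nonneg_left ?_ (Real.exp_pos _).le
      exact hb ⟨⟨t + (t₁ - t₀), Set.mem_Iic.2 (by linarith)⟩, rfl⟩
    · refine le_trans ?_ (le_max_left _ _)
      have h2 : clampHist u t₁ t = u (t₁ + t) := by rw [clampHist, min_eq_left ht0']
      rw [h2]
      have h3 := hC (t₁ + t) ⟨by linarith, by linarith⟩
      have h4 : Real.exp (γ * t) ≤ 1 := Real.exp_le_one_iff.2 (mul_nonpos_of_nonneg_of_nonpos hγ.le ht0')
      exact (mul_le_of_le_one_left (norm_nonneg _) h4).trans h3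

lemma le_gNorm {n : ℕ} {γ : ℝ} {u v : ℝ → NState n} (hu : InC γ u) (hv : InC γ v) {s : ℝ}
    (hs : s ≤ 0) : Real.exp (γ * s) * ‖u s - v s‖ ≤ gNorm γ (fun s => u s - v s) := by
  obtain ⟨b, hb⟩ := hu.2.2
  obtain ⟨b', hb'⟩ := hv.2.2
  have hbd : BddAbove (range fun t : Iic (0 : ℝ) => Real.exp (γ * t.1) * ‖u t.1 - v t.1‖) := by
    refine ⟨b + b', ?_⟩
    rintro _ ⟨t, rfl⟩
    have h1 : Real.exp (γ * t.1) * ‖u t.1‖ ≤ b := hb ⟨t, rfl⟩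
    have h2 : Real.exp (γ * t.1) * ‖v t.1‖ ≤ b' := hb' ⟨t, rfl⟩
    have h3 := mul_le_mul_of_nonneg_left (norm_sub_le (u t.1) (v t.1)) (Real.exp_pos (γ * t.1)).le
    show Real.exp (γ * t.1) * ‖u t.1 - v t.1‖ ≤ _
    linarith
  exact le_ciSup hbd ⟨s, hs⟩

/-- the attainability sets are compact (sequential compactness in the
`‖·‖_γ` metric) and the attainability process is upper semicontinuous in the
initial datum. -/
theorem stmt15 {n : ℕ} (hn : 2 ≤ n) (γ α : ℝ) (hγ : 0 < γ)
    (A : Fin n → ℝ → ℝ) (B : IdxZ n → ℝ → ℝ) (μ : IdxZ n → Measure ℝ)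
    (c d : IdxZ n → ℝ) (Γ : Fin n → ℝ) (Istim : Fin n → ℝ → ℝ)
    (hD : HypD α A B) (hM : HypM γ μ) (hI : HypI Istim)
    (hc : ∀ p, 0 ≤ c p) (hd : ∀ p, 0 ≤ d p)
    (ε : ℝ) (hε : ε ∈ Icc (0 : ℝ) (1 / 5))
    (t₀ t₁ : ℝ) (ht : t₀ ≤ t₁)
    (u₀ : ℝ → NState n) (hu₀ : InC γ u₀) (hcl : ∀ s ≥ (0 : ℝ), u₀ s = u₀ 0) :
    (∀ v : ℕ → ℝ → NState n,
      (∀ m, v m ∈ attain ε A B μ c d Γ Istim t₁ t₀ u₀) →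
      ∃ φ : ℕ → ℕ, StrictMono φ ∧ ∃ w ∈ attain ε A B μ c d Γ Istim t₁ t₀ u₀,
        Tendsto (fun k => gNorm γ (fun s => v (φ k) s - w s)) atTop (𝓝 0)) ∧
    ∀ V : Set (ℝ → NState n),
      (∀ w ∈ V, ∃ ρ > (0 : ℝ), ∀ w' : ℝ → NState n, InC γ w' →
        (∀ s ≥ (0 : ℝ), w' s = w' 0) → gNorm γ (fun s => w' s - w s) < ρ → w' ∈ V) →
      attain ε A B μ c d Γ Istim t₁ t₀ u₀ ⊆ V →
      ∃ δ > (0 : ℝ), ∀ u : ℝ → NState n, InC γ u → (∀ s ≥ (0 : ℝ), u s = u 0) →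
        gNorm γ (fun s => u s - u₀ s) < δ →
        attain ε A B μ c d Γ Istim t₁ t₀ u ⊆ V := by
  have hμ : ∀ p, μ p (Iic 0) < ⊤ := fun p => mass_lt_top hγ hM p
  refine ⟨?_, ?_⟩
  · intro v hv
    choose um hsol hvm using hv
    obtain ⟨φ, hφ, u, hu, hlim⟩ := core hε hD hμ c d Γ hI ht hγ (U := fun _ => u₀) (e0 := fun _ => 0)
      (fun _ => hu₀.1) hu₀.1 tendsto_const_nhds (by simp) hsol
    refine ⟨φ, hφ, clampHist u t₁, ⟨u, hu, rfl⟩, ?_⟩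
    simpa only [hvm] using hlim
  · intro V hV hsub
    by_contra hcon
    push Not at hcon
    choose U hU _ hUlt hnot using fun m : ℕ => hcon (1 / ((m : ℝ) + 1)) (by positivity)
    choose v hv hvV using fun m => Set.not_subset.1 (hnot m)
    choose um hsol hvm using hv
    obtain ⟨φ, hφ, u, hu, hlim⟩ := core hε hD hμ c d Γ hI ht hγ (U := U)
      (e0 := fun m : ℕ => 1 / ((m : ℝ) + 1))
      (fun m => (hU m).1) hu₀.1 tendsto_one_div_add_atTop_nhds_zero_nat
      (fun m s hs => (le_gNorm (hU m) hu₀ hs).trans (hUlt m).le) hsol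
    obtain ⟨ρ, hρ, hball⟩ := hV (clampHist u t₁) (hsub ⟨u, hu, rfl⟩)
    obtain ⟨k, hk⟩ := (hlim.eventually (gt_mem_nhds hρ)).exists
    apply hvV (φ k)
    rw [hvm (φ k)]
    refine hball _ (clamp_inC ht hγ (hU (φ k)) (hsol (φ k))) (fun s hs => ?_) hk
    simp [clampHist, min_eq_right hs]

end
end

section
/- Assume hypotheses (D), (M), (I), and (A). Then there exist γ₀>0 and constants β>0, K≥0, ξ>0 (depending only on the data) such that for every γ∈(0,γ₀) (in particular γ<β/2), every ε∈[0,1/5], every t₀∈ℝ, and every solution u of the ε-inflated differential inclusion on [t₀,t] with u_{t₀}∈C_γ, one has ‖u_t‖_γ ≤ n·e^{−γ(t−t₀)}·‖u_{t₀}‖_γ + √(K/β) + (1/√ξ)·( Σ_{i=1}^n ∫_{t₀}^t I_i(s)² ds )^{1/2} for all t≥t₀. Consequently, the nonautonomous family of balls Λ(t) = { φ∈C_γ : ‖φ‖_γ ≤ √(K/β) + (1/√ξ)( Σ_i ∫_{t₀}^t I_i² )^{1/2} + 1 } is pullback absorbing for the attainability process Φ^ε within the universe of nonautonomous sets uniformly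 bounded in C_γ. -/
open MeasureTheory Set Filter Topology Pointwise

noncomputable section

lemma young_aux {X Y M a b : ℝ} (hX : 0 ≤ X) (hY : 0 ≤ Y) (h : X * Y = M ^ 2) :
    2 * (M * a * b) ≤ X * a ^ 2 + Y * b ^ 2 := by
  have h0 : 0 ≤ X * a ^ 2 + Y * b ^ 2 := by positivity
  apply le_of_sq_le_sq _ h0
  have : (2 * (M * a * b)) ^ 2 = 4 * (X * Y) * (a ^ 2 * b ^ 2) := by rw [h]; ring
  rw [this]
  nlinarith [sq_nonneg (X * a ^ 2 - Y * b ^ 2)]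

lemma exists_pos_lb {ι : Type*} [Finite ι] (g : ι → ℝ) (hg : ∀ i, 0 < g i) :
    ∃ δ > 0, ∀ i, δ ≤ g i := by
  cases isEmpty_or_nonempty ι with
  | inl h => exact ⟨1, one_pos, fun i => h.elim i⟩
  | inr h =>
    obtain ⟨i, hi⟩ := Finite.exists_min g
    exact ⟨g i, hg i, hi⟩

lemma sum_reindex {n : ℕ} (g : IdxZ n → ℝ) :
    ∑ i : Fin n, ∑ k : Fin n, (if h : k ≠ i then g ⟨(k, i), h⟩ else 0) = ∑ p, g p := by
  rw [Finset.sum_comm, ← Fintype.sum_prod_type'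
    (f := fun k i : Fin n => if h : k ≠ i then g ⟨(k, i), h⟩ else 0)]
  symm
  refine Finset.sum_of_injOn Subtype.val Subtype.val_injective.injOn (by simp) ?_ ?_
  · rintro ⟨k, i⟩ _ hp
    have : ¬ k ≠ i := fun h => hp ⟨⟨(k, i), h⟩, by simp, rfl⟩
    simp only [dif_neg this]
  · rintro ⟨⟨k, i⟩, h⟩ _
    have h2 : k ≠ i := h
    simp only [dif_pos h2]

lemma energy_gronwall {ι : Type*} [Fintype ι] (y f : ι → ℝ → ℝ) (y0 : ι → ℝ) (G : ℝ → ℝ)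
    (a b β K : ℝ) (hab : a ≤ b) (hβ : 0 < β) (hK : 0 ≤ K) (hG : Continuous G)
    (hG0 : ∀ t, 0 ≤ G t)
    (hf : ∀ i, IntervalIntegrable (f i) volume a b)
    (hy : ∀ i, ∀ t ∈ Icc a b, y i t = y0 i + ∫ s in a..t, f i s)
    (hineq : ∀ t ∈ Icc a b, 2 * ∑ i, y i t * f i t ≤ -β * ∑ i, y i t ^ 2 + K + G t) :
    ∑ i, y i b ^ 2 ≤ Real.exp (-β * (b - a)) * ∑ i, y i a ^ 2 + K / β + ∫ s in a..b, G s := by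
  set Y : ι → ℝ → ℝ := fun i t => y0 i + ∫ s in a..t, f i s with hY
  set W : ℝ → ℝ := fun s => Real.exp (β * s) * (∑ i, Y i s ^ 2 - K / β)
    - Real.exp (β * b) * ∫ r in a..s, G r with hW
  have hconst : ∀ c : ℝ, AbsolutelyContinuousOnInterval (fun _ : ℝ => c) a b := fun c =>
    (contDiff_const.contDiffOn).absolutelyContinuousOnInterval
  have hYac : ∀ i, AbsolutelyContinuousOnInterval (Y i) a b := fun i =>
    (hconst (y0 i)).add ((hf i).absolutelyContinuousOnInterval_intervalIntegral (by simp))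
  have hsum : ∀ s : Finset ι, AbsolutelyContinuousOnInterval (fun t => ∑ i ∈ s, Y i t ^ 2) a b := by
    classical
    intro s
    induction s using Finset.induction_on with
    | empty => simpa using hconst 0
    | insert i s hi ih =>
      simp only [Finset.sum_insert hi]
      refine AbsolutelyContinuousOnInterval.add ?_ ih
      simp only [pow_two]
      exact (hYac i).mul (hYac i)
  have hWac : AbsolutelyContinuousOnInterval W a b := by
    refine AbsolutelyContinuousOnInterval.sub ?_ ?_
    · refine AbsolutelyContinuousOnInterval.mul ?_ ((hsum Finset.univ).sub (hconst _))
      refine ContDiffOn.absolutelyContinuousOnInterval (ContDiff.contDiffOn ?_)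
      fun_prop
    · exact AbsolutelyContinuousOnInterval.const_mul _
        ((hG.intervalIntegrable a b).absolutelyContinuousOnInterval_intervalIntegral (by simp))
  have hder : ∀ᵐ x, x ∈ Icc a b → deriv W x ≤ 0 := by
    have h1 : ∀ᵐ x, ∀ i, x ∈ uIcc a b → ∀ c ∈ uIcc a b,
        HasDerivAt (fun x => ∫ (t : ℝ) in c..x, f i t) (f i x) x :=
      ae_all_iff.2 fun i => (hf i).ae_hasDerivAt_integral
    filter_upwards [h1] with x hx hxab
    have hYd : ∀ i, HasDerivAt (Y i) (f i x) x := fun i =>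
      (hx i (by rwa [uIcc_of_le hab]) a (by simp)).const_add (y0 i)
    have hGd : HasDerivAt (fun s => ∫ r in a..s, G r) (G x) x :=
      hG.integral_hasStrictDerivAt a x |>.hasDerivAt
    have hE : HasDerivAt (fun s => Real.exp (β * s)) (Real.exp (β * x) * β) x := by
      simpa using ((hasDerivAt_id x).const_mul β).exp
    have hS : HasDerivAt (fun s => ∑ i, Y i s ^ 2) (∑ i, 2 * (Y i x * f i x)) x := by
      refine HasDerivAt.fun_sum fun i _ => ?_
      have h3 := (hYd i).fun_pow 2
      have e : (2 : ℝ) * (Y i x * f i x) = ((2 : ℕ) : ℝ) * Y i x ^ (2 - 1) * f i x := by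
        norm_num; ring
      rw [e]; exact h3
    have hWd := (hE.mul (hS.sub_const (K / β))).sub (hGd.const_mul (Real.exp (β * b)))
    have hWd' : deriv W x = _ := hWd.deriv
    rw [hWd']
    have hyx : ∀ i, Y i x = y i x := fun i => (hy i x hxab).symm
    have hi := hineq x hxab
    simp only [hyx, ← Finset.mul_sum]
    have he : Real.exp (β * x) ≤ Real.exp (β * b) := by
      apply Real.exp_le_exp.2; nlinarith [hxab.2]
    have hep := Real.exp_pos (β * x)
    have e1 : Real.exp (β * x) * β * (∑ i, y i x ^ 2 - K / β)
        = Real.exp (β * x) * (β * ∑ i, y i x ^ 2 - K) := by field_simp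
    rw [e1, ← mul_add]
    have e2 : Real.exp (β * x) * (β * ∑ i, y i x ^ 2 - K + 2 * ∑ i, y i x * f i x)
        ≤ Real.exp (β * x) * G x := by
      apply mul_le_mul_of_nonneg_left _ hep.le
      linarith
    have e3 := mul_le_mul_of_nonneg_right he (hG0 x)
    linarith
  have hle : W b - W a ≤ 0 := by
    rw [← hWac.integral_deriv_eq_sub, intervalIntegral.integral_of_le hab]
    apply integral_nonpos_of_ae
    refine (ae_restrict_iff' measurableSet_Ioc).2 ?_
    filter_upwards [hder] with x hx hx2
    exact hx (Ioc_subset_Icc_self hx2)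
  have hyb : ∀ i, Y i b = y i b := fun i => (hy i b ⟨hab, le_rfl⟩).symm
  have hya : ∀ i, Y i a = y i a := fun i => (hy i a ⟨le_rfl, hab⟩).symm
  simp only [hW, hyb, hya, intervalIntegral.integral_same, mul_zero, sub_zero] at hle
  have hee : Real.exp (-β * (b - a)) = Real.exp (β * a) / Real.exp (β * b) := by
    rw [← Real.exp_sub]; ring_nf
  have hpb := Real.exp_pos (β * b)
  have hpa := Real.exp_pos (β * a)
  have hKβ : 0 ≤ K / β := by positivity
  rw [hee]
  have : Real.exp (β * b) * (∑ i, y i b ^ 2 - K / β - ∫ s in a..b, G s)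
      ≤ Real.exp (β * a) * ∑ i, y i a ^ 2 := by nlinarith [mul_nonneg hpa.le hKβ]
  have h2 : ∑ i, y i b ^ 2 - K / β - ∫ s in a..b, G s
      ≤ Real.exp (β * a) * (∑ i, y i a ^ 2) / Real.exp (β * b) := by
    rw [le_div_iff₀ hpb]; linarith
  rw [div_mul_eq_mul_div]
  linarith

lemma chiSet_sub {ε s y : ℝ} (hε : ε ∈ Icc (0 : ℝ) (1 / 5)) (hy : y ∈ chiSet ε s) :
    0 ≤ y ∧ y ≤ 1 := by
  obtain ⟨h1, h2⟩ := hε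
  unfold chiSet at hy
  split_ifs at hy <;> simp only [mem_Icc] at hy <;> constructor <;> linarith [hy.1, hy.2]

lemma mu_fin {n : ℕ} {γ : ℝ} (hγ : 0 < γ) {μ : IdxZ n → Measure ℝ} (hM : HypM γ μ) (p : IdxZ n) :
    μ p (Iic 0) ≠ ⊤ := by
  refine ne_of_lt (lt_of_le_of_lt ?_ (hM p))
  rw [← setLIntegral_one]
  refine setLIntegral_mono' measurableSet_Iic fun t ht => ?_
  rw [← ENNReal.ofReal_one]
  apply ENNReal.ofReal_le_ofReal
  apply Real.one_le_exp
  have : t ≤ 0 := ht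
  nlinarith

lemma aumann_bd {n : ℕ} {ε : ℝ} (hε : ε ∈ Icc (0 : ℝ) (1 / 5)) {μ : IdxZ n → Measure ℝ}
    (p : IdxZ n) (hfin : μ p (Iic 0) ≠ ⊤) {φ : ℝ → ℝ} {y : ℝ}
    (hy : y ∈ aumann (fun τ => chiSet ε (φ τ)) (μ p)) : 0 ≤ y ∧ y ≤ mTot μ p := by
  obtain ⟨s, -, hint, hs, rfl⟩ := hy
  constructor
  · exact setIntegral_nonneg measurableSet_Iic fun t ht => (chiSet_sub hε (hs t ht)).1
  · have h1 : IntegrableOn (fun _ : ℝ => (1 : ℝ)) (Iic 0) (μ p) := by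
      rw [integrableOn_const_iff]; right; exact hfin.lt_top
    have := setIntegral_mono_on hint h1 measurableSet_Iic
      fun t ht => (chiSet_sub hε (hs t ht)).2
    simpa [mTot, Measure.real] using this

lemma xset_rep {n : ℕ} {ε : ℝ} (hε : ε ∈ Icc (0 : ℝ) (1 / 5)) {μ : IdxZ n → Measure ℝ}
    (hfin : ∀ p, μ p (Iic 0) ≠ ⊤) {c d : IdxZ n → ℝ} {Γ : Fin n → ℝ} {u : ℝ → NState n}
    {v : NState n} (hv : v ∈ Xset ε μ c d Γ u) :
    ∃ m m' : IdxZ n → ℝ, (∀ p, 0 ≤ m p ∧ m p ≤ mTot μ p) ∧ (∀ p, 0 ≤ m' p ∧ m' p ≤ mTot μ p) ∧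
      (∀ i, v.1 i = ∑ k : Fin n, if h : k ≠ i then
        ((u 0).2 ⟨(k, i), h⟩ - c ⟨(k, i), h⟩) * m ⟨(k, i), h⟩ else 0) ∧
      ∀ p, v.2 p = d p * max ((u 0).1 p.1.2) 0 * m' p := by
  obtain ⟨h1, h2⟩ := hv
  choose g hg0 hg hgs using h1
  have hg' : ∀ p : IdxZ n, ∃ m, (0 ≤ m ∧ m ≤ mTot μ p) ∧
      ((u 0).2 p - c p) * m = g p.1.2 p.1.1 := by
    rintro ⟨⟨k, i⟩, h⟩
    obtain ⟨m, hm, hme⟩ := hg i k h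
    exact ⟨m, aumann_bd hε _ (hfin _) hm, hme⟩
  choose m hm hme using hg'
  have h2' : ∀ p : IdxZ n, ∃ m, (0 ≤ m ∧ m ≤ mTot μ p) ∧
      d p * max ((u 0).1 p.1.2) 0 * m = v.2 p := by
    intro p
    obtain ⟨m, hm, hme⟩ := h2 p
    exact ⟨m, aumann_bd hε _ (hfin _) hm, hme⟩
  choose m' hm' hme' using h2'
  refine ⟨m, m', hm, hm', fun i => ?_, fun p => (hme' p).symm⟩
  rw [hgs i]
  refine Finset.sum_congr rfl fun k _ => ?_
  split_ifs with h
  · exact (hme ⟨(k, i), h⟩).symm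
  · rw [not_not] at h; rw [h]; exact hg0 i

lemma energy_pointwise {n : ℕ} (hn : 2 ≤ n) (α δ : ℝ) (hδ : 0 < δ) (M c d : IdxZ n → ℝ)
    (hc : ∀ p, 0 ≤ c p) (hd : ∀ p, 0 ≤ d p)
    (lx lz nx nz eta eps : IdxZ n → ℝ)
    (hlx : ∀ p, 0 ≤ lx p) (hlz : ∀ p, 0 ≤ lz p) (hnx : ∀ p, 0 ≤ nx p) (hnz : ∀ p, 0 ≤ nz p)
    (hl : ∀ p, lx p * lz p = M p ^ 2 * d p ^ 2) (hnn : ∀ p, nx p * nz p = M p ^ 2)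
    (heta : ∀ p, 0 < eta p) (heps : ∀ p, 0 < eps p)
    (hz : ∀ p, nz p / eta p + lz p / eps p ≤ 2 * α - δ)
    (hx : ∀ i : Fin n, (∑ k : Fin n, if h : k ≠ i then
          nx ⟨(k, i), h⟩ * eta ⟨(k, i), h⟩ + lx ⟨(k, i), h⟩ * eps ⟨(k, i), h⟩
        else 0) ≤ 2 * α - δ)
    (x J a : Fin n → ℝ) (z b m m' : IdxZ n → ℝ) (ha : ∀ i, α ≤ a i) (hb : ∀ p, α ≤ b p)
    (hm : ∀ p, 0 ≤ m p ∧ m p ≤ M p) (hm' : ∀ p, 0 ≤ m' p ∧ m' p ≤ M p) :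
    2 * (∑ i, x i * (-(a i) * x i + (∑ k : Fin n, if h : k ≠ i then
        (z ⟨(k, i), h⟩ - c ⟨(k, i), h⟩) * m ⟨(k, i), h⟩ else 0) + J i)
      + ∑ p, z p * (-(b p) * z p + d p * max (x p.1.2) 0 * m' p + 0))
    ≤ -(δ / 2) * (∑ i, x i ^ 2 + ∑ p, z p ^ 2) + (∑ p, 4 * n / δ * (c p * M p) ^ 2)
      + 4 / δ * ∑ i, J i ^ 2 := by
  have hn0 : (0 : ℝ) < n := by exact_mod_cast (by omega : 0 < n)
  -- the coupling terms, one pair at a time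
  have key : ∀ p : IdxZ n, 2 * (x p.1.2 * ((z p - c p) * m p)) + 2 * (z p * (d p * max (x p.1.2) 0 * m' p))
      ≤ (nx p * eta p + lx p * eps p + δ / (4 * n)) * x p.1.2 ^ 2
        + (nz p / eta p + lz p / eps p) * z p ^ 2 + 4 * n / δ * (c p * M p) ^ 2 := by
    intro p
    set X := x p.1.2
    have hXm : max X 0 ≤ |X| := max_le (le_abs_self _) (abs_nonneg _)
    have hX0 : 0 ≤ max X 0 := le_max_right _ _
    have t1 : 2 * (M p * |X| * |z p|) ≤ (nx p * eta p) * |X| ^ 2 + (nz p / eta p) * |z p| ^ 2 := by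
      apply young_aux
      · exact mul_nonneg (hnx p) (heta p).le
      · exact div_nonneg (hnz p) (heta p).le
      · rw [← hnn p]; have := (heta p).ne'; field_simp
    have t2 : 2 * ((M p * d p) * |X| * |z p|)
        ≤ (lx p * eps p) * |X| ^ 2 + (lz p / eps p) * |z p| ^ 2 := by
      apply young_aux
      · exact mul_nonneg (hlx p) (heps p).le
      · exact div_nonneg (hlz p) (heps p).le
      · rw [mul_pow, ← hl p]; have := (heps p).ne'; field_simp
    have t3 : 2 * (1 * |X| * (c p * M p)) ≤ (δ / (4 * n)) * |X| ^ 2 + (4 * n / δ) * (c p * M p) ^ 2 := by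
      apply young_aux
      · positivity
      · positivity
      · field_simp
    have s1 : X * z p * m p ≤ M p * |X| * |z p| := by
      calc X * z p * m p ≤ |X * z p| * m p :=
            mul_le_mul_of_nonneg_right (le_abs_self _) (hm p).1
        _ ≤ |X * z p| * M p := mul_le_mul_of_nonneg_left (hm p).2 (abs_nonneg _)
        _ = _ := by rw [abs_mul]; ring
    have s2 : -(X * c p * m p) ≤ |X| * (c p * M p) := by
      calc -(X * c p * m p) = (-X) * (c p * m p) := by ring
        _ ≤ |X| * (c p * m p) :=
            mul_le_mul_of_nonneg_right (neg_le_abs _) (mul_nonneg (hc p) (hm p).1)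
        _ ≤ |X| * (c p * M p) :=
            mul_le_mul_of_nonneg_left (mul_le_mul_of_nonneg_left (hm p).2 (hc p)) (abs_nonneg _)
    have s3 : z p * (d p * max X 0 * m' p) ≤ (M p * d p) * |X| * |z p| := by
      calc z p * (d p * max X 0 * m' p) ≤ |z p| * (d p * max X 0 * m' p) :=
            mul_le_mul_of_nonneg_right (le_abs_self _)
              (mul_nonneg (mul_nonneg (hd p) hX0) (hm' p).1)
        _ ≤ |z p| * (d p * |X| * M p) := by
            apply mul_le_mul_of_nonneg_left _ (abs_nonneg _)
            apply mul_le_mul (mul_le_mul_of_nonneg_left hXm (hd p)) (hm' p).2 (hm' p).1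
            exact mul_nonneg (hd p) (abs_nonneg _)
        _ = _ := by ring
    rw [sq_abs, sq_abs] at t1 t2
    rw [sq_abs] at t3
    linarith
  have hsumkey := Finset.sum_le_sum fun p (_ : p ∈ Finset.univ) => key p
  simp only [Finset.sum_add_distrib] at hsumkey
  -- the coupling term of `x`, reindexed
  have r1 : ∑ i, x i * (∑ k : Fin n, if h : k ≠ i then
        (z ⟨(k, i), h⟩ - c ⟨(k, i), h⟩) * m ⟨(k, i), h⟩ else 0)
      = ∑ p : IdxZ n, x p.1.2 * ((z p - c p) * m p) := by
    rw [← sum_reindex]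
    refine Finset.sum_congr rfl fun i _ => ?_
    rw [Finset.mul_sum]
    refine Finset.sum_congr rfl fun k _ => ?_
    split_ifs <;> simp
  have r2 : ∑ p : IdxZ n, (nx p * eta p + lx p * eps p + δ / (4 * n)) * x p.1.2 ^ 2
      ≤ ∑ i, (2 * α - δ + δ / 4) * x i ^ 2 := by
    rw [← sum_reindex]
    refine Finset.sum_le_sum fun i _ => ?_
    have e : ∀ k : Fin n, (if h : k ≠ i then (nx ⟨(k, i), h⟩ * eta ⟨(k, i), h⟩
          + lx ⟨(k, i), h⟩ * eps ⟨(k, i), h⟩ + δ / (4 * n)) * x i ^ 2 else 0)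
        ≤ ((if h : k ≠ i then nx ⟨(k, i), h⟩ * eta ⟨(k, i), h⟩
          + lx ⟨(k, i), h⟩ * eps ⟨(k, i), h⟩ else 0) + δ / (4 * n)) * x i ^ 2 := by
      intro k
      split_ifs
      · exact le_rfl
      · positivity
    refine (Finset.sum_le_sum fun k _ => e k).trans ?_
    rw [← Finset.sum_mul, Finset.sum_add_distrib]
    apply mul_le_mul_of_nonneg_right _ (sq_nonneg _)
    have : ∑ _k : Fin n, δ / (4 * (n : ℝ)) = δ / 4 := by
      simp; field_simp
    rw [this]
    linarith [hx i]
  have r3 : ∑ p : IdxZ n, (nz p / eta p + lz p / eps p) * z p ^ 2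
      ≤ ∑ p, (2 * α - δ) * z p ^ 2 :=
    Finset.sum_le_sum fun p _ => mul_le_mul_of_nonneg_right (hz p) (sq_nonneg _)
  have r4 : ∑ i, 2 * (x i * J i) ≤ ∑ i, (δ / 4 * x i ^ 2 + 4 / δ * J i ^ 2) := by
    refine Finset.sum_le_sum fun i _ => ?_
    have := young_aux (X := δ / 4) (Y := 4 / δ) (M := 1) (a := x i) (b := J i)
      (by positivity) (by positivity) (by field_simp)
    linarith
  have r5 : ∑ i, x i * (-(a i) * x i) ≤ ∑ i, (-α) * x i ^ 2 := by
    refine Finset.sum_le_sum fun i _ => ?_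
    nlinarith [ha i, sq_nonneg (x i), mul_nonneg (sub_nonneg.2 (ha i)) (sq_nonneg (x i))]
  have r6 : ∑ p, z p * (-(b p) * z p) ≤ ∑ p, (-α) * z p ^ 2 := by
    refine Finset.sum_le_sum fun i _ => ?_
    nlinarith [hb i, sq_nonneg (z i), mul_nonneg (sub_nonneg.2 (hb i)) (sq_nonneg (z i))]
  have hz2 : 0 ≤ ∑ p, z p ^ 2 := Finset.sum_nonneg fun p _ => sq_nonneg _
  simp only [Finset.sum_add_distrib, mul_add, add_zero]
  rw [r1]
  simp only [Finset.sum_add_distrib, ← Finset.mul_sum] at r2 r3 r4 r5 r6 hsumkey ⊢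
  nlinarith

lemma V_le {n : ℕ} (v : NState n) :
    ∑ i, v.1 i ^ 2 + ∑ p, v.2 p ^ 2 ≤ (n * ‖v‖) ^ 2 := by
  have h1 : ∀ i, v.1 i ^ 2 ≤ ‖v‖ ^ 2 := fun i => by
    rw [← sq_abs]
    exact pow_le_pow_left₀ (abs_nonneg _) ((norm_le_pi_norm v.1 i).trans (norm_fst_le v)) 2
  have h2 : ∀ p, v.2 p ^ 2 ≤ ‖v‖ ^ 2 := fun p => by
    rw [← sq_abs]
    exact pow_le_pow_left₀ (abs_nonneg _) ((norm_le_pi_norm v.2 p).trans (norm_snd_le v)) 2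
  have h3 : Fintype.card (Fin n ⊕ IdxZ n) ≤ Fintype.card (Fin n × Fin n) := by
    refine Fintype.card_le_of_injective
      (Sum.elim (fun i => (i, i)) Subtype.val : Fin n ⊕ IdxZ n → Fin n × Fin n) ?_
    rintro (i | ⟨⟨k, i⟩, h⟩) (j | ⟨⟨k', j⟩, h'⟩) hij <;>
      simp only [Sum.elim_inl, Sum.elim_inr, Prod.mk.injEq] at hij
    · rw [hij.1]
    · exact absurd (hij.1.symm.trans hij.2) h'
    · exact absurd (hij.1.trans hij.2.symm) h
    · congr 3
      · exact hij.1
      · exact hij.2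
  rw [Fintype.card_sum, Fintype.card_prod, Fintype.card_fin] at h3
  have h4 : (n : ℝ) + (Fintype.card (IdxZ n) : ℝ) ≤ n * n := by exact_mod_cast h3
  have a1 := Finset.sum_le_sum fun i (_ : i ∈ Finset.univ) => h1 i
  have a2 := Finset.sum_le_sum fun i (_ : i ∈ Finset.univ) => h2 i
  simp only [Finset.sum_const, Finset.card_univ, nsmul_eq_mul, Fintype.card_fin] at a1 a2
  nlinarith [mul_le_mul_of_nonneg_right h4 (sq_nonneg ‖v‖)]

lemma norm_le_V {n : ℕ} (v : NState n) :
    ‖v‖ ≤ Real.sqrt (∑ i, v.1 i ^ 2 + ∑ p, v.2 p ^ 2) := by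
  have p1 : 0 ≤ ∑ i, v.1 i ^ 2 := Finset.sum_nonneg fun p _ => sq_nonneg _
  have p2 : 0 ≤ ∑ p, v.2 p ^ 2 := Finset.sum_nonneg fun p _ => sq_nonneg _
  rw [Prod.norm_def]
  refine max_le ?_ ?_
  · refine (pi_norm_le_iff_of_nonneg (Real.sqrt_nonneg _)).2 fun i => ?_
    apply Real.abs_le_sqrt
    have := Finset.single_le_sum (f := fun i => v.1 i ^ 2) (fun j _ => sq_nonneg _)
      (Finset.mem_univ i)
    linarith
  · refine (pi_norm_le_iff_of_nonneg (Real.sqrt_nonneg _)).2 fun i => ?_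
    apply Real.abs_le_sqrt
    have := Finset.single_le_sum (f := fun i => v.2 i ^ 2) (fun j _ => sq_nonneg _)
      (Finset.mem_univ i)
    linarith

lemma sqrt_add_le' {a b : ℝ} (ha : 0 ≤ a) (hb : 0 ≤ b) :
    Real.sqrt (a + b) ≤ Real.sqrt a + Real.sqrt b := by
  rw [Real.sqrt_le_left (by positivity), add_sq, Real.sq_sqrt ha, Real.sq_sqrt hb]
  have := mul_nonneg (Real.sqrt_nonneg a) (Real.sqrt_nonneg b)
  linarith

/-- From the differential inequality to the bound on `‖u t‖`. -/
lemma sol_bound {n : ℕ} (δ K : ℝ) (hδ : 0 < δ) (hK : 0 ≤ K)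
    (Istim : Fin n → ℝ → ℝ) (hI : ∀ i, Continuous (Istim i)) (u F : ℝ → NState n)
    (t₀ t : ℝ) (ht : t₀ ≤ t)
    (hF : IntegrableOn F (Icc t₀ t)) (hu : ∀ s ∈ Icc t₀ t, u s = u t₀ + ∫ r in t₀..s, F r)
    (hineq : ∀ s ∈ Icc t₀ t,
      2 * (∑ i, (u s).1 i * (F s).1 i + ∑ p, (u s).2 p * (F s).2 p)
      ≤ -(δ / 2) * (∑ i, (u s).1 i ^ 2 + ∑ p, (u s).2 p ^ 2) + K
        + 4 / δ * ∑ i, Istim i s ^ 2) :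
    ‖u t‖ ≤ Real.exp (-(δ / 4) * (t - t₀)) * (n * ‖u t₀‖) + Real.sqrt (K / (δ / 2))
      + 1 / Real.sqrt (δ / 4) * Real.sqrt (∑ i, ∫ s in t₀..t, Istim i s ^ 2) := by
  have hFi : IntervalIntegrable F volume t₀ t :=
    (intervalIntegrable_iff_integrableOn_Icc_of_le ht).2 hF
  have hFis : ∀ s ∈ Icc t₀ t, IntervalIntegrable F volume t₀ s := fun s hs =>
    hFi.mono_set (by rw [uIcc_of_le hs.1, uIcc_of_le ht]; exact Icc_subset_Icc_right hs.2)
  let L : Fin n ⊕ IdxZ n → NState n →L[ℝ] ℝ := Sum.elim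
    (fun i => (ContinuousLinearMap.proj i).comp (ContinuousLinearMap.fst ℝ _ _))
    (fun p => (ContinuousLinearMap.proj p).comp (ContinuousLinearMap.snd ℝ _ _))
  have hL1 : ∀ i v, L (Sum.inl i) v = v.1 i := fun i v => rfl
  have hL2 : ∀ p v, L (Sum.inr p) v = v.2 p := fun p v => rfl
  have hGc : Continuous fun s => 4 / δ * ∑ i, Istim i s ^ 2 := by
    have := hI; fun_prop
  have main := energy_gronwall (fun j s => L j (u s)) (fun j s => L j (F s)) (fun j => L j (u t₀))
    (fun s => 4 / δ * ∑ i, Istim i s ^ 2) t₀ t (δ / 2) K ht (by positivity) hK hGc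
    (fun s => mul_nonneg (by positivity) (Finset.sum_nonneg fun i _ => sq_nonneg _))
    (fun j => (intervalIntegrable_iff_integrableOn_Icc_of_le ht).2
      ((L j).integrable_comp hF))
    (fun j s hs => by
      rw [(L j).intervalIntegral_comp_comm (hFis s hs), ← map_add, ← hu s hs])
    (fun s hs => by
      simp only [Fintype.sum_sum_type, hL1, hL2]
      exact hineq s hs)
  simp only [Fintype.sum_sum_type, hL1, hL2] at main
  rw [intervalIntegral.integral_const_mul, intervalIntegral.integral_finsetSum
    (fun i _ => ((hI i).fun_pow 2).intervalIntegrable _ _)] at main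
  set Q := ∑ i, ∫ s in t₀..t, Istim i s ^ 2 with hQ
  have hQ0 : 0 ≤ Q := Finset.sum_nonneg fun i _ =>
    intervalIntegral.integral_nonneg ht fun s _ => sq_nonneg _
  refine (norm_le_V (u t)).trans ?_
  refine (Real.sqrt_le_sqrt main).trans ?_
  have p1 : 0 ≤ ∑ i, (u t₀).1 i ^ 2 := Finset.sum_nonneg fun p _ => sq_nonneg _
  have p2 : 0 ≤ ∑ p, (u t₀).2 p ^ 2 := Finset.sum_nonneg fun p _ => sq_nonneg _
  have p3 := mul_nonneg (Real.exp_pos (-(δ / 2) * (t - t₀))).le (add_nonneg p1 p2)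
  have hKd : 0 ≤ K / (δ / 2) := by positivity
  refine (sqrt_add_le' (add_nonneg p3 hKd) (by positivity)).trans ?_
  refine add_le_add ((sqrt_add_le' p3 hKd).trans (add_le_add ?_ le_rfl)) ?_
  · rw [Real.sqrt_le_left (by positivity), mul_pow, ← Real.exp_nat_mul]
    refine (mul_le_mul_of_nonneg_left (V_le (u t₀)) (Real.exp_pos _).le).trans (le_of_eq ?_)
    congr 2
    push_cast; ring
  · rw [Real.sqrt_mul (by positivity)]
    refine le_of_eq ?_
    congr 1
    rw [← Real.sqrt_one, ← Real.sqrt_div zero_le_one]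
    congr 1
    field_simp

/-- uniform estimate on solutions of the `ε`-inflated inclusions and
existence of a pullback absorbing family of balls for the attainability process,
within the universe of uniformly bounded nonautonomous sets. -/
theorem stmt16 {n : ℕ} (hn : 2 ≤ n) (γbar α : ℝ) (hγbar : 0 < γbar)
    (A : Fin n → ℝ → ℝ) (B : IdxZ n → ℝ → ℝ) (μ : IdxZ n → Measure ℝ)
    (c d : IdxZ n → ℝ) (Γ : Fin n → ℝ) (Istim : Fin n → ℝ → ℝ)
    (hD : HypD α A B) (hM : HypM γbar μ) (hI : HypI Istim)
    (hA : HypA α μ d)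
    (hc : ∀ p, 0 ≤ c p) (hd : ∀ p, 0 ≤ d p) :
    ∃ γ₀ > 0, γ₀ ≤ γbar ∧ ∃ β > 0, ∃ K ≥ (0 : ℝ), ∃ ξ > 0, 2 * γ₀ ≤ β ∧
      (∀ γ ∈ Ioo (0 : ℝ) γ₀, ∀ ε ∈ Icc (0 : ℝ) (1 / 5), ∀ t₀ t : ℝ, t₀ ≤ t →
        ∀ u₀ u : ℝ → NState n, InC γ u₀ →
        IsIncSolOn ε A B μ c d Γ Istim t₀ t u₀ u →
        gNorm γ (hist u t) ≤
          n * Real.exp (-γ * (t - t₀)) * gNorm γ u₀ + Real.sqrt (K / β) +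
            (1 / Real.sqrt ξ) * Real.sqrt (∑ i, ∫ s in t₀..t, Istim i s ^ 2)) ∧
      ∀ γ ∈ Ioo (0 : ℝ) γ₀, ∀ ε ∈ Icc (0 : ℝ) (1 / 5), ∀ t : ℝ, ∀ r > (0 : ℝ),
        ∃ T > (0 : ℝ), ∀ τ ≥ T, ∀ u₀ u : ℝ → NState n,
          InC γ u₀ → gNorm γ u₀ ≤ r →
          IsIncSolOn ε A B μ c d Γ Istim (t - τ) t u₀ u →
          gNorm γ (hist u t) ≤ Real.sqrt (K / β) +
            (1 / Real.sqrt ξ) * Real.sqrt (∑ i, ∫ s in (t - τ)..t, Istim i s ^ 2) + 1 := by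
  obtain ⟨hα, hDA, hDB⟩ := hD
  obtain ⟨lx, lz, nx, nz, eta, eps, hp, hx⟩ := hA
  have hfin := fun p => mu_fin hγbar hM p
  have hn0 : (0 : ℝ) < n := by exact_mod_cast (by omega : 0 < n)
  have hn1 : (1 : ℝ) ≤ n := by exact_mod_cast (by omega : 1 ≤ n)
  have four : ∀ p, ∀ y ∈ ({1, mTot μ p ^ 2, d p ^ 2, mTot μ p ^ 2 * d p ^ 2} : Set ℝ), 0 ≤ y := by
    intro p y hy
    simp only [mem_insert_iff, mem_singleton_iff] at hy
    rcases hy with rfl | rfl | rfl | rfl <;> positivity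
  have two : ∀ p, ∀ y ∈ ({1, mTot μ p ^ 2} : Set ℝ), 0 ≤ y := by
    intro p y hy
    simp only [mem_insert_iff, mem_singleton_iff] at hy
    rcases hy with rfl | rfl <;> positivity
  obtain ⟨δ₁, hδ₁, hz1⟩ := exists_pos_lb (fun p => 2 * α - (nz p / eta p + lz p / eps p))
    (fun p => by have := (hp p).2.2.2.2.2.2.2.2; linarith)
  obtain ⟨δ₂, hδ₂, hx1⟩ := exists_pos_lb (fun i : Fin n => 2 * α -
      (∑ k : Fin n, if h : k ≠ i then
          nx ⟨(k, i), h⟩ * eta ⟨(k, i), h⟩ + lx ⟨(k, i), h⟩ * eps ⟨(k, i), h⟩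
        else 0)) (fun i => by have := hx i; linarith)
  obtain ⟨δ, hδ, hδa, hδb⟩ : ∃ δ > 0, δ ≤ δ₁ ∧ δ ≤ δ₂ :=
    ⟨min δ₁ δ₂, lt_min hδ₁ hδ₂, min_le_left _ _, min_le_right _ _⟩
  set K : ℝ := ∑ p, 4 * n / δ * (c p * mTot μ p) ^ 2 with hKdef
  have hK : 0 ≤ K := Finset.sum_nonneg fun p _ => by positivity
  have part1 : ∀ γ ∈ Ioo (0 : ℝ) (min γbar (δ / 4)), ∀ ε ∈ Icc (0 : ℝ) (1 / 5),
        ∀ t₀ t : ℝ, t₀ ≤ t →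
        ∀ u₀ u : ℝ → NState n, InC γ u₀ →
        IsIncSolOn ε A B μ c d Γ Istim t₀ t u₀ u →
        gNorm γ (hist u t) ≤
          n * Real.exp (-γ * (t - t₀)) * gNorm γ u₀ + Real.sqrt (K / (δ / 2)) +
            (1 / Real.sqrt (δ / 4)) * Real.sqrt (∑ i, ∫ s in t₀..t, Istim i s ^ 2) := by
    rintro γ ⟨hγ, hγ2⟩ ε hε t₀ t ht u₀ u hu₀ ⟨hini, -, S, hS, hint, hsol⟩
    have hγδ : γ ≤ δ / 4 := (hγ2.trans_le (min_le_right _ _)).le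
    have hut0 : u t₀ = u₀ 0 := by simpa using hini 0 le_rfl
    have hg : ∀ s ≤ (0 : ℝ), Real.exp (γ * s) * ‖u₀ s‖ ≤ gNorm γ u₀ := fun s hs =>
      le_ciSup hu₀.2.2 (⟨s, hs⟩ : Iic (0 : ℝ))
    have hg0 : ‖u₀ 0‖ ≤ gNorm γ u₀ := by simpa using hg 0 le_rfl
    have hgn : 0 ≤ gNorm γ u₀ := (norm_nonneg _).trans hg0
    have hQ : ∀ s ∈ Icc t₀ t, ∑ i, ∫ r in t₀..s, Istim i r ^ 2 ≤ ∑ i, ∫ r in t₀..t, Istim i r ^ 2 := by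
      intro s hs
      refine Finset.sum_le_sum fun i _ => ?_
      exact intervalIntegral.integral_mono_interval le_rfl hs.1 hs.2
        (Eventually.of_forall fun r => sq_nonneg _) (((hI i).fun_pow 2).intervalIntegrable _ _)
    have hbound : ∀ s ∈ Icc t₀ t, ‖u s‖ ≤ Real.exp (-γ * (s - t₀)) * (n * gNorm γ u₀)
        + (Real.sqrt (K / (δ / 2)) + 1 / Real.sqrt (δ / 4) *
          Real.sqrt (∑ i, ∫ s in t₀..t, Istim i s ^ 2)) := by
      intro s hs
      have hsub : Icc t₀ s ⊆ Icc t₀ t := Icc_subset_Icc_right hs.2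
      have h1 := sol_bound δ K hδ hK Istim hI u
        (fun s => decayT A B (hist u s) + S s + stimT Istim s) t₀ s hs.1
        (hint.mono_set hsub) (fun r hr => by rw [hut0]; exact hsol r (hsub hr))
        (fun r hr => by
          obtain ⟨m, m', hm, hm', e1, e2⟩ := xset_rep hε hfin (hS r (hsub hr))
          have hr0 : hist u r 0 = u r := by simp [hist]
          rw [hr0] at e1 e2
          have := energy_pointwise hn α δ hδ (mTot μ) c d hc hd lx lz nx nz eta eps
            (fun p => four p _ (hp p).1) (fun p => four p _ (hp p).2.1)
            (fun p => two p _ (hp p).2.2.2.1) (fun p => two p _ (hp p).2.2.2.2.1)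
            (fun p => (hp p).2.2.1) (fun p => (hp p).2.2.2.2.2.1)
            (fun p => (hp p).2.2.2.2.2.2.1) (fun p => (hp p).2.2.2.2.2.2.2.1)
            (fun p => by linarith [hz1 p]) (fun i => by linarith [hx1 i])
            (u r).1 (fun i => Istim i r) (fun i => A i ((u r).1 i)) (u r).2
            (fun p => B p ((u r).2 p)) m m' (fun i => (hDA i).2 _) (fun p => (hDB p).2 _) hm hm'
          simp only [decayT, stimT, hr0, Prod.fst_add, Prod.snd_add, Pi.add_apply, e1, e2,
            Pi.zero_apply]
          exact this)
      refine h1.trans ?_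
      rw [add_assoc]
      refine add_le_add ?_ (add_le_add le_rfl ?_)
      · have : Real.exp (-(δ / 4) * (s - t₀)) ≤ Real.exp (-γ * (s - t₀)) := by
          apply Real.exp_le_exp.2
          nlinarith [hs.1]
        rw [hut0]
        gcongr
      · exact mul_le_mul_of_nonneg_left (Real.sqrt_le_sqrt (hQ s hs)) (by positivity)
    set R := Real.sqrt (K / (δ / 2)) + 1 / Real.sqrt (δ / 4) *
          Real.sqrt (∑ i, ∫ s in t₀..t, Istim i s ^ 2) with hR
    have hR0 : 0 ≤ R := by positivity
    rw [add_assoc, ← hR]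
    refine ciSup_le ?_
    rintro ⟨s, hs⟩
    have hs0 : s ≤ 0 := hs
    simp only [hist]
    by_cases hst : t₀ ≤ t + s
    · have h2 := hbound (t + s) ⟨hst, by linarith⟩
      have hes : Real.exp (γ * s) ≤ 1 := Real.exp_le_one_iff.2 (by nlinarith)
      have hee : Real.exp (γ * s) * Real.exp (-γ * (t + s - t₀)) = Real.exp (-γ * (t - t₀)) := by
        rw [← Real.exp_add]; ring_nf
      calc Real.exp (γ * s) * ‖u (t + s)‖ ≤ Real.exp (γ * s) *
            (Real.exp (-γ * (t + s - t₀)) * (n * gNorm γ u₀) + R) :=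
            mul_le_mul_of_nonneg_left h2 (Real.exp_pos _).le
        _ = Real.exp (-γ * (t - t₀)) * (n * gNorm γ u₀) + Real.exp (γ * s) * R := by
            rw [mul_add, ← mul_assoc, hee]
        _ ≤ n * Real.exp (-γ * (t - t₀)) * gNorm γ u₀ + R := by
            have := mul_le_mul_of_nonneg_right hes hR0
            linarith
    · have h3 := hini (t + s - t₀) (by linarith)
      rw [add_sub_cancel] at h3
      have h4 := hg (t + s - t₀) (by linarith)
      have hee : Real.exp (γ * s) = Real.exp (-γ * (t - t₀)) * Real.exp (γ * (t + s - t₀)) := by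
        rw [← Real.exp_add]; ring_nf
      rw [h3, hee, mul_assoc]
      have h5 := mul_le_mul_of_nonneg_left h4 (Real.exp_pos (-γ * (t - t₀))).le
      have h6 : 0 ≤ Real.exp (-γ * (t - t₀)) * gNorm γ u₀ := by positivity
      nlinarith [mul_le_mul_of_nonneg_right hn1 h6]
  refine ⟨min γbar (δ / 4), lt_min hγbar (by positivity), min_le_left _ _, δ / 2, by positivity,
    K, hK, δ / 4, by positivity, ?_, part1, ?_⟩
  · linarith [min_le_right γbar (δ / 4)]
  · intro γ hγ ε hε t r hr
    refine ⟨n * r / γ, div_pos (mul_pos hn0 hr) hγ.1, ?_⟩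
    intro τ hτ u₀ u hu₀ hur hsol
    have hτ0 : 0 ≤ τ := (div_pos (mul_pos hn0 hr) hγ.1).le.trans hτ
    have h1 := part1 γ hγ ε hε (t - τ) t (by linarith) u₀ u hu₀ hsol
    have h2 : n * Real.exp (-γ * (t - (t - τ))) * gNorm γ u₀ ≤ 1 := by
      have e : -γ * (t - (t - τ)) = -(γ * τ) := by ring
      rw [e, Real.exp_neg]
      have h3 : n * r ≤ γ * τ := by
        have := (div_le_iff₀ hγ.1).1 hτ
        linarith
      have h4 : γ * τ ≤ Real.exp (γ * τ) := by linarith [Real.add_one_le_exp (γ * τ)]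
      have h5 := Real.exp_pos (γ * τ)
      calc n * (Real.exp (γ * τ))⁻¹ * gNorm γ u₀ ≤ n * (Real.exp (γ * τ))⁻¹ * r :=
            mul_le_mul_of_nonneg_left hur (by positivity)
        _ = (n * r) / Real.exp (γ * τ) := by rw [div_eq_mul_inv]; ring
        _ ≤ 1 := (div_le_one h5).2 (h3.trans h4)
    linarith

end
end

section
/- Assume hypotheses (D), (M), (I), and (A), and additionally that Σ_{i=1}^n ∫_ℝ I_i(s)² ds < ∞. Then there exists γ₀>0 such that for every γ∈(0,γ₀) the attainability process Φ^ε (ε∈[0,1/5] fixed) is pullback asymptotically upper semicompact on C_γ within the universe of uniformly bounded nonautonomous sets: if t∈ℝ, τ_m→∞, r>0, and for each m, u^m is a solution of the ε-inflated differential inclusion on [t−τ_m, t] with ‖u^m_{t−τ_m}‖_γ ≤ r, then the sequence of histories {u^m_t} has a subsequence converging in C_γ. -/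
open MeasureTheory Set Filter Topology Pointwise

noncomputable section

lemma aux_sq {f x : ℝ → ℝ} {x0 t₀ t : ℝ} (hf : IntegrableOn f (Icc t₀ t))
    (hx : ∀ s ∈ Icc t₀ t, x s = x0 + ∫ y in t₀..s, f y) {a b : ℝ}
    (ha : a ∈ Icc t₀ t) (hb : b ∈ Icc t₀ t) (hab : a ≤ b) :
    IntervalIntegrable (fun s => 2 * x s * f s) volume a b ∧
      x b ^ 2 - x a ^ 2 = ∫ s in a..b, 2 * x s * f s := by
  have htt : t₀ ≤ t := ha.1.trans ha.2
  have hint : IntervalIntegrable f volume t₀ t := by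
    rw [intervalIntegrable_iff_integrableOn_Icc_of_le htt]; exact hf
  have hsub : uIcc a b ⊆ uIcc t₀ t := by
    rw [uIcc_of_le hab, uIcc_of_le htt]; exact Icc_subset_Icc ha.1 hb.2
  have hab1 : IntervalIntegrable f volume a b := hint.mono_set hsub
  set X : ℝ → ℝ := fun s => x0 + ∫ y in t₀..s, f y with hX
  have hc : AbsolutelyContinuousOnInterval (fun _ : ℝ => x0) t₀ t :=
    ((LipschitzWith.const x0).lipschitzOnWith (s := uIcc t₀ t)).absolutelyContinuousOnInterval
  have hXac : AbsolutelyContinuousOnInterval X t₀ t :=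
    hc.fun_add (hint.absolutelyContinuousOnInterval_intervalIntegral (c := t₀) (by simp))
  have hXab := hXac.mono hsub
  have h2 := hXab.integral_deriv_mul_eq_sub hXab
  have hder := hint.ae_hasDerivAt_integral
  have hxX : ∀ s ∈ uIcc a b, x s = X s := by
    intro s hs
    have := hsub hs
    rw [uIcc_of_le htt] at this
    exact hx s this
  have hxc : ContinuousOn x (uIcc a b) := hXab.continuousOn.congr hxX
  constructor
  · exact hab1.continuousOn_mul (continuousOn_const.mul hxc)
  · rw [hxX b right_mem_uIcc, hxX a left_mem_uIcc, pow_two, pow_two, ← h2]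
    apply intervalIntegral.integral_congr_ae
    filter_upwards [hder] with s hs hs'
    have hs1 : s ∈ uIcc a b := uIoc_subset_uIcc hs'
    have := (hs (hsub hs1) t₀ (by simp)).const_add x0
    rw [hxX s hs1, show deriv X s = f s from this.deriv]
    ring

lemma aux_aumann {n : ℕ} {ε : ℝ} (hε : ε ∈ Icc (0 : ℝ) (1 / 5)) {γ : ℝ} (hγ : 0 < γ)
    (μ : IdxZ n → Measure ℝ) (hM : HypM γ μ) (p : IdxZ n) (F : ℝ → ℝ) {y : ℝ}
    (hy : y ∈ aumann (fun τ => chiSet ε (F τ)) (μ p)) : 0 ≤ y ∧ y ≤ mTot μ p := by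
  obtain ⟨s, hs, hsi, hsF, rfl⟩ := hy
  have h01 : ∀ t ≤ (0 : ℝ), s t ∈ Icc (0 : ℝ) 1 := by
    intro t ht
    have h := hsF t ht
    simp only [chiSet] at h
    obtain ⟨h1, h2⟩ := hε
    split_ifs at h
    · exact ⟨h.1, by linarith [h.2]⟩
    · exact h
    · exact ⟨by linarith [h.1], h.2⟩
  have hfin : μ p (Iic 0) < ⊤ := by
    refine lt_of_le_of_lt ?_ (hM p)
    rw [← setLIntegral_one]
    apply setLIntegral_mono' measurableSet_Iic
    intro x hx
    have hx : x ≤ 0 := hx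
    rw [← ENNReal.ofReal_one]
    apply ENNReal.ofReal_le_ofReal
    apply Real.one_le_exp
    nlinarith
  constructor
  · exact setIntegral_nonneg measurableSet_Iic fun t ht => (h01 t ht).1
  · have h3 : ∫ t in Iic (0 : ℝ), s t ∂(μ p) ≤ ∫ t in Iic (0 : ℝ), (1 : ℝ) ∂(μ p) := by
      apply setIntegral_mono_on hsi _ measurableSet_Iic fun t ht => (h01 t ht).2
      exact integrableOn_const hfin.ne
    simpa [mTot, Measure.real] using h3

lemma aux_X {n : ℕ} {ε : ℝ} (hε : ε ∈ Icc (0 : ℝ) (1 / 5)) {γ : ℝ} (hγ : 0 < γ)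
    (μ : IdxZ n → Measure ℝ) (hM : HypM γ μ) (c d : IdxZ n → ℝ) (Γ : Fin n → ℝ)
    (u : ℝ → NState n) {v : NState n} (hv : v ∈ Xset ε μ c d Γ u) :
    ∃ m m' : IdxZ n → ℝ, (∀ p, 0 ≤ m p ∧ m p ≤ mTot μ p) ∧ (∀ p, 0 ≤ m' p ∧ m' p ≤ mTot μ p) ∧
      (∀ i, v.1 i = ∑ k : Fin n, if h : k ≠ i then
        ((u 0).2 ⟨(k, i), h⟩ - c ⟨(k, i), h⟩) * m ⟨(k, i), h⟩ else 0) ∧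
      ∀ p : IdxZ n, v.2 p = d p * max ((u 0).1 p.1.2) 0 * m' p := by
  obtain ⟨h1, h2⟩ := hv
  choose g hg0 hg hgs using h1
  have h3 : ∀ p : IdxZ n, ∃ y, (0 ≤ y ∧ y ≤ mTot μ p) ∧
      g p.1.2 p.1.1 = ((u 0).2 p - c p) * y := by
    intro p
    obtain ⟨y, hy, hy'⟩ := hg p.1.2 p.1.1 p.2
    exact ⟨y, aux_aumann hε hγ μ hM p _ hy, hy'.symm⟩
  have h4 : ∀ p : IdxZ n, ∃ y, (0 ≤ y ∧ y ≤ mTot μ p) ∧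
      v.2 p = d p * max ((u 0).1 p.1.2) 0 * y := by
    intro p
    obtain ⟨y, hy, hy'⟩ := h2 p
    exact ⟨y, aux_aumann hε hγ μ hM p _ hy, hy'.symm⟩
  choose m hm hm' using h3
  choose m' hmm hmm' using h4
  refine ⟨m, m', hm, hmm, ?_, hmm'⟩
  intro i
  rw [hgs i]
  apply Finset.sum_congr rfl
  intro k _
  by_cases h : k = i
  · subst h; simp [hg0]
  · rw [dif_pos h]; exact hm' ⟨(k, i), h⟩

lemma aux_sum {n : ℕ} (F : IdxZ n → ℝ) :
    ∑ i : Fin n, ∑ k : Fin n, (if h : k ≠ i then F ⟨(k, i), h⟩ else 0) = ∑ p, F p := by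
  rw [Finset.sum_comm]
  rw [← Fintype.sum_prod_type' (f := fun k i : Fin n => if h : k ≠ i then F ⟨(k, i), h⟩ else 0)]
  symm
  apply Finset.sum_of_injOn (e := Subtype.val)
  · exact Subtype.val_injective.injOn
  · intro p _; simp
  · intro p _ hp
    rw [dif_neg]
    intro h
    exact hp ⟨⟨p, h⟩, by simp, rfl⟩
  · intro p _
    rw [dif_pos p.2]

lemma aux_sum_mul {n : ℕ} (w : Fin n → ℝ) (F : IdxZ n → ℝ) :
    ∑ i : Fin n, w i * ∑ k : Fin n, (if h : k ≠ i then F ⟨(k, i), h⟩ else 0)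
      = ∑ p : IdxZ n, w p.1.2 * F p := by
  rw [← aux_sum]
  apply Finset.sum_congr rfl
  intro i _
  rw [Finset.mul_sum]
  apply Finset.sum_congr rfl
  intro k _
  split_ifs <;> simp

lemma aux_young {A B M x z : ℝ} (hA : 0 ≤ A) (hB : 0 ≤ B) (hAB : A * B = M ^ 2) :
    2 * (M * (|x| * |z|)) ≤ A * x ^ 2 + B * z ^ 2 := by
  apply abs_le_of_sq_le_sq' _ (by positivity) |>.2
  have h1 : (2 * (M * (|x| * |z|))) ^ 2 = 4 * (A * B) * (x ^ 2 * z ^ 2) := by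
    rw [hAB, ← sq_abs x, ← sq_abs z]; ring
  rw [h1]
  nlinarith [sq_nonneg (A * x ^ 2 - B * z ^ 2)]

lemma aux_alg {n : ℕ} {α : ℝ} (μ : IdxZ n → Measure ℝ) (c d : IdxZ n → ℝ)
    (hA : HypA α μ d) (hc : ∀ p, 0 ≤ c p) (hd : ∀ p, 0 ≤ d p) :
    ∃ δ > 0, ∃ C ≥ 0, ∃ C' ≥ 0, ∀ (x a J : Fin n → ℝ) (z b m m' : IdxZ n → ℝ),
      (∀ i, α ≤ a i) → (∀ p, α ≤ b p) → (∀ p, 0 ≤ m p ∧ m p ≤ mTot μ p) →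
      (∀ p, 0 ≤ m' p ∧ m' p ≤ mTot μ p) →
      ∑ i, 2 * x i * (-(a i) * x i + (∑ k : Fin n, if h : k ≠ i then
          (z ⟨(k, i), h⟩ - c ⟨(k, i), h⟩) * m ⟨(k, i), h⟩ else 0) + J i) +
        ∑ p : IdxZ n, 2 * z p * (-(b p) * z p + d p * max (x p.1.2) 0 * m' p) ≤
      -δ * (∑ i, x i ^ 2 + ∑ p, z p ^ 2) + C + C' * ∑ i, J i ^ 2 := by
  obtain ⟨lx, lz, nx, nz, eta, eps, hp, hi⟩ := hA
  obtain ⟨δ, hδ1, hδ2, hδ0⟩ : ∃ δ : ℝ, (∀ p, nz p / eta p + lz p / eps p ≤ 2 * α - δ) ∧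
      (∀ i : Fin n, (∑ k : Fin n, if h : k ≠ i then
          nx ⟨(k, i), h⟩ * eta ⟨(k, i), h⟩ + lx ⟨(k, i), h⟩ * eps ⟨(k, i), h⟩
        else 0) ≤ 2 * α - δ) ∧ 0 < δ := by
    have key : ∀ y : ℝ, y < 2 * α → ∀ᶠ δ in 𝓝[>] (0 : ℝ), y ≤ 2 * α - δ := by
      intro y hy
      have : ∀ᶠ δ in 𝓝 (0 : ℝ), δ < 2 * α - y := gt_mem_nhds (by linarith)
      filter_upwards [nhdsWithin_le_nhds this] with δ h
      linarith
    have e1 : ∀ᶠ δ in 𝓝[>] (0 : ℝ), ∀ p, nz p / eta p + lz p / eps p ≤ 2 * α - δ :=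
      eventually_all.2 fun p => key _ (hp p).2.2.2.2.2.2.2.2
    have e2 : ∀ᶠ δ in 𝓝[>] (0 : ℝ), ∀ i : Fin n, (∑ k : Fin n, if h : k ≠ i then
          nx ⟨(k, i), h⟩ * eta ⟨(k, i), h⟩ + lx ⟨(k, i), h⟩ * eps ⟨(k, i), h⟩
        else 0) ≤ 2 * α - δ := eventually_all.2 fun i => key _ (hi i)
    exact (e1.and (e2.and self_mem_nhdsWithin)).exists
  set K : Fin n → ℝ := fun i => ∑ k : Fin n, if h : k ≠ i then
    c ⟨(k, i), h⟩ * mTot μ ⟨(k, i), h⟩ else 0 with hK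
  have hmt : ∀ p, 0 ≤ mTot μ p := fun p => ENNReal.toReal_nonneg
  refine ⟨δ / 2, by positivity, ∑ i, 4 * K i ^ 2 / δ, by positivity, 4 / δ, by positivity, ?_⟩
  intro x a J z b m m' ha hb hm hm'
  have hP : ∀ p : IdxZ n, 2 * x p.1.2 * ((z p - c p) * m p) +
      2 * z p * (d p * max (x p.1.2) 0 * m' p) ≤
      x p.1.2 ^ 2 * (nx p * eta p + lx p * eps p) + (2 * α - δ) * z p ^ 2 +
      2 * |x p.1.2| * (c p * mTot μ p) := by
    intro p
    obtain ⟨h1, h2, h3, h4, h5, h6, h7, h8, -⟩ := hp p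
    have hlx : 0 ≤ lx p := by
      simp only [mem_insert_iff, mem_singleton_iff] at h1
      rcases h1 with h | h | h | h <;> rw [h] <;> positivity
    have hlz : 0 ≤ lz p := by
      simp only [mem_insert_iff, mem_singleton_iff] at h2
      rcases h2 with h | h | h | h <;> rw [h] <;> positivity
    have hnx : 0 ≤ nx p := by
      simp only [mem_insert_iff, mem_singleton_iff] at h4
      rcases h4 with h | h <;> rw [h] <;> positivity
    have hnz : 0 ≤ nz p := by
      simp only [mem_insert_iff, mem_singleton_iff] at h5
      rcases h5 with h | h <;> rw [h] <;> positivity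
    have y1 := aux_young (A := nx p * eta p) (B := nz p / eta p) (M := mTot μ p)
      (x := x p.1.2) (z := z p) (by positivity) (by positivity) (by rw [← h6]; field_simp)
    have y2 := aux_young (A := lx p * eps p) (B := lz p / eps p) (M := mTot μ p * d p)
      (x := x p.1.2) (z := z p) (by positivity) (by positivity)
      (by rw [mul_pow, ← h3]; field_simp)
    obtain ⟨hm0, hm1⟩ := hm p
    obtain ⟨hm0', hm1'⟩ := hm' p
    have b1 : x p.1.2 * z p * m p ≤ mTot μ p * (|x p.1.2| * |z p|) := by
      calc x p.1.2 * z p * m p ≤ |x p.1.2 * z p| * m p := by gcongr; exact le_abs_self _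
        _ ≤ |x p.1.2 * z p| * mTot μ p := by gcongr
        _ = _ := by rw [abs_mul]; ring
    have b2 : -(x p.1.2) * c p * m p ≤ |x p.1.2| * (c p * mTot μ p) := by
      have := hc p
      calc -(x p.1.2) * c p * m p ≤ |x p.1.2| * c p * m p := by gcongr; exact neg_le_abs _
        _ ≤ |x p.1.2| * c p * mTot μ p := by gcongr
        _ = _ := by ring
    have b3 : z p * (d p * max (x p.1.2) 0 * m' p) ≤
        mTot μ p * d p * (|x p.1.2| * |z p|) := by
      have := hd p
      calc z p * (d p * max (x p.1.2) 0 * m' p)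
          ≤ |z p| * (d p * max (x p.1.2) 0 * m' p) := by
            gcongr; exact le_abs_self _
        _ ≤ |z p| * (d p * |x p.1.2| * mTot μ p) := by
            gcongr; exact max_le (le_abs_self _) (abs_nonneg _)
        _ = _ := by ring
    have b4 : (nz p / eta p + lz p / eps p) * z p ^ 2 ≤ (2 * α - δ) * z p ^ 2 := by
      gcongr; exact hδ1 p
    nlinarith
  have hPs := Finset.sum_le_sum fun p (_ : p ∈ Finset.univ) => hP p
  simp only [Finset.sum_add_distrib] at hPs
  rw [← aux_sum_mul (fun i => 2 * x i) (fun p => (z p - c p) * m p),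
    ← aux_sum_mul (fun i => x i ^ 2) (fun p => nx p * eta p + lx p * eps p),
    ← aux_sum_mul (fun i => 2 * |x i|) (fun p => c p * mTot μ p), ← Finset.mul_sum] at hPs
  have hZ : ∑ p : IdxZ n, 2 * z p * (-(b p) * z p + d p * max (x p.1.2) 0 * m' p) ≤
      -(2 * α) * ∑ p, z p ^ 2 + ∑ p : IdxZ n, 2 * z p * (d p * max (x p.1.2) 0 * m' p) := by
    rw [Finset.mul_sum, ← Finset.sum_add_distrib]
    apply Finset.sum_le_sum
    intro p _
    nlinarith [mul_nonneg (sub_nonneg.2 (hb p)) (sq_nonneg (z p))]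
  have hXX : ∀ i, 2 * x i * (-(a i) * x i + (∑ k : Fin n, if h : k ≠ i then
          (z ⟨(k, i), h⟩ - c ⟨(k, i), h⟩) * m ⟨(k, i), h⟩ else 0) + J i) ≤
      (2 * x i * (∑ k : Fin n, if h : k ≠ i then
          (z ⟨(k, i), h⟩ - c ⟨(k, i), h⟩) * m ⟨(k, i), h⟩ else 0)) -
      (x i ^ 2 * ∑ k : Fin n, (if h : k ≠ i then
          nx ⟨(k, i), h⟩ * eta ⟨(k, i), h⟩ + lx ⟨(k, i), h⟩ * eps ⟨(k, i), h⟩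
        else 0)) - (2 * |x i| * K i) + (-(δ / 2) * x i ^ 2 + 4 * K i ^ 2 / δ
          + 4 / δ * J i ^ 2) := by
    intro i
    have h1 := mul_nonneg (sub_nonneg.2 (ha i)) (sq_nonneg (x i))
    have h2 := mul_nonneg (sub_nonneg.2 (hδ2 i)) (sq_nonneg (x i))
    have h3 : 2 * |x i| * K i ≤ δ / 4 * x i ^ 2 + 4 * K i ^ 2 / δ := by
      have := sq_nonneg (δ / 2 * |x i| - 2 * K i)
      rw [← sq_abs (x i), ← sub_nonneg]
      have h : δ / 4 * |x i| ^ 2 + 4 * K i ^ 2 / δ - 2 * |x i| * K i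
        = (δ / 2 * |x i| - 2 * K i) ^ 2 / δ := by field_simp; ring
      rw [h]; positivity
    have h4 : 2 * x i * J i ≤ δ / 4 * x i ^ 2 + 4 / δ * J i ^ 2 := by
      rw [← sub_nonneg]
      have h : δ / 4 * x i ^ 2 + 4 / δ * J i ^ 2 - 2 * x i * J i
        = (δ / 2 * x i - 2 * J i) ^ 2 / δ := by field_simp; ring
      rw [h]; positivity
    nlinarith
  have hXs := Finset.sum_le_sum fun i (_ : i ∈ Finset.univ) => hXX i
  simp only [Finset.sum_add_distrib (f := fun i => _ - _ - _), Finset.sum_sub_distrib] at hXs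
  have hlast : ∑ i, (-(δ / 2) * x i ^ 2 + 4 * K i ^ 2 / δ + 4 / δ * J i ^ 2) =
    -(δ / 2) * ∑ i, x i ^ 2 + ∑ i, 4 * K i ^ 2 / δ + 4 / δ * ∑ i, J i ^ 2 := by
    simp only [Finset.sum_add_distrib, Finset.mul_sum]
  have hzz : 0 ≤ ∑ p, z p ^ 2 := by positivity
  simp only [hK] at *
  nlinarith [mul_nonneg hδ0.le hzz]
def energyV {n : ℕ} (v : NState n) : ℝ := ∑ i, v.1 i ^ 2 + ∑ p, v.2 p ^ 2

lemma norm_le_energy {n : ℕ} (v : NState n) {R : ℝ} (h : energyV v ≤ R) : ‖v‖ ≤ √R := by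
  have h1 : ∀ i, v.1 i ^ 2 ≤ R := fun i => by
    have := Finset.single_le_sum (f := fun i => v.1 i ^ 2) (fun i _ => sq_nonneg _)
      (Finset.mem_univ i)
    have h2 : 0 ≤ ∑ p, v.2 p ^ 2 := by positivity
    unfold energyV at h
    linarith
  have h2 : ∀ p, v.2 p ^ 2 ≤ R := fun p => by
    have := Finset.single_le_sum (f := fun i => v.2 i ^ 2) (fun i _ => sq_nonneg _)
      (Finset.mem_univ p)
    have h2 : 0 ≤ ∑ p, v.1 p ^ 2 := by positivity
    unfold energyV at h
    linarith
  rw [Prod.norm_def]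
  apply max_le
  · rw [pi_norm_le_iff_of_nonneg (Real.sqrt_nonneg _)]
    intro i
    exact Real.abs_le_sqrt (h1 i)
  · rw [pi_norm_le_iff_of_nonneg (Real.sqrt_nonneg _)]
    intro i
    exact Real.abs_le_sqrt (h2 i)

lemma coord1_le {n : ℕ} (v : NState n) (i : Fin n) : |v.1 i| ≤ ‖v‖ :=
  (norm_le_pi_norm v.1 i).trans (norm_fst_le v)

lemma coord2_le {n : ℕ} (v : NState n) (p : IdxZ n) : |v.2 p| ≤ ‖v‖ :=
  (norm_le_pi_norm v.2 p).trans (norm_snd_le v)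

lemma energy_le {n : ℕ} (v : NState n) {r : ℝ} (h : ‖v‖ ≤ r) :
    energyV v ≤ (n + Fintype.card (IdxZ n) : ℝ) * r ^ 2 := by
  have h1 : ∀ i, v.1 i ^ 2 ≤ r ^ 2 := fun i =>
    sq_le_sq' (by linarith [neg_abs_le (v.1 i), coord1_le v i])
      (by linarith [le_abs_self (v.1 i), coord1_le v i])
  have h2 : ∀ i, v.2 i ^ 2 ≤ r ^ 2 := fun i =>
    sq_le_sq' (by linarith [neg_abs_le (v.2 i), coord2_le v i])
      (by linarith [le_abs_self (v.2 i), coord2_le v i])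
  have h3 := Finset.sum_le_card_nsmul Finset.univ _ _ fun i _ => h1 i
  have h4 := Finset.sum_le_card_nsmul Finset.univ _ _ fun i _ => h2 i
  simp only [nsmul_eq_mul, Finset.card_univ, Fintype.card_fin] at h3 h4
  unfold energyV
  linarith

lemma energy_cont {n : ℕ} : Continuous (energyV (n := n)) := by
  unfold energyV
  fun_prop

lemma sol_bound_s18 {n : ℕ} (γbar α : ℝ) (hγbar : 0 < γbar)
    (A : Fin n → ℝ → ℝ) (B : IdxZ n → ℝ → ℝ) (μ : IdxZ n → Measure ℝ)
    (c d : IdxZ n → ℝ) (Γ : Fin n → ℝ) (Istim : Fin n → ℝ → ℝ)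
    (hD : HypD α A B) (hM : HypM γbar μ)
    (hA : HypA α μ d)
    (hc : ∀ p, 0 ≤ c p) (hd : ∀ p, 0 ≤ d p)
    (hI2 : ∀ i, Integrable (fun s => Istim i s ^ 2)) (r : ℝ) :
    ∃ R, 0 ≤ R ∧ ∀ ε ∈ Icc (0 : ℝ) (1 / 5), ∀ t₀ t : ℝ, ∀ u₀ u : ℝ → NState n,
      IsIncSolOn ε A B μ c d Γ Istim t₀ t u₀ u → ‖u₀ 0‖ ≤ r →
      ∀ s ∈ Icc t₀ t, ‖u s‖ ≤ R := by
  obtain ⟨δ, hδ, C, hC, C', hC', halg⟩ := aux_alg μ c d hA hc hd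
  set M := max ((n + Fintype.card (IdxZ n) : ℝ) * r ^ 2) (C / δ) with hMdef
  set T := C' * ∑ i, ∫ s, Istim i s ^ 2 with hT
  have hT0 : 0 ≤ T := mul_nonneg hC' (Finset.sum_nonneg fun i _ =>
    integral_nonneg fun s => sq_nonneg _)
  refine ⟨√(M + T), Real.sqrt_nonneg _, ?_⟩
  intro ε hε t₀ t u₀ u hu hr s₁ hs₁
  apply norm_le_energy
  obtain ⟨hu0, hucont, S, hS, hFint, hFeq⟩ := hu
  set F := fun s => decayT A B (hist u s) + S s + stimT Istim s with hF
  have hut0 : u t₀ = u₀ 0 := by simpa using hu0 0 le_rfl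
  have htt : t₀ ≤ t := hs₁.1.trans hs₁.2
  by_contra! hcon
  have hVc : ContinuousOn (fun s => energyV (u s)) (Icc t₀ s₁) :=
    energy_cont.comp_continuousOn (hucont.mono (Icc_subset_Icc_right hs₁.2))
  have hcl : IsCompact (Icc t₀ s₁ ∩ (fun s => energyV (u s)) ⁻¹' Iic M) :=
    isCompact_Icc.of_isClosed_subset (hVc.preimage_isClosed_of_isClosed isClosed_Icc isClosed_Iic)
      inter_subset_left
  obtain ⟨a, ⟨ha1, ha2⟩, ha3⟩ := hcl.exists_isGreatest
    ⟨t₀, ⟨le_rfl, hs₁.1⟩, by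
      simp only [mem_preimage, mem_Iic, hut0]
      exact (energy_le _ hr).trans (le_max_left _ _)⟩
  simp only [mem_preimage, mem_Iic] at ha2
  have haI : a ∈ Icc t₀ t := ⟨ha1.1, ha1.2.trans hs₁.2⟩
  have hbig : ∀ s ∈ Ioc a s₁, M < energyV (u s) := by
    intro s hs
    by_contra! h
    exact absurd (ha3 ⟨⟨ha1.1.trans hs.1.le, hs.2⟩, h⟩) (not_le.2 hs.1)
  -- squares
  have hcomp : ∀ ℓ : NState n →L[ℝ] ℝ,
      IntervalIntegrable (fun s => 2 * ℓ (u s) * ℓ (F s)) volume a s₁ ∧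
      ℓ (u s₁) ^ 2 - ℓ (u a) ^ 2 = ∫ s in a..s₁, 2 * ℓ (u s) * ℓ (F s) := by
    intro ℓ
    refine aux_sq (f := fun s => ℓ (F s)) (x := fun s => ℓ (u s)) (x0 := ℓ (u₀ 0)) (t₀ := t₀)
      (t := t) (ℓ.integrable_comp hFint) ?_ haI hs₁ ha1.2
    intro s hs
    rw [hFeq s hs, map_add]
    congr 1
    symm
    apply ℓ.intervalIntegral_comp_comm
    rw [intervalIntegrable_iff_integrableOn_Icc_of_le hs.1]
    exact hFint.mono_set (Icc_subset_Icc_right hs.2)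
  have hc1 : ∀ i, IntervalIntegrable (fun s => 2 * (u s).1 i * (F s).1 i) volume a s₁ ∧
      (u s₁).1 i ^ 2 - (u a).1 i ^ 2 = ∫ s in a..s₁, 2 * (u s).1 i * (F s).1 i := fun i =>
    hcomp ((ContinuousLinearMap.proj i).comp (ContinuousLinearMap.fst ℝ _ _))
  have hc2 : ∀ i, IntervalIntegrable (fun s => 2 * (u s).2 i * (F s).2 i) volume a s₁ ∧
      (u s₁).2 i ^ 2 - (u a).2 i ^ 2 = ∫ s in a..s₁, 2 * (u s).2 i * (F s).2 i := fun i =>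
    hcomp ((ContinuousLinearMap.proj i).comp (ContinuousLinearMap.snd ℝ _ _))
  have hi1 : IntervalIntegrable (fun s => ∑ i, 2 * (u s).1 i * (F s).1 i) volume a s₁ := by
    have := IntervalIntegrable.sum (s := Finset.univ) fun i _ => (hc1 i).1
    simpa [Finset.sum_fn] using this
  have hi2 : IntervalIntegrable (fun s => ∑ i, 2 * (u s).2 i * (F s).2 i) volume a s₁ := by
    have := IntervalIntegrable.sum (s := Finset.univ) fun i _ => (hc2 i).1
    simpa [Finset.sum_fn] using this
  have hVeq : energyV (u s₁) - energyV (u a) = ∫ s in a..s₁,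
      (∑ i, 2 * (u s).1 i * (F s).1 i + ∑ i, 2 * (u s).2 i * (F s).2 i) := by
    rw [intervalIntegral.integral_add hi1 hi2,
      intervalIntegral.integral_finsetSum fun i _ => (hc1 i).1,
      intervalIntegral.integral_finsetSum fun i _ => (hc2 i).1]
    simp only [← (hc1 _).2, ← (hc2 _).2, Finset.sum_sub_distrib, energyV]
    ring
  have hJint : Integrable (fun s => C' * ∑ i, Istim i s ^ 2) :=
    (integrable_finsetSum _ fun i _ => hI2 i).const_mul _
  have hle : ∫ s in a..s₁,
      (∑ i, 2 * (u s).1 i * (F s).1 i + ∑ i, 2 * (u s).2 i * (F s).2 i) ≤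
      ∫ s in a..s₁, C' * ∑ i, Istim i s ^ 2 := by
    rw [intervalIntegral.integral_of_le ha1.2, intervalIntegral.integral_of_le ha1.2]
    apply setIntegral_mono_on ((intervalIntegrable_iff_integrableOn_Ioc_of_le ha1.2).1
      (hi1.add hi2)) hJint.integrableOn measurableSet_Ioc
    intro s hs
    have hsI : s ∈ Icc t₀ t := ⟨ha1.1.trans hs.1.le, hs.2.trans hs₁.2⟩
    obtain ⟨m, m', hm, hm', hS1, hS2⟩ := aux_X hε hγbar μ hM c d Γ _ (hS s hsI)
    have := halg (u s).1 (fun i => A i ((u s).1 i)) (fun i => Istim i s) (u s).2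
      (fun p => B p ((u s).2 p)) m m' (fun i => (hD.2.1 i).2 _) (fun p => (hD.2.2 p).2 _) hm hm'
    have e1 : ∀ i, (F s).1 i = -(A i ((u s).1 i)) * (u s).1 i + (∑ k : Fin n, if h : k ≠ i then
          ((u s).2 ⟨(k, i), h⟩ - c ⟨(k, i), h⟩) * m ⟨(k, i), h⟩ else 0) + Istim i s := by
      intro i
      simp [hF, decayT, stimT, hist, hS1]
    have e2 : ∀ p, (F s).2 p = -(B p ((u s).2 p)) * (u s).2 p +
        d p * max ((u s).1 p.1.2) 0 * m' p := by
      intro i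
      simp [hF, decayT, stimT, hist, hS2]
    simp only [e1, e2]
    refine this.trans ?_
    have hb := hbig s hs
    have hb2 : C / δ < energyV (u s) := (le_max_right _ _).trans_lt hb
    rw [div_lt_iff₀ hδ] at hb2
    unfold energyV at hb2
    nlinarith
  have hle2 : ∫ s in a..s₁, C' * ∑ i, Istim i s ^ 2 ≤ T := by
    rw [intervalIntegral.integral_of_le ha1.2]
    refine (setIntegral_le_integral hJint (Eventually.of_forall fun s => ?_)).trans ?_
    · exact mul_nonneg hC' (Finset.sum_nonneg fun i _ => sq_nonneg _)
    · rw [integral_const_mul, integral_finsetSum _ fun i _ => hI2 i]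
  linarith
lemma sol_lip {n : ℕ} (γbar α : ℝ) (hγbar : 0 < γbar)
    (A : Fin n → ℝ → ℝ) (B : IdxZ n → ℝ → ℝ) (μ : IdxZ n → Measure ℝ)
    (c d : IdxZ n → ℝ) (Γ : Fin n → ℝ) (Istim : Fin n → ℝ → ℝ)
    (hD : HypD α A B) (hM : HypM γbar μ) (hI : HypI Istim)
    (hc : ∀ p, 0 ≤ c p) (hd : ∀ p, 0 ≤ d p) (R : ℝ) (hR : 0 ≤ R) (t₁ t : ℝ) :
    ∃ L, 0 ≤ L ∧ ∀ ε ∈ Icc (0 : ℝ) (1 / 5), ∀ t₀ : ℝ, ∀ u₀ u : ℝ → NState n,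
      IsIncSolOn ε A B μ c d Γ Istim t₀ t u₀ u → (∀ s ∈ Icc t₀ t, ‖u s‖ ≤ R) →
      ∀ a ∈ Icc t₀ t, ∀ b ∈ Icc t₀ t, t₁ ≤ a → t₁ ≤ b → ‖u b - u a‖ ≤ L * |b - a| := by
  have hKA : ∀ i, ∃ K, ∀ y ∈ Icc (-R) R, ‖A i y‖ ≤ K := fun i =>
    isCompact_Icc.exists_bound_of_continuousOn (hD.2.1 i).1.continuous.continuousOn
  have hKB : ∀ i, ∃ K, ∀ y ∈ Icc (-R) R, ‖B i y‖ ≤ K := fun i =>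
    isCompact_Icc.exists_bound_of_continuousOn (hD.2.2 i).1.continuous.continuousOn
  have hKI : ∀ i, ∃ K, ∀ y ∈ Icc t₁ t, ‖Istim i y‖ ≤ K := fun i =>
    isCompact_Icc.exists_bound_of_continuousOn (hI i).continuousOn
  choose KA hKA using hKA
  choose KB hKB using hKB
  choose KI hKI using hKI
  have hmt : ∀ p, 0 ≤ mTot μ p := fun p => ENNReal.toReal_nonneg
  set L1 : Fin n → ℝ := fun i => KA i * R + (∑ k : Fin n, if h : k ≠ i then
    (R + c ⟨(k, i), h⟩) * mTot μ ⟨(k, i), h⟩ else 0) + KI i with hL1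
  set L2 : IdxZ n → ℝ := fun p => KB p * R + d p * R * mTot μ p with hL2
  obtain ⟨b1, hb1⟩ := (Set.finite_range L1).bddAbove
  obtain ⟨b2, hb2⟩ := (Set.finite_range L2).bddAbove
  refine ⟨max 0 (max b1 b2), le_max_left _ _, ?_⟩
  intro ε hε t₀ u₀ u hu hbd
  obtain ⟨hu0, hucont, S, hS, hFint, hFeq⟩ := hu
  set F := fun s => decayT A B (hist u s) + S s + stimT Istim s with hF
  have hFb : ∀ s ∈ Icc t₀ t, t₁ ≤ s → ‖F s‖ ≤ max 0 (max b1 b2) := by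
    intro s hs hs1
    obtain ⟨m, m', hm, hm', hS1, hS2⟩ := aux_X hε hγbar μ hM c d Γ _ (hS s hs)
    have e1 : ∀ i, (F s).1 i = -(A i ((u s).1 i)) * (u s).1 i + (∑ k : Fin n, if h : k ≠ i then
          ((u s).2 ⟨(k, i), h⟩ - c ⟨(k, i), h⟩) * m ⟨(k, i), h⟩ else 0) + Istim i s := by
      intro i
      simp [hF, decayT, stimT, hist, hS1]
    have e2 : ∀ p, (F s).2 p = -(B p ((u s).2 p)) * (u s).2 p +
        d p * max ((u s).1 p.1.2) 0 * m' p := by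
      intro i
      simp [hF, decayT, stimT, hist, hS2]
    have hx : ∀ i, |(u s).1 i| ≤ R := fun i => (coord1_le _ i).trans (hbd s hs)
    have hz : ∀ i, |(u s).2 i| ≤ R := fun i => (coord2_le _ i).trans (hbd s hs)
    rw [Prod.norm_def]
    apply max_le
    · rw [pi_norm_le_iff_of_nonneg (le_max_left _ _)]
      intro i
      refine le_trans ?_ ((hb1 ⟨i, rfl⟩ : L1 i ≤ b1).trans
        ((le_max_left _ _).trans (le_max_right _ _)))
      rw [Real.norm_eq_abs, e1]
      refine (abs_add_le _ _).trans (add_le_add ((abs_add_le _ _).trans (add_le_add ?_ ?_)) ?_)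
      · rw [abs_mul, abs_neg]
        have := hKA i _ (abs_le.1 (hx i))
        have h0 := (norm_nonneg _).trans this
        exact mul_le_mul this (hx i) (abs_nonneg _) h0
      · refine (Finset.abs_sum_le_sum_abs _ _).trans (Finset.sum_le_sum fun k _ => ?_)
        split_ifs with h
        · rw [abs_mul]
          refine mul_le_mul ?_ ?_ (abs_nonneg _) (add_nonneg hR (hc _))
          · refine (abs_sub _ _).trans (add_le_add (hz _) ?_)
            rw [abs_of_nonneg (hc _)]
          · rw [abs_of_nonneg (hm _).1]; exact (hm _).2
        · simp
      · exact hKI i s ⟨hs1, hs.2⟩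
    · rw [pi_norm_le_iff_of_nonneg (le_max_left _ _)]
      intro p
      refine le_trans ?_ ((hb2 ⟨p, rfl⟩ : L2 p ≤ b2).trans
        ((le_max_right _ _).trans (le_max_right _ _)))
      rw [Real.norm_eq_abs, e2]
      refine (abs_add_le _ _).trans (add_le_add ?_ ?_)
      · rw [abs_mul, abs_neg]
        have := hKB p _ (abs_le.1 (hz p))
        have h0 := (norm_nonneg _).trans this
        exact mul_le_mul this (hz p) (abs_nonneg _) h0
      · have h1 := hd p
        have h2 := (hm' p).1
        rw [abs_of_nonneg (by positivity)]
        gcongr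
        · exact max_le ((le_abs_self _).trans (hx _)) hR
        · exact (hm' p).2
  intro a ha b hb ha1 hb1
  have htt : t₀ ≤ t := ha.1.trans ha.2
  have hii : ∀ s ∈ Icc t₀ t, IntervalIntegrable F volume t₀ s := fun s hs => by
    rw [intervalIntegrable_iff_integrableOn_Icc_of_le hs.1]
    exact hFint.mono_set (Icc_subset_Icc_right hs.2)
  rw [hFeq b hb, hFeq a ha, add_sub_add_left_eq_sub,
    intervalIntegral.integral_interval_sub_left (hii b hb) (hii a ha)]
  apply intervalIntegral.norm_integral_le_of_norm_le_const
  intro s hs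
  rcases le_total a b with hab | hab
  · rw [uIoc_of_le hab] at hs
    exact hFb s ⟨ha.1.trans hs.1.le, hs.2.trans hb.2⟩ (ha1.trans hs.1.le)
  · rw [uIoc_of_ge hab] at hs
    exact hFb s ⟨hb.1.trans hs.1.le, hs.2.trans ha.2⟩ (hb1.trans hs.1.le)

lemma aux_ascoli {E : Type*} [NormedAddCommGroup E] [ProperSpace E] (v : ℕ → ℝ → E) (R : ℝ)
    (hR : ∀ m s, ‖v m s‖ ≤ R) (L : ℕ → ℝ)
    (hL : ∀ N : ℕ, ∀ m, ∀ a b : ℝ, -(N : ℝ) ≤ a → -(N : ℝ) ≤ b →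
      ‖v m b - v m a‖ ≤ L N * |b - a|) :
    ∃ φ : ℕ → ℕ, StrictMono φ ∧ ∃ w : ℝ → E, Continuous w ∧ (∀ s, ‖w s‖ ≤ R) ∧
      ∀ K, IsCompact K → TendstoUniformlyOn (fun k => v (φ k)) w atTop K := by
  have hcont : ∀ f : ℝ → E, (∀ N : ℕ, ∀ a b : ℝ, -(N : ℝ) ≤ a → -(N : ℝ) ≤ b →
      ‖f b - f a‖ ≤ L N * |b - a|) → Continuous f := by
    intro f hf
    rw [continuous_iff_continuousAt]
    intro x
    obtain ⟨N, hN⟩ := exists_nat_gt (-x)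
    rw [ContinuousAt, tendsto_iff_norm_sub_tendsto_zero]
    refine squeeze_zero' (Eventually.of_forall fun _ => norm_nonneg _) (g := fun y => L N * |y - x|)
      ?_ ?_
    · filter_upwards [lt_mem_nhds (show -(N : ℝ) < x by linarith)] with y hy
      exact hf N x y (by linarith) hy.le
    · have : Continuous fun y => L N * |y - x| := by fun_prop
      simpa using this.tendsto x
  set P : Set (ℝ → E) := {f | (∀ s, ‖f s‖ ≤ R) ∧ ∀ N : ℕ, ∀ a b : ℝ, -(N : ℝ) ≤ a →
      -(N : ℝ) ≤ b → ‖f b - f a‖ ≤ L N * |b - a|} with hP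
  set S : Set C(ℝ, E) := {f | (f : ℝ → E) ∈ P} with hS
  have himg : ContinuousMap.toFun '' S = P := by
    ext f
    constructor
    · rintro ⟨g, hg, rfl⟩; exact hg
    · intro hf; exact ⟨⟨f, hcont f hf.2⟩, hf, rfl⟩
  have hPc : IsClosed P := by
    simp only [hP, ofPred_and, ofPred_forall]
    refine (isClosed_iInter fun s => ?_).inter (isClosed_iInter fun N => isClosed_iInter fun a =>
      isClosed_iInter fun b => isClosed_iInter fun _ => isClosed_iInter fun _ => ?_)
    · exact isClosed_le (by fun_prop) continuous_const
    · exact isClosed_le (by fun_prop) continuous_const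
  have hPk : IsCompact P := by
    refine (isCompact_univ_pi fun _ : ℝ => isCompact_closedBall (0 : E) R).of_isClosed_subset hPc ?_
    intro f hf s _
    simpa using hf.1 s
  have hSk : IsCompact S := by
    apply ArzelaAscoli.isCompact_of_equicontinuous S (by rw [himg]; exact hPk)
    intro x
    obtain ⟨N, hN⟩ := exists_nat_gt (-x)
    refine Metric.equicontinuousAt_of_continuity_modulus (fun y => L N * |y - x|) ?_ _ ?_
    · have : Continuous fun y => L N * |y - x| := by fun_prop
      simpa using this.tendsto x
    · filter_upwards [lt_mem_nhds (show -(N : ℝ) < x by linarith)] with y hy f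
      rw [dist_comm, dist_eq_norm]
      exact f.2.2 N x y (by linarith) hy.le
  obtain ⟨w, hw, φ, hφ, hlim⟩ := hSk.tendsto_subseq
    (x := fun m => (⟨v m, hcont _ fun N => hL N m⟩ : C(ℝ, E))) fun m => ⟨hR m, fun N => hL N m⟩
  refine ⟨φ, hφ, w, w.continuous, hw.1, ?_⟩
  rw [ContinuousMap.tendsto_iff_forall_isCompact_tendstoUniformlyOn] at hlim
  exact hlim
/-- pullback asymptotic upper semicompactness of the attainability
process of the `ε`-inflated inclusion, within the universe of uniformly bounded
nonautonomous sets. -/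
theorem stmt18 {n : ℕ} (hn : 2 ≤ n) (γbar α : ℝ) (hγbar : 0 < γbar)
    (A : Fin n → ℝ → ℝ) (B : IdxZ n → ℝ → ℝ) (μ : IdxZ n → Measure ℝ)
    (c d : IdxZ n → ℝ) (Γ : Fin n → ℝ) (Istim : Fin n → ℝ → ℝ)
    (hD : HypD α A B) (hM : HypM γbar μ) (hI : HypI Istim)
    (hA : HypA α μ d)
    (hc : ∀ p, 0 ≤ c p) (hd : ∀ p, 0 ≤ d p)
    (hI2 : ∀ i, Integrable (fun s => Istim i s ^ 2)) :
    ∃ γ₀ > 0, γ₀ ≤ γbar ∧ ∀ γ ∈ Ioo (0 : ℝ) γ₀, ∀ ε ∈ Icc (0 : ℝ) (1 / 5),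
      ∀ t : ℝ, ∀ τ : ℕ → ℝ, Tendsto τ atTop atTop → ∀ r > (0 : ℝ),
      ∀ u₀ : ℕ → ℝ → NState n, ∀ u : ℕ → ℝ → NState n,
      (∀ m, InC γ (u₀ m)) → (∀ m, gNorm γ (u₀ m) ≤ r) →
      (∀ m, IsIncSolOn ε A B μ c d Γ Istim (t - τ m) t (u₀ m) (u m)) →
      ∃ φ : ℕ → ℕ, StrictMono φ ∧ ∃ w : ℝ → NState n, InC γ w ∧
        Tendsto (fun k => gNorm γ (fun s => hist (u (φ k)) t s - w s)) atTop (𝓝 0) := by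
  refine ⟨γbar, hγbar, le_rfl, ?_⟩
  intro γ hγ ε hε t τ hτ r hr u₀ u hC hN hsol
  have hγ0 : 0 < γ := hγ.1
  obtain ⟨R, hR0, hR⟩ := sol_bound_s18 γbar α hγbar A B μ c d Γ Istim hD hM hA hc hd hI2 r
  have hu0 : ∀ m, ∀ s ≤ (0 : ℝ), Real.exp (γ * s) * ‖u₀ m s‖ ≤ r := by
    intro m s hs
    exact (le_ciSup (hC m).2.2 (⟨s, hs⟩ : Iic (0 : ℝ))).trans (hN m)
  have hbd : ∀ m, ∀ s ∈ Icc (t - τ m) t, ‖u m s‖ ≤ R := fun m =>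
    hR ε hε _ _ _ _ (hsol m) (by simpa using hu0 m 0 le_rfl)
  have hlip := fun N : ℕ => sol_lip γbar α hγbar A B μ c d Γ Istim hD hM hI hc hd R hR0 (t - N) t
  choose L hL0 hL using hlip
  obtain ⟨M, hM0⟩ := eventually_atTop.1 (hτ.eventually_ge_atTop 0)
  set q : ℕ → ℝ → ℝ := fun m s => max (t - τ (m + M)) (t + min s 0) with hq
  have hqI : ∀ m s, q m s ∈ Icc (t - τ (m + M)) t := by
    intro m s
    have := hM0 (m + M) (by omega)
    exact ⟨le_max_left _ _, max_le (by linarith) (by linarith [min_le_right s 0])⟩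
  obtain ⟨φ, hφ, w, hwc, hwR, hlim⟩ := aux_ascoli (fun m s => u (m + M) (q m s)) R
    (fun m s => hbd _ _ (hqI m s)) L (by
      intro N m a b ha hb
      have hge : ∀ y : ℝ, -(N : ℝ) ≤ y → t - N ≤ q m y := by
        intro y hy
        refine le_trans ?_ (le_max_right _ _)
        have : -(N : ℝ) ≤ min y 0 := le_min hy (by simp)
        linarith
      refine (hL N ε hε _ _ _ (hsol (m + M)) (hbd _) _ (hqI m a) _ (hqI m b)
        (hge a ha) (hge b hb)).trans ?_
      refine mul_le_mul_of_nonneg_left ?_ (hL0 N)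
      refine (abs_max_sub_max_le_max _ _ _ _).trans ?_
      simp only [sub_self, abs_zero, add_sub_add_left_eq_sub]
      refine max_le (abs_nonneg _) ((abs_min_sub_min_le_max _ _ _ _).trans ?_)
      simp)
  refine ⟨fun k => φ k + M, fun a b h => Nat.add_lt_add_right (hφ h) M, w, ⟨hwc.continuousOn,
    ⟨0, ?_⟩, ⟨R, ?_⟩⟩, ?_⟩
  · have hexp : Tendsto (fun s : ℝ => Real.exp (γ * s) * R) atBot (𝓝 0) := by
      have := (Real.tendsto_exp_atBot.comp (tendsto_id.const_mul_atBot hγ0)).mul_const R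
      simpa using this
    refine squeeze_zero_norm (fun s => ?_) hexp
    rw [norm_smul, Real.norm_eq_abs, Real.abs_exp]
    exact mul_le_mul_of_nonneg_left (hwR s) (Real.exp_pos _).le
  · rintro _ ⟨s, rfl⟩
    have h1 : Real.exp (γ * s.1) ≤ 1 := Real.exp_le_one_iff.2
      (mul_nonpos_of_nonneg_of_nonpos hγ0.le s.2)
    calc Real.exp (γ * s.1) * ‖w s.1‖ ≤ 1 * R :=
          mul_le_mul h1 (hwR _) (norm_nonneg _) zero_le_one
      _ = R := one_mul R
  · rw [Metric.tendsto_nhds]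
    intro η hη
    have hexp : Tendsto (fun T : ℝ => Real.exp (-(γ * T)) * (r + 2 * R)) atTop (𝓝 0) := by
      have h1 : Tendsto (fun T : ℝ => -(γ * T)) atTop atBot :=
        tendsto_neg_atTop_atBot.comp (tendsto_id.const_mul_atTop hγ0)
      have := (Real.tendsto_exp_atBot.comp h1).mul_const (r + 2 * R)
      simpa using this
    obtain ⟨T, hT⟩ := eventually_atTop.1 (hexp.eventually (gt_mem_nhds (half_pos hη)))
    have hun := Metric.tendstoUniformlyOn_iff.1 (hlim (Icc (-T) 0) isCompact_Icc) (η / 2)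
      (half_pos hη)
    have hτ2 : Tendsto (fun k => τ (φ k + M)) atTop atTop :=
      hτ.comp ((tendsto_add_atTop_nat M).comp hφ.tendsto_atTop)
    filter_upwards [hun, hτ2.eventually_ge_atTop T] with k hk hkT
    have hbound : ∀ s : Iic (0 : ℝ),
        Real.exp (γ * s.1) * ‖hist (u (φ k + M)) t s.1 - w s.1‖ ≤ η / 2 := by
      rintro ⟨s, hs⟩
      have hs : s ≤ 0 := hs
      have hsol0 := (hsol (φ k + M)).1
      have h1 : Real.exp (γ * s) ≤ 1 := Real.exp_le_one_iff.2
        (mul_nonpos_of_nonneg_of_nonpos hγ0.le hs)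
      have hmon : ∀ y, T ≤ y → s ≤ -y →
          Real.exp (γ * s) * (r + 2 * R) ≤ η / 2 := by
        intro y hy hsy
        refine le_trans ?_ (hT y hy).le
        refine mul_le_mul_of_nonneg_right (Real.exp_le_exp.2 ?_) (by positivity)
        nlinarith
      simp only [hist]
      by_cases hsτ : -τ (φ k + M) ≤ s
      · have hqs : q (φ k) s = t + s := by
          simp only [hq, min_eq_left hs]
          exact max_eq_right (by linarith)
        by_cases hsT : -T ≤ s
        · have := hk s ⟨hsT, hs⟩
          rw [dist_comm, dist_eq_norm, hqs] at this
          calc _ ≤ 1 * ‖u (φ k + M) (t + s) - w s‖ :=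
                mul_le_mul_of_nonneg_right h1 (norm_nonneg _)
            _ ≤ η / 2 := by rw [one_mul]; exact this.le
        · refine le_trans ?_ (hmon T le_rfl (not_le.1 hsT).le)
          refine mul_le_mul_of_nonneg_left ?_ (Real.exp_pos _).le
          have h2 := hbd _ _ (hqI (φ k) s)
          rw [hqs] at h2
          linarith [norm_sub_le (u (φ k + M) (t + s)) (w s), hwR s]
      · have hsτ := not_le.1 hsτ
        set τ' := τ (φ k + M) with hτ'
        have hu1 := hsol0 (s + τ') (by linarith)
        rw [show t - τ' + (s + τ') = t + s by ring] at hu1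
        have h3 := hu0 (φ k + M) (s + τ') (by linarith)
        rw [hu1]
        refine le_trans ?_ (hT τ' hkT).le
        have e1 : Real.exp (γ * s) = Real.exp (-(γ * τ')) * Real.exp (γ * (s + τ')) := by
          rw [← Real.exp_add]; ring_nf
        have e2 : Real.exp (γ * (s + τ')) ≤ 1 := Real.exp_le_one_iff.2
          (mul_nonpos_of_nonneg_of_nonpos hγ0.le (by linarith))
        rw [e1, mul_assoc]
        refine mul_le_mul_of_nonneg_left ?_ (Real.exp_pos _).le
        have e3 := mul_le_mul_of_nonneg_left (norm_sub_le (u₀ (φ k + M) (s + τ')) (w s))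
          (Real.exp_pos (γ * (s + τ'))).le
        have e4 : Real.exp (γ * (s + τ')) * ‖w s‖ ≤ 1 * R :=
          mul_le_mul e2 (hwR _) (norm_nonneg _) zero_le_one
        rw [mul_add (Real.exp (γ * (s + τ')))] at e3
        linarith
    have hle : gNorm γ (fun s => hist (u (φ k + M)) t s - w s) ≤ η / 2 := ciSup_le hbound
    have hge : 0 ≤ gNorm γ (fun s => hist (u (φ k + M)) t s - w s) :=
      Real.iSup_nonneg fun s => by positivity
    rw [Real.dist_eq, sub_zero, abs_of_nonneg hge]
    linarith

end
end
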